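/- arXiv:2602.16406 — 13 statements merged into one kernel-verified Lean document; each statement's English description precedes it below -/
import Mathlib

section
/- For any integers q ≥ 2, k ≥ 2, n ≥ 1 and any tuple (e_1,…,e_k) of nonnegative integers, the family of all (e_1,…,e_k)-CECCs in Φ_{q,k}^n and the family of all (e_k,e_{k−1},…,e_1)-CECCs in Φ_{q,k}^n are equivalent; explicitly, the map g : Φ_{q,k}^n → Φ_{q,k}^n acting columnwise by g([s_1,…,s_k]^T) = [q−1−s_k,…,q−1−s_2,q−1−s_1]^T is a bijection, g maps every (e_1,…,e_k)-CECC to an (e_k,…,e_1)-CECC, and g^{-1} maps every (e_k,…,e_1)-CECC to an (e_1,…,e_k)-CECC. -/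
/-- A sequence in `Φ_{q,k}^n`, viewed as a `k × n` matrix over `Σ_q = Fin q`,
is valid if every column is nondecreasing. -/
def ValidSeq (q k n : ℕ) (s : Fin k → Fin n → Fin q) : Prop :=
  ∀ j : Fin n, Monotone fun i : Fin k => s i j

/-- `C` is an `(e 0, …, e (k-1))`-CECC: its codewords are valid, and no word is
within substitution distance `e i` in row `i` of two distinct codewords. -/
def IsCECC (q k n : ℕ) (e : Fin k → ℕ) (C : Set (Fin k → Fin n → Fin q)) : Prop :=
  (∀ c ∈ C, ValidSeq q k n c) ∧
  ∀ c ∈ C, ∀ c' ∈ C, c ≠ c' →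
    ¬ ∃ y : Fin k → Fin n → Fin q,
        ∀ i : Fin k, hammingDist (y i) (c i) ≤ e i ∧ hammingDist (y i) (c' i) ≤ e i

/-- The families of `(e₁,…,e_k)`-CECCs and `(e_k,…,e₁)`-CECCs are equivalent,
via the explicit columnwise map `g([s₁,…,s_k]ᵀ) = [q-1-s_k,…,q-1-s₁]ᵀ`. -/
theorem stmt0 (q k n : ℕ) (hq : 2 ≤ q) (hk : 2 ≤ k) (hn : 1 ≤ n)
    (e : Fin k → ℕ)
    (g : (Fin k → Fin n → Fin q) → (Fin k → Fin n → Fin q))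
    (hg : g = fun s i j => (s i.rev j).rev) :
    Set.BijOn g {s | ValidSeq q k n s} {s | ValidSeq q k n s} ∧
    (∀ C : Set (Fin k → Fin n → Fin q),
      IsCECC q k n e C → IsCECC q k n (fun i => e i.rev) (g '' C)) ∧
    (∀ C : Set (Fin k → Fin n → Fin q),
      IsCECC q k n (fun i => e i.rev) C → IsCECC q k n e (g ⁻¹' C)) := by
  have hgg : ∀ s, g (g s) = s := by
    intro s; subst hg; funext i j; simp
  have hinj : Function.Injective g := Function.LeftInverse.injective hgg
  have hv : ∀ s, ValidSeq q k n s → ValidSeq q k n (g s) := by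
    intro s hs j a b hab
    subst hg
    exact Fin.rev_le_rev.mpr (hs j (Fin.rev_le_rev.mpr hab))
  have hd : ∀ (x y : Fin k → Fin n → Fin q) (i : Fin k),
      hammingDist (g x i) (g y i) = hammingDist (x i.rev) (y i.rev) := by
    intro x y i
    subst hg
    exact hammingDist_comp (fun _ => Fin.rev) (fun _ => Fin.rev_injective)
  have key : ∀ (f : Fin k → ℕ) (C : Set (Fin k → Fin n → Fin q)),
      IsCECC q k n f C → IsCECC q k n (fun i => f i.rev) (g ⁻¹' C) := by
    rintro f C ⟨h1, h2⟩
    refine ⟨fun c hc => ?_, fun c hc c' hc' hne => ?_⟩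
    · have := hv _ (h1 _ hc)
      rwa [hgg] at this
    · rintro ⟨y, hy⟩
      refine h2 _ hc _ hc' (fun h => hne (hinj h)) ⟨g y, fun i => ?_⟩
      rw [hd, hd]
      simpa using hy i.rev
  have himg : ∀ C : Set (Fin k → Fin n → Fin q), g '' C = g ⁻¹' C := fun C =>
    congrFun (Set.image_eq_preimage_of_inverse hgg hgg) C
  refine ⟨⟨fun s hs => hv s hs, hinj.injOn, fun s hs => ⟨g s, hv s hs, hgg s⟩⟩, ?_, ?_⟩
  · intro C hC
    rw [himg]
    exact key e C hC
  · intro C hC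
    simpa using key _ C hC
end

section
/- Let q ≥ 2 and k ≥ 2 be integers and let σ = [a_1,…,a_k]^T ∈ Φ_{q,k}. Then the number of valid letters obtainable from σ by a single substitution in one of its k components, excluding σ itself, equals q − 1 + a_k − a_1; that is, |B^{(q,k)}_1(σ) \ {σ}| = q − 1 + a_k − a_1. -/
def extA {q k : ℕ} (a : Fin k → Fin q) (n : ℕ) : ℕ :=
  if n = 0 then 0 else if h : n - 1 < k then (a ⟨n - 1, h⟩).val else q - 1

lemma extA_succ {q k : ℕ} (a : Fin k → Fin q) (i : Fin k) : extA a (i.val + 1) = (a i).val := by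
  simp [extA]

lemma extA_mono {q k : ℕ} (a : Fin k → Fin q) (ha : Monotone a) : Monotone (extA a) := by
  intro m n hmn
  unfold extA
  split_ifs with h1 h2 h3 h4 h5 h6
  all_goals first
    | omega
    | (exact ha (by simp only [Fin.mk_le_mk]; omega))

lemma mono_update {q k : ℕ} (a : Fin k → Fin q) (ha : Monotone a) (i : Fin k) (v : Fin q) :
    Monotone (Function.update a i v) ↔ extA a i.val ≤ v.val ∧ v.val ≤ extA a (i.val + 2) := by
  constructor
  · intro h
    constructor
    · unfold extA
      split_ifs with h1 h2
      · omega
      · have hne : (⟨i.val - 1, h2⟩ : Fin k) ≠ i := by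
          intro h; have := congrArg Fin.val h; simp at this; omega
        have := @h ⟨i.val - 1, h2⟩ i (by rw [Fin.le_def]; simp)
        rw [Function.update_self, Function.update_of_ne hne] at this
        exact this
      · omega
    · unfold extA
      rw [if_neg (by omega)]
      split_ifs with h2
      · have hne : (⟨i.val + 2 - 1, h2⟩ : Fin k) ≠ i := by
          intro h; have := congrArg Fin.val h; simp at this
        have := @h i ⟨i.val + 2 - 1, h2⟩ (by rw [Fin.le_def]; simp)
        rw [Function.update_self, Function.update_of_ne hne] at this
        exact this
      · omega
  · rintro ⟨h1, h2⟩ x y hxy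
    have hm := extA_mono a ha
    by_cases hx : x = i <;> by_cases hy : y = i
    · subst hx; subst hy; rfl
    · subst hx
      rw [Function.update_self, Function.update_of_ne hy, Fin.le_def, ← extA_succ a y]
      exact h2.trans (hm (by have : x.val ≠ y.val := fun h => hy (Fin.ext h.symm)
                             rw [Fin.le_def] at hxy; omega))
    · subst hy
      rw [Function.update_self, Function.update_of_ne hx, Fin.le_def, ← extA_succ a x]
      exact (hm (by have : x.val ≠ y.val := fun h => hx (Fin.ext h)
                    rw [Fin.le_def] at hxy; omega)).trans h1
    · rw [Function.update_of_ne hx, Function.update_of_ne hy]; exact ha hxy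

lemma extA_lt {q k : ℕ} (hq : 2 ≤ q) (a : Fin k → Fin q) (n : ℕ) : extA a n < q := by
  unfold extA
  split_ifs <;> omega

lemma fiber_card {q k : ℕ} (hq : 2 ≤ q) (a : Fin k → Fin q) (ha : Monotone a) (i : Fin k) :
    (Finset.univ.filter (fun v : Fin q => (extA a i.val ≤ v.val ∧ v.val ≤ extA a (i.val + 2))
      ∧ v ≠ a i)).card = extA a (i.val + 2) - extA a i.val := by
  have e : Finset.univ.filter (fun v : Fin q =>
      (extA a i.val ≤ v.val ∧ v.val ≤ extA a (i.val + 2)) ∧ v ≠ a i)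
      = (Finset.Icc (⟨extA a i.val, extA_lt hq a _⟩ : Fin q)
          ⟨extA a (i.val + 2), extA_lt hq a _⟩).erase (a i) := by
    ext v
    simp [Fin.le_def]
    tauto
  rw [e, Finset.card_erase_of_mem, Fin.card_Icc]
  · simp only
    have := extA_mono a ha (show i.val ≤ i.val + 2 by omega)
    omega
  · simp only [Finset.mem_Icc, Fin.le_def, ← extA_succ]
    exact ⟨extA_mono a ha (by omega), extA_mono a ha (by omega)⟩

lemma tele (A : ℕ → ℕ) (hA : Monotone A) (k : ℕ) :
    ∑ i ∈ Finset.range k, (A (i + 2) - A i) + A 0 + A 1 = A k + A (k + 1) := by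
  induction k with
  | zero => simp
  | succ n ih =>
    rw [Finset.sum_range_succ]
    have := hA (show n ≤ n + 2 by omega)
    have e : n + 1 + 1 = n + 2 := rfl
    rw [e]
    omega

/-- The set of valid letters reachable from a valid letter `a ∈ Φ_{q,k}` by a single
substitution (excluding `a` itself) has size `q - 1 + a_k - a_1`. -/
theorem stmt4 (q k : ℕ) (hq : 2 ≤ q) (hk : 2 ≤ k)
    (a : Fin k → Fin q) (ha : Monotone a) :
    Set.ncard {τ : Fin k → Fin q | Monotone τ ∧ hammingDist τ a ≤ 1 ∧ τ ≠ a}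
      = q - 1 + ((a ⟨k - 1, by omega⟩).val - (a ⟨0, by omega⟩).val) := by
  let S : Finset (Σ _ : Fin k, Fin q) := Finset.univ.sigma (fun i =>
    Finset.univ.filter (fun v : Fin q => (extA a i.val ≤ v.val ∧ v.val ≤ extA a (i.val + 2))
      ∧ v ≠ a i))
  have hS : ∀ p : (Σ _ : Fin k, Fin q), p ∈ S ↔
      Monotone (Function.update a p.1 p.2) ∧ p.2 ≠ a p.1 := by
    intro p
    simp only [S, Finset.mem_sigma, Finset.mem_univ, true_and, Finset.mem_filter,
      mono_update a ha]
  have himg : {τ : Fin k → Fin q | Monotone τ ∧ hammingDist τ a ≤ 1 ∧ τ ≠ a}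
      = (fun p : (Σ _ : Fin k, Fin q) => Function.update a p.1 p.2) '' (S : Set _) := by
    ext τ
    simp only [Set.mem_setOf_eq, Set.mem_image, Finset.mem_coe, hS]
    constructor
    · rintro ⟨h1, h2, h3⟩
      obtain ⟨i, hi⟩ := Function.ne_iff.mp h3
      have hu : Function.update a i (τ i) = τ := by
        funext j
        by_cases hj : j = i
        · subst hj; simp
        · rw [Function.update_of_ne hj]
          by_contra hne
          unfold hammingDist at h2
          exact hj (Finset.card_le_one.mp h2 j (by simpa using Ne.symm hne) i (by simpa using hi))
      exact ⟨⟨i, τ i⟩, ⟨by simpa only [hu] using h1, hi⟩, hu⟩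
    · rintro ⟨⟨i, v⟩, ⟨h1, h2⟩, rfl⟩
      refine ⟨h1, ?_, ?_⟩
      · unfold hammingDist
        have hmem : ∀ x : Fin k, Function.update a i v x ≠ a x → x = i := by
          intro x hx
          by_contra hne
          exact hx (Function.update_of_ne hne _ _)
        refine Finset.card_le_one.mpr fun x hx y hy => ?_
        rw [hmem x (Finset.mem_filter.mp hx).2, hmem y (Finset.mem_filter.mp hy).2]
      · intro h
        have := congrFun h i
        simp at this
        exact h2 this
  have hinj : Set.InjOn (fun p : (Σ _ : Fin k, Fin q) => Function.update a p.1 p.2)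
      (S : Set _) := by
    rintro ⟨i, v⟩ hp ⟨j, w⟩ hp' h
    have h1 := ((hS _).mp hp).2
    simp only at h h1
    have hi := congrFun h i
    rw [Function.update_self] at hi
    by_cases hij : i = j
    · subst hij
      rw [Function.update_self] at hi
      rw [hi]
    · rw [Function.update_of_ne hij] at hi
      exact absurd hi h1
  rw [himg, Set.ncard_image_of_injOn hinj, Set.ncard_coe_finset, Finset.card_sigma]
  simp only [fiber_card hq a ha]
  rw [Fin.sum_univ_eq_sum_range (fun n => extA a (n + 2) - extA a n) k]
  have ht := tele (extA a) (extA_mono a ha) k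
  have e0 : extA a 0 = 0 := by simp [extA]
  have e1 : extA a 1 = (a ⟨0, by omega⟩).val := extA_succ a ⟨0, by omega⟩
  have ek : extA a k = (a ⟨k - 1, by omega⟩).val := by
    rw [← extA_succ]; congr 1; simp only; omega
  have ek1 : extA a (k + 1) = q - 1 := by simp [extA]
  have hle := extA_mono a ha (show 1 ≤ k by omega)
  rw [← e1, ← ek]
  omega
end

section
/- Let q ≥ 2, k ≥ 2, e ≥ 1 and 0 ≤ l ≤ q−1 be integers. Let s ∈ Φ_{q,k}^n be such that s_k[i] − s_1[i] ≥ l holds for at least m indices i ∈ [n], where e ≤ m ≤ n. Then |B^{(q,k)}_e(s)| ≥ binom(m, e)·(q−1+l)^e + 1. -/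
lemma aux_up {k q : ℕ} (c : Fin k → Fin q) (hc : Monotone c) (i0 : Fin k) (v : Fin q)
    (hv : c i0 < v) : ∃ i, c i < v ∧ Monotone (Function.update c i v) := by
  have hne : (Finset.univ.filter fun i => c i < v).Nonempty := ⟨i0, by simpa using hv⟩
  obtain ⟨i, hi, hmax⟩ := Finset.exists_max_image _ (fun i => i) hne
  simp only [Finset.mem_filter, Finset.mem_univ, true_and] at hi hmax
  refine ⟨i, hi, ?_⟩
  intro a b hab
  by_cases ha : a = i
  · by_cases hb : b = i
    · subst ha; subst hb; exact le_rfl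
    · subst ha
      rw [Function.update_self, Function.update_of_ne hb]
      by_contra h
      exact hb (le_antisymm (hmax b (not_le.mp h)) hab)
  · by_cases hb : b = i
    · subst hb
      rw [Function.update_self, Function.update_of_ne ha]
      exact (hc hab).trans hi.le
    · rw [Function.update_of_ne hb, Function.update_of_ne ha]
      exact hc hab

lemma aux_down {k q : ℕ} (c : Fin k → Fin q) (hc : Monotone c) (i0 : Fin k) (v : Fin q)
    (hv : v < c i0) : ∃ i, v < c i ∧ Monotone (Function.update c i v) := by
  have hne : (Finset.univ.filter fun i => v < c i).Nonempty := ⟨i0, by simpa using hv⟩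
  obtain ⟨i, hi, hmin⟩ := Finset.exists_min_image _ (fun i => i) hne
  simp only [Finset.mem_filter, Finset.mem_univ, true_and] at hi hmin
  refine ⟨i, hi, ?_⟩
  intro a b hab
  by_cases ha : a = i
  · by_cases hb : b = i
    · subst ha; subst hb; exact le_rfl
    · subst ha
      rw [Function.update_self, Function.update_of_ne hb]
      exact hi.le.trans (hc hab)
  · by_cases hb : b = i
    · subst hb
      rw [Function.update_self, Function.update_of_ne ha]
      by_contra h
      exact ha (le_antisymm hab (hmin a (not_le.mp h)))
    · rw [Function.update_of_ne hb, Function.update_of_ne ha]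
      exact hc hab

lemma aux_inj {k q : ℕ} (c : Fin k → Fin q) (i i' : Fin k) (v v' : Fin q)
    (hv : c i ≠ v) (h : Function.update c i v = Function.update c i' v') : v = v' := by
  have h1 := congrFun h i
  rw [Function.update_self] at h1
  by_cases hi : i = i'
  · subst hi; simpa using h1
  · rw [Function.update_of_ne hi] at h1
    exact absurd h1.symm hv

lemma aux_dist {k q : ℕ} (c : Fin k → Fin q) (i : Fin k) (v : Fin q)
    (hv : c i ≠ v) : hammingDist (Function.update c i v) c = 1 := by
  unfold hammingDist
  rw [Finset.card_eq_one]
  refine ⟨i, ?_⟩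
  ext a
  by_cases ha : a = i
  · subst ha; simpa using hv.symm
  · simp [ha]

/-- valid single-substitution neighbours of a column -/
def colD {k q : ℕ} (c : Fin k → Fin q) : Finset (Fin k → Fin q) :=
  open Classical in
  Finset.univ.filter fun c' => Monotone c' ∧ hammingDist c' c = 1

lemma colD_card {k q : ℕ} (c : Fin k → Fin q) (hc : Monotone c) (i0 i1 : Fin k) (l : ℕ)
    (hle : i0 ≤ i1) (hl : l ≤ (c i1).val - (c i0).val) : q - 1 + l ≤ (colD c).card := by
  classical
  have hcc : (c i0).val ≤ (c i1).val := hc hle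
  have hu : ∀ v : {v // v ∈ Finset.Ioi (c i0)}, ∃ i, c i < v.1 ∧ Monotone (Function.update c i v.1) :=
    fun v => aux_up c hc i0 v.1 (Finset.mem_Ioi.mp v.2)
  have hd : ∀ v : {v // v ∈ Finset.Iio (c i1)}, ∃ i, v.1 < c i ∧ Monotone (Function.update c i v.1) :=
    fun v => aux_down c hc i1 v.1 (Finset.mem_Iio.mp v.2)
  choose fu hfu hfu' using hu
  choose fd hfd hfd' using hd
  let F : {v // v ∈ Finset.Ioi (c i0)} ⊕ {v // v ∈ Finset.Iio (c i1)} → {x // x ∈ colD c} :=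
    Sum.elim
      (fun v => ⟨Function.update c (fu v) v.1, by
        simp [colD, hfu' v, aux_dist c _ _ (hfu v).ne]⟩)
      (fun v => ⟨Function.update c (fd v) v.1, by
        simp [colD, hfd' v, aux_dist c _ _ (hfd v).ne']⟩)
  have hcross : ∀ u d, Function.update c (fu u) u.1 ≠ Function.update c (fd d) d.1 := by
    intro u d h
    have h0 := aux_inj c _ _ _ _ (hfu u).ne h
    have h1 := congrFun h (fu u)
    rw [Function.update_self] at h1
    by_cases hi : fu u = fd d
    · have a1 := hfu u
      have a2 := hfd d
      rw [hi, h0] at a1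
      exact lt_asymm a1 a2
    · rw [Function.update_of_ne hi] at h1
      exact (hfu u).ne h1.symm
  have hF : Function.Injective F := by
    rintro (u | d) (u' | d') h
    · have := aux_inj c _ _ _ _ (hfu u).ne (Subtype.ext_iff.mp h)
      rw [Subtype.ext this]
    · exact absurd (Subtype.ext_iff.mp h) (hcross u d')
    · exact absurd (Subtype.ext_iff.mp h).symm (hcross u' d)
    · have := aux_inj c _ _ _ _ (hfd d).ne' (Subtype.ext_iff.mp h)
      rw [Subtype.ext this]
  have := Fintype.card_le_of_injective F hF
  rw [Fintype.card_sum, Fintype.card_coe, Fintype.card_coe, Fintype.card_coe, Fin.card_Ioi,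
    Fin.card_Iio] at this
  have := (c i0).isLt
  omega

lemma colD_ne {k q : ℕ} (c c' : Fin k → Fin q) (h : c' ∈ colD c) : c' ≠ c := by
  rintro rfl
  simp [colD] at h

/-- If `s ∈ Φ_{q,k}^n` has `s_k[i] - s_1[i] ≥ l` for at least `m` indices `i`,
with `e ≤ m ≤ n`, then the total-substitution ball `B_e^{(q,k)}(s)` of valid
sequences has size at least `C(m,e)·(q-1+l)^e + 1`. -/
theorem stmt6 (q k n e l m : ℕ) (hq : 2 ≤ q) (hk : 2 ≤ k)
    (he : 1 ≤ e) (hl : l ≤ q - 1) (hem : e ≤ m) (hmn : m ≤ n)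
    (s : Fin k → Fin n → Fin q) (hs : ValidSeq q k n s)
    (hcount : m ≤ (Finset.univ.filter fun i : Fin n =>
      l ≤ (s ⟨k - 1, by omega⟩ i).val - (s ⟨0, by omega⟩ i).val).card) :
    Nat.choose m e * (q - 1 + l) ^ e + 1 ≤
      Set.ncard {y : Fin k → Fin n → Fin q |
        ValidSeq q k n y ∧ ∑ i : Fin k, hammingDist (y i) (s i) ≤ e} := by
  classical
  set S := (Finset.univ.filter fun i : Fin n =>
      l ≤ (s ⟨k - 1, by omega⟩ i).val - (s ⟨0, by omega⟩ i).val) with hS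
  let c : Fin n → Fin k → Fin q := fun j i => s i j
  let A : Finset (Fin n) → Finset (Fin n → Fin k → Fin q) := fun T =>
    Fintype.piFinset fun j => if j ∈ T then colD (c j) else {c j}
  have hA : ∀ T, ∀ y ∈ A T, ∀ j, j ∈ T ↔ y j ≠ c j := by
    intro T y hy j
    have h := Fintype.mem_piFinset.mp hy j
    by_cases hj : j ∈ T
    · rw [if_pos hj] at h
      simp [hj, colD_ne _ _ h]
    · rw [if_neg hj] at h
      simpa [hj] using h
  have hdisj : ∀ T ∈ Finset.powersetCard e S, ∀ T' ∈ Finset.powersetCard e S, T ≠ T' →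
      Disjoint (A T) (A T') := by
    intro T _ T' _ hne
    rw [Finset.disjoint_left]
    intro y hy hy'
    exact hne (Finset.ext fun j => (hA T y hy j).trans (hA T' y hy' j).symm)
  let U := (Finset.powersetCard e S).biUnion A
  have hU : Nat.choose m e * (q - 1 + l) ^ e ≤ U.card := by
    rw [Finset.card_biUnion hdisj]
    calc Nat.choose m e * (q - 1 + l) ^ e ≤ Nat.choose S.card e * (q - 1 + l) ^ e :=
          Nat.mul_le_mul_right _ (Nat.choose_le_choose e hcount)
      _ = (Finset.powersetCard e S).card • (q - 1 + l) ^ e := by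
          rw [Finset.card_powersetCard, smul_eq_mul]
      _ ≤ _ := by
          apply Finset.card_nsmul_le_sum
          intro T hT
          obtain ⟨hTS, hTe⟩ := Finset.mem_powersetCard.mp hT
          have h1 : (A T).card = ∏ j ∈ T, (colD (c j)).card := by
            rw [Fintype.card_piFinset, ← Finset.prod_subset (Finset.subset_univ T)]
            · apply Finset.prod_congr rfl
              intro j hj
              rw [if_pos hj]
            · intro j _ hj
              rw [if_neg hj, Finset.card_singleton]
          rw [h1, ← hTe]
          apply Finset.pow_card_le_prod
          intro j hj
          have hjS := hTS hj
          rw [hS, Finset.mem_filter] at hjS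
          exact colD_card (c j) (hs j) ⟨0, by omega⟩ ⟨k - 1, by omega⟩ l
            (by simp [Fin.le_def]) hjS.2
  have hcU : c ∉ U := by
    intro h
    obtain ⟨T, hT, hc⟩ := Finset.mem_biUnion.mp h
    obtain ⟨hTS, hTe⟩ := Finset.mem_powersetCard.mp hT
    obtain ⟨j, hj⟩ : T.Nonempty := Finset.card_pos.mp (by omega)
    exact (hA T c hc j).mp hj rfl
  have hswap : Function.Injective
      (fun (y : Fin n → Fin k → Fin q) (i : Fin k) (j : Fin n) => y j i) := by
    intro y y' h
    funext j i
    exact congrFun (congrFun h i) j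
  have hcard : (((insert c U).image
      (fun (y : Fin n → Fin k → Fin q) (i : Fin k) (j : Fin n) => y j i)).card) = U.card + 1 := by
    rw [Finset.card_image_of_injective _ hswap, Finset.card_insert_of_notMem hcU]
  refine (Nat.succ_le_succ hU).trans ?_
  rw [Nat.succ_eq_add_one, ← hcard, ← Set.ncard_coe_finset]
  apply Set.ncard_le_ncard _ (Set.toFinite _)
  intro z hz
  obtain ⟨y, hy, rfl⟩ := Finset.mem_image.mp (Finset.mem_coe.mp hz)
  rcases Finset.mem_insert.mp hy with rfl | hy
  · refine ⟨hs, ?_⟩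
    have : ∑ i : Fin k, hammingDist (s i) (s i) ≤ e := by simp
    exact this
  · obtain ⟨T, hT, hyT⟩ := Finset.mem_biUnion.mp hy
    obtain ⟨hTS, hTe⟩ := Finset.mem_powersetCard.mp hT
    have hmem := Fintype.mem_piFinset.mp hyT
    constructor
    · intro j
      have h := hmem j
      change Monotone (y j)
      by_cases hj : j ∈ T
      · rw [if_pos hj] at h
        exact (Finset.mem_filter.mp h).2.1
      · rw [if_neg hj, Finset.mem_singleton] at h
        rw [h]; exact hs j
    · have hsum : ∑ i : Fin k, hammingDist (fun j => y j i) (s i)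
          = ∑ j : Fin n, hammingDist (y j) (c j) := by
        simp only [hammingDist, Finset.card_filter]
        exact Finset.sum_comm
      change ∑ i : Fin k, hammingDist (fun j => y j i) (s i) ≤ e
      rw [hsum]
      have : ∀ j : Fin n, hammingDist (y j) (c j) = if j ∈ T then 1 else 0 := by
        intro j
        have h := hmem j
        by_cases hj : j ∈ T
        · rw [if_pos hj] at h ⊢
          exact (Finset.mem_filter.mp h).2.2
        · rw [if_neg hj, Finset.mem_singleton] at h
          rw [if_neg hj, h, hammingDist_self]
      simp [this, hTe]
end

section
/- Let q ≥ 2 and k ≥ 2 be integers and Q_{q,k} = binom(k+q−1, q−1). (1) If e_1 ≥ e_2 ≥ … ≥ e_k ≥ 1 are integers and C ⊆ Φ_{q,k}^n is an (e_1,…,e_k)-CECC, then |C| ≤ Q_{q,k}^n / (binom(n, e_k)·[Σ_{l=1}^{q−1} binom(l+k−1, l)]^{e_k} + 1). (2) If e ≥ 1 is an integer and C ⊆ Φ_{q,k}^n is a k-resolution e-CECC, then |C| ≤ Q_{q,k}^n / (binom(n, e)·(q−1)^e + 1). -/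
/-- `C` is a `k`-resolution `e`-CECC (at most `e` substitutions in total). -/
def IsECECC (q k n : ℕ) (e : ℕ) (C : Set (Fin k → Fin n → Fin q)) : Prop :=
  (∀ c ∈ C, ValidSeq q k n c) ∧
  ∀ c ∈ C, ∀ c' ∈ C, c ≠ c' →
    ¬ ∃ y : Fin k → Fin n → Fin q,
        (∑ i : Fin k, hammingDist (y i) (c i)) ≤ e ∧
        (∑ i : Fin k, hammingDist (y i) (c' i)) ≤ e

abbrev MCol (q k : ℕ) := {f : Fin k → Fin q // Monotone f}

noncomputable instance mcolFintype (q k : ℕ) : Fintype (MCol q k) := Fintype.ofFinite _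
noncomputable instance mcolDecEq (q k : ℕ) : DecidableEq (MCol q k) := Classical.decEq _

theorem card_mcol (q k : ℕ) : Fintype.card (MCol q k) = Nat.multichoose q k := by
  classical
  rw [← Fintype.card_fin q, ← Sym.card_sym_eq_multichoose (Fin q) k, Fintype.card_fin q]
  let F : MCol q k → Sym (Fin q) k := fun f => ⟨(List.ofFn f.1 : Multiset (Fin q)), by simp⟩
  refine Fintype.card_of_bijective (f := F) ⟨?_, ?_⟩
  · intro f g h
    have h1 : ((List.ofFn f.1 : List (Fin q)) : Multiset (Fin q)) = (List.ofFn g.1 : List (Fin q)) :=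
      congrArg Subtype.val h
    have h2 := List.Perm.eq_of_pairwise' (r := (· ≤ ·)) f.2.sortedLE_ofFn.pairwise
      g.2.sortedLE_ofFn.pairwise (Multiset.coe_eq_coe.1 h1)
    exact Subtype.ext (List.ofFn_injective h2)
  · rintro ⟨s, hs⟩
    have hl : (s.sort).length = k := by rw [Multiset.length_sort, hs]
    have hp : (s.sort).SortedLE := (s.pairwise_sort (· ≤ ·)).sortedLE
    subst hl
    refine ⟨⟨(s.sort).get, hp.monotone_get⟩, ?_⟩
    apply Subtype.ext
    simp only [F, List.ofFn_get]
    exact s.sort_eq (· ≤ ·)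

theorem packing {α : Type*} [Fintype α] [DecidableEq α] (n e m : ℕ) (he : 1 ≤ e)
    (N : α → Finset α) (hN : ∀ v, v ∉ N v) (hm : ∀ v, m ≤ (N v).card)
    (D : Finset (Fin n → α))
    (hD : ∀ c ∈ D, ∀ c' ∈ D, c ≠ c' → ∀ s : Fin n → α,
      ∀ S S' : Finset (Fin n), S.card ≤ e → S'.card ≤ e →
      (∀ j, s j = c j ∨ j ∈ S ∧ s j ∈ N (c j)) →
      (∀ j, s j = c' j ∨ j ∈ S' ∧ s j ∈ N (c' j)) → False) :
    D.card * (n.choose e * m ^ e + 1) ≤ Fintype.card α ^ n := by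
  classical
  let P : (Fin n → α) → Finset (Fin n) → Finset (Fin n → α) := fun c S =>
    Fintype.piFinset (fun j => if j ∈ S then N (c j) else {c j})
  have hP : ∀ c S s, s ∈ P c S ↔ ∀ j, if j ∈ S then s j ∈ N (c j) else s j = c j := by
    intro c S s
    simp only [P, Fintype.mem_piFinset]
    refine forall_congr' fun j => ?_
    split_ifs <;> simp
  have hPS : ∀ c S s, s ∈ P c S → S = Finset.univ.filter (fun j => s j ≠ c j) := by
    intro c S s h
    rw [hP] at h
    ext j
    have := h j
    simp only [Finset.mem_filter, Finset.mem_univ, true_and]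
    split_ifs at this with hj
    · simp only [hj, true_iff]
      intro h'
      rw [h'] at this
      exact hN _ this
    · simp [hj, this]
  have hPc : ∀ c S, m ^ S.card ≤ (P c S).card := by
    intro c S
    rw [Fintype.card_piFinset]
    calc m ^ S.card = ∏ j : Fin n, (if j ∈ S then m else 1) := by
          rw [Finset.prod_ite_mem]; simp
      _ ≤ _ := by
          apply Finset.prod_le_prod'
          intro j _
          split_ifs
          · exact hm _
          · simp
  let B : (Fin n → α) → Finset (Fin n → α) := fun c =>
    insert c ((Finset.univ.powersetCard e).biUnion (P c))
  have hB : ∀ c s, s ∈ B c → ∃ S : Finset (Fin n), S.card ≤ e ∧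
      ∀ j, s j = c j ∨ j ∈ S ∧ s j ∈ N (c j) := by
    intro c s h
    rcases Finset.mem_insert.1 h with rfl | h
    · exact ⟨∅, by simp, fun j => Or.inl rfl⟩
    · obtain ⟨S, hS, hs⟩ := Finset.mem_biUnion.1 h
      refine ⟨S, (Finset.mem_powersetCard.1 hS).2.le, fun j => ?_⟩
      have := (hP _ _ _).1 hs j
      split_ifs at this with hj
      · exact Or.inr ⟨hj, this⟩
      · exact Or.inl this
  have hBc : ∀ c, n.choose e * m ^ e + 1 ≤ (B c).card := by
    intro c
    rw [Finset.card_insert_of_notMem]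
    · rw [Finset.card_biUnion]
      · gcongr
        calc n.choose e * m ^ e = ∑ S ∈ (Finset.univ : Finset (Fin n)).powersetCard e, m ^ e := by
              simp
          _ ≤ _ := by
              apply Finset.sum_le_sum
              intro S hS
              rw [← (Finset.mem_powersetCard.1 hS).2]
              exact hPc c S
      · intro S _ S' _ hne
        refine Finset.disjoint_left.2 ?_
        intro s h h'
        exact hne ((hPS _ _ _ h).trans (hPS _ _ _ h').symm)
    · intro h
      obtain ⟨S, hS, hs⟩ := Finset.mem_biUnion.1 h
      have h1 := hPS _ _ _ hs
      have h2 := (Finset.mem_powersetCard.1 hS).2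
      simp at h1
      subst h1
      simp at h2
      omega
  calc D.card * (n.choose e * m ^ e + 1) = ∑ c ∈ D, (n.choose e * m ^ e + 1) := by simp
    _ ≤ ∑ c ∈ D, (B c).card := Finset.sum_le_sum fun c _ => hBc c
    _ = (D.biUnion B).card := by
        rw [Finset.card_biUnion]
        intro c hc c' hc' hne
        refine Finset.disjoint_left.2 ?_
        intro s h h'
        obtain ⟨S, h1, h2⟩ := hB _ _ h
        obtain ⟨S', h3, h4⟩ := hB _ _ h'
        exact hD c hc c' hc' hne s S S' h1 h3 h2 h4
    _ ≤ Fintype.card (Fin n → α) := Finset.card_le_univ _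
    _ = _ := by simp

theorem exists_pos (q k : ℕ) (hk : 2 ≤ k) (v : MCol q k) (x : Fin q)
    (hx : x ≠ v.1 ⟨k - 1, by omega⟩) : ∃ p, x ≠ v.1 p ∧ Monotone (Function.update v.1 p x) := by
  have last : ∀ i : Fin k, i ≤ ⟨k - 1, by omega⟩ := fun i => by
    rw [Fin.le_def]; show i.1 ≤ k - 1; omega
  rcases lt_or_gt_of_ne hx with h | h
  · let p := Fin.find (fun i => x < v.1 i) ⟨_, h⟩
    have hp : x < v.1 p := Fin.find_spec (p := fun i => x < v.1 i) ⟨_, h⟩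
    have hmin : ∀ i, i < p → v.1 i ≤ x := fun i hi =>
      not_lt.1 (Fin.find_min (p := fun i => x < v.1 i) ⟨_, h⟩ hi)
    refine ⟨p, hp.ne, fun a b hab => ?_⟩
    simp only [Function.update_apply]
    split_ifs with h1 h2 h2
    · exact le_rfl
    · subst h1; exact hp.le.trans (v.2 hab)
    · subst h2; exact hmin a (lt_of_le_of_ne hab h1)
    · exact v.2 hab
  · refine ⟨_, hx, fun a b hab => ?_⟩
    simp only [Function.update_apply]
    split_ifs with h1 h2 h2
    · exact le_rfl
    · subst h1; exact absurd (le_antisymm (last b) hab) h2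
    · exact (v.2 (last a)).trans h.le
    · exact v.2 hab

noncomputable def nbr (q k : ℕ) (v : MCol q k) : Finset (MCol q k) :=
  Finset.univ.filter (fun w => hammingDist w.1 v.1 = 1)

theorem card_nbr (q k : ℕ) (hk : 2 ≤ k) (v : MCol q k) : q - 1 ≤ (nbr q k v).card := by
  classical
  let z : Fin q := v.1 ⟨k - 1, by omega⟩
  haveI : Nonempty (Fin k) := ⟨⟨k - 1, by omega⟩⟩
  choose! p hp1 hp2 using exists_pos q k hk v
  have hc : (Finset.univ.erase z).card = q - 1 := by
    rw [Finset.card_erase_of_mem (Finset.mem_univ _)]; simp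
  rw [← hc]
  refine Finset.card_le_card_of_injOn
    (fun x => if h : Monotone (Function.update v.1 (p x) x) then ⟨_, h⟩ else v) ?_ ?_
  · intro x hx
    have hx' : x ≠ z := by simpa using hx
    simp only [nbr, hp2 x hx', dif_pos, Finset.coe_filter, Finset.mem_univ, true_and,
      Set.mem_ofPred_eq]
    have : (Finset.univ.filter fun i => Function.update v.1 (p x) x i ≠ v.1 i) = {p x} := by
      ext i
      simp only [Finset.mem_filter, Finset.mem_univ, true_and, Finset.mem_singleton,
        Function.update_apply]
      split_ifs with h
      · subst h; simp [hp1 x hx']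
      · simp [h]
    unfold hammingDist
    rw [this]; rfl
  · intro x hx y hy hxy
    have hx' : x ≠ z := by simpa using hx
    have hy' : y ≠ z := by simpa using hy
    simp only [hp2 x hx', hp2 y hy', dif_pos, Subtype.mk.injEq] at hxy
    have h := congrFun hxy (p x)
    simp only [Function.update_self, Function.update_apply] at h
    split_ifs at h with h'
    · exact h
    · exact absurd h (hp1 x hx')

def toMat {q k n : ℕ} (s : Fin n → MCol q k) : Fin k → Fin n → Fin q := fun i j => (s j).1 i

theorem toMat_inj {q k n : ℕ} : Function.Injective (toMat (q := q) (k := k) (n := n)) := by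
  intro s t h
  funext j
  apply Subtype.ext
  funext i
  exact congrFun (congrFun h i) j

theorem exists_finset (q k n : ℕ) (C : Set (Fin k → Fin n → Fin q))
    (hC : ∀ c ∈ C, ValidSeq q k n c) :
    ∃ D : Finset (Fin n → MCol q k), D.card = C.ncard ∧ ∀ s ∈ D, toMat s ∈ C := by
  classical
  refine ⟨Finset.univ.filter (fun s => toMat s ∈ C), ?_, by simp⟩
  rw [← Set.ncard_coe_finset, ← Set.ncard_image_of_injective _ toMat_inj]
  congr 1
  ext c
  simp only [Finset.coe_filter, Finset.mem_univ, true_and, Set.mem_image, Set.mem_ofPred_eq]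
  constructor
  · rintro ⟨s, hs, rfl⟩; exact hs
  · intro hc
    exact ⟨fun j => ⟨fun i => c i j, hC c hc j⟩, hc, rfl⟩

theorem sum_dist (q k n : ℕ) (s t : Fin n → MCol q k) :
    ∑ i, hammingDist (toMat s i) (toMat t i) = ∑ j, hammingDist (s j).1 (t j).1 := by
  simp only [hammingDist, Finset.card_filter]
  rw [Finset.sum_comm]
  rfl

theorem sum_choose (q k : ℕ) (hq : 2 ≤ q) (hk : 2 ≤ k) :
    ∑ l ∈ Finset.Icc 1 (q - 1), Nat.choose (l + k - 1) l + 1 = Nat.choose (k + q - 1) (q - 1) := by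
  obtain ⟨q, rfl⟩ : ∃ r, q = r + 1 := ⟨q - 1, by omega⟩
  obtain ⟨k, rfl⟩ : ∃ r, k = r + 1 := ⟨k - 1, by omega⟩
  clear hq hk
  simp only [Nat.add_sub_cancel, ← Nat.add_assoc]
  induction q with
  | zero => simp
  | succ q ih =>
    rw [Finset.sum_Icc_succ_top (by omega), add_right_comm, ih,
      show k + 1 + (q + 1) = (k + 1 + q) + 1 by omega, Nat.choose_succ_succ,
      show q + 1 + k = k + 1 + q by omega]

theorem card_mcol' (q k : ℕ) (hq : 2 ≤ q) :
    Fintype.card (MCol q k) = Nat.choose (k + q - 1) (q - 1) := by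
  rw [card_mcol, Nat.multichoose_eq, add_comm q k]
  exact Nat.choose_symm_of_eq_add (by omega)

/-- Sphere-packing bounds: (1) for `(e₁,…,e_k)`-CECCs with `e₁ ≥ … ≥ e_k ≥ 1`;
(2) for `k`-resolution `e`-CECCs with `e ≥ 1`. Here `Q_{q,k} = C(k+q-1, q-1)`. -/
theorem stmt7 (q k n : ℕ) (hq : 2 ≤ q) (hk : 2 ≤ k) (hn : 1 ≤ n) :
    (∀ e : Fin k → ℕ, Antitone e → (∀ i, 1 ≤ e i) →
      ∀ C : Set (Fin k → Fin n → Fin q), IsCECC q k n e C →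
        (C.ncard : ℝ) ≤ (Nat.choose (k + q - 1) (q - 1) : ℝ) ^ n /
          ((Nat.choose n (e ⟨k - 1, by omega⟩) : ℝ) *
            (∑ l ∈ Finset.Icc 1 (q - 1), (Nat.choose (l + k - 1) l : ℝ))
              ^ (e ⟨k - 1, by omega⟩) + 1)) ∧
    (∀ e : ℕ, 1 ≤ e →
      ∀ C : Set (Fin k → Fin n → Fin q), IsECECC q k n e C →
        (C.ncard : ℝ) ≤ (Nat.choose (k + q - 1) (q - 1) : ℝ) ^ n /
          ((Nat.choose n e : ℝ) * ((q : ℝ) - 1) ^ e + 1)) := by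
  classical
  refine ⟨?_, ?_⟩
  · intro e hanti he C hC
    obtain ⟨D, hD, hDC⟩ := exists_finset q k n C hC.1
    rw [le_div_iff₀ (by positivity), ← hD]
    set t := e ⟨k - 1, by omega⟩ with ht
    have hs := sum_choose q k hq hk
    have key := packing (α := MCol q k) n t
      (∑ l ∈ Finset.Icc 1 (q - 1), Nat.choose (l + k - 1) l) (he _)
      (fun v => Finset.univ.erase v) (by simp)
      (by
        intro v
        rw [Finset.card_erase_of_mem (Finset.mem_univ _), Finset.card_univ, card_mcol' q k hq]
        omega) D (by
        intro c hc c' hc' hne s S S' hS hS' h h'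
        have aux : ∀ (c : Fin n → MCol q k) (S : Finset (Fin n)), S.card ≤ t →
            (∀ j, s j = c j ∨ j ∈ S ∧ s j ∈ Finset.univ.erase (c j)) →
            ∀ i, hammingDist (toMat s i) (toMat c i) ≤ e i := by
          intro c S hS h i
          have h1 : t ≤ e i := hanti (by rw [Fin.le_def]; show i.1 ≤ k - 1; omega)
          refine (Finset.card_le_card ?_).trans (hS.trans h1)
          intro j hj
          rcases h j with h2 | h2
          · exact absurd (show toMat s i j = toMat c i j by simp [toMat, h2]) (Finset.mem_filter.1 hj).2
          · exact h2.1
        exact hC.2 _ (hDC c hc) _ (hDC c' hc') (fun h => hne (toMat_inj h))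
          ⟨toMat s, fun i => ⟨aux c S hS h i, aux c' S' hS' h' i⟩⟩)
    rw [card_mcol' q k hq] at key
    exact_mod_cast key
  · intro e he C hC
    obtain ⟨D, hD, hDC⟩ := exists_finset q k n C hC.1
    have hq1 : (q : ℝ) - 1 = ((q - 1 : ℕ) : ℝ) := by
      rw [Nat.cast_sub (by omega)]; simp
    rw [hq1, le_div_iff₀ (by positivity), ← hD]
    have key := packing (α := MCol q k) n e (q - 1) he (nbr q k) (by simp [nbr])
      (card_nbr q k hk) D (by
        intro c hc c' hc' hne s S S' hS hS' h h'
        have aux : ∀ (c : Fin n → MCol q k) (S : Finset (Fin n)), S.card ≤ e →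
            (∀ j, s j = c j ∨ j ∈ S ∧ s j ∈ nbr q k (c j)) →
            ∑ i, hammingDist (toMat s i) (toMat c i) ≤ e := by
          intro c S hS h
          rw [sum_dist]
          calc ∑ j, hammingDist (s j).1 (c j).1 ≤ ∑ j : Fin n, (if j ∈ S then 1 else 0) := by
                apply Finset.sum_le_sum
                intro j _
                rcases h j with h2 | ⟨h2, h3⟩
                · simp [h2]
                · simp only [nbr, Finset.mem_filter] at h3
                  simp [h2, h3.2]
            _ = S.card := by simp
            _ ≤ e := hS
        exact hC.2 _ (hDC c hc) _ (hDC c' hc') (fun h => hne (toMat_inj h))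
          ⟨toMat s, aux c S hS h, aux c' S' hS' h'⟩)
    rw [card_mcol' q k hq] at key
    exact_mod_cast key
end

section
/- Let q ≥ 2 and k ≥ 2 be integers and Q_{q,k} = binom(k+q−1, q−1). Let e_1,…,e_k be nonnegative integers whose nonzero entries are exactly e_{l_1},…,e_{l_m} with l_1 < … < l_m, where 1 ≤ m ≤ q. Let R = {j : 1 < j < m and l_j − l_{j−1} = 1} and e = Σ_{j=1}^m e_{l_j}. Then limsup_{n→∞} [ A^S_{q,k}(n;(e_1,…,e_k)) · 2^{|R|} · (q−1)^{e_{l_m}} · binom(q,m)^{e − e_{l_m}} · n^e ] / [ Q_{q,k}^{n+e} · Π_{j=1}^m e_{l_j}^{e_{l_j}} ] ≤ 1. -/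
/-- `A^S_{q,k}(n; e)`: the maximum size of an `(e 0,…,e (k-1))`-CECC in `Φ_{q,k}^n`. -/
noncomputable def maxCECC (q k n : ℕ) (e : Fin k → ℕ) : ℕ :=
  sSup {m | ∃ C : Set (Fin k → Fin n → Fin q), IsCECC q k n e C ∧ C.ncard = m}


open Finset in
theorem aux_chernoff {Φ : Type*} [Fintype Φ] [Nonempty Φ] (f : Φ → ℝ) (a : ℝ)
    (ha : a * Fintype.card Φ < ∑ x, f x) :
    ∃ ρ : ℝ, 0 ≤ ρ ∧ ρ < 1 ∧ ∀ n : ℕ,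
      ((univ.filter fun s : Fin n → Φ => ∑ p, f (s p) ≤ a * n).card : ℝ)
        ≤ (ρ * Fintype.card Φ) ^ n := by
  classical
  have hQ : (0:ℝ) < Fintype.card Φ := by exact_mod_cast Fintype.card_pos
  let g : ℝ → ℝ := fun t => ∑ x, Real.exp (t * (a - f x))
  have hg0 : g 0 = Fintype.card Φ := by simp [g]
  have hd : HasDerivAt g (∑ x, (a - f x)) 0 := by
    have : ∀ x ∈ (univ : Finset Φ), HasDerivAt (fun t : ℝ => Real.exp (t * (a - f x))) (a - f x) 0 := by
      intro x _
      have h := ((hasDerivAt_id (0:ℝ)).mul_const (a - f x)).exp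
      simpa using h
    have h2 := HasDerivAt.fun_sum this
    exact h2
  have hneg : ∑ x, (a - f x) < 0 := by
    rw [sum_sub_distrib]; simp only [sum_const, card_univ, nsmul_eq_mul]; linarith
  have hev : ∃ t : ℝ, 0 < t ∧ g t < Fintype.card Φ := by
    have h1 := hd.hasDerivWithinAt (s := Set.Ioi 0)
    have h2 := (hasDerivWithinAt_iff_tendsto_slope' (by simp)).1 h1
    have h3 : ∀ᶠ t in nhdsWithin (0:ℝ) (Set.Ioi 0), slope g 0 t < 0 := by
      exact h2.eventually_lt_const hneg
    obtain ⟨t, ht, ht0⟩ := (h3.and self_mem_nhdsWithin).exists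
    have ht0 : 0 < t := ht0
    refine ⟨t, ht0, ?_⟩
    rw [slope_def_field, sub_zero] at ht
    rw [div_lt_iff₀ ht0] at ht
    linarith
  obtain ⟨t, ht, hgt⟩ := hev
  have hg_nonneg : 0 ≤ g t := sum_nonneg fun x _ => (Real.exp_pos _).le
  refine ⟨g t / Fintype.card Φ, div_nonneg hg_nonneg hQ.le, (div_lt_one hQ).2 hgt, fun n => ?_⟩
  rw [div_mul_cancel₀ _ hQ.ne']
  have hprod : (g t) ^ n = ∑ s : Fin n → Φ, ∏ p, Real.exp (t * (a - f (s p))) := by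
    have := Finset.prod_univ_sum (fun _ : Fin n => (univ : Finset Φ)) (fun _ x => Real.exp (t * (a - f x)))
    simp only [prod_const, card_univ, Fintype.card_fin, Fintype.piFinset_univ] at this
    exact this
  rw [hprod, card_eq_sum_ones, Nat.cast_sum, sum_filter]
  apply sum_le_sum
  intro s _
  rw [← Real.exp_sum]
  split_ifs with h
  · rw [Nat.cast_one, Real.one_le_exp_iff, ← mul_sum, sum_sub_distrib]
    simp only [sum_const, card_univ, Fintype.card_fin, nsmul_eq_mul]
    apply mul_nonneg ht.le
    linarith
  · exact (Real.exp_pos _).le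

theorem aux_cardMono (q k : ℕ) (hq : 2 ≤ q) :
    Fintype.card {φ : Fin k → Fin q // Monotone φ} ≤ Nat.choose (k + q - 1) (q - 1) := by
  have h1 : Fintype.card {φ : Fin k → Fin q // Monotone φ} ≤ Fintype.card (Sym (Fin q) k) := by
    let F : {φ : Fin k → Fin q // Monotone φ} → Sym (Fin q) k := fun φ =>
      Sym.mk ((List.ofFn φ.1 : List (Fin q)) : Multiset (Fin q)) (by simp)
    apply Fintype.card_le_of_injective F
    intro φ ψ h
    have h := congrArg Subtype.val h
    have h : ((List.ofFn φ.1 : List (Fin q)) : Multiset (Fin q)) = (List.ofFn ψ.1 : List (Fin q)) := h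
    rw [Multiset.coe_eq_coe] at h
    apply Subtype.ext
    apply List.ofFn_injective
    exact h.eq_of_pairwise' (r := (· ≤ ·))
      (List.pairwise_ofFn.2 fun i j hij => φ.2 hij.le) (List.pairwise_ofFn.2 fun i j hij => ψ.2 hij.le)
  rw [Sym.card_sym_eq_choose, Fintype.card_fin] at h1
  refine h1.trans (le_of_eq ?_)
  rw [show q + k - 1 = k + q - 1 by omega]
  apply Nat.choose_symm_of_eq_add
  omega

open Finset Classical in
/-- number of valid changes of row `i` in column `φ` -/
noncomputable def auxDg {q k : ℕ} (i : Fin k) (φ : Fin k → Fin q) : ℕ :=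
  (univ.filter fun v : Fin q => v ≠ φ i ∧ Monotone (Function.update φ i v)).card

open Finset Classical in
noncomputable def auxY {q k n : ℕ} (c : Fin k → Fin n → Fin q) (a : Fin k → ℕ) :
    Finset (Fin k → Fin n → Fin q) :=
  univ.filter fun y => ValidSeq q k n y ∧ ∀ i, hammingDist (y i) (c i) = a i

def auxSet {q k n : ℕ} (y : Fin k → Fin n → Fin q) (i : Fin k) (p : Fin n) (v : Fin q) :
    Fin k → Fin n → Fin q := fun r s => if r = i ∧ s = p then v else y r s

open Finset Classical in
theorem aux_step {q k n : ℕ} (c : Fin k → Fin n → Fin q)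
    (a : Fin k → ℕ) (i : Fin k) (D : ℕ) (hD : D + q * ∑ r, a r ≤ ∑ p, auxDg i (fun r => c r p)) :
    (auxY c a).card * D ≤ (auxY c (Function.update a i (a i + 1))).card * (a i + 1) := by
  apply card_mul_le_card_mul
    (fun y y' => ∃ p, y' i p ≠ c i p ∧ y = auxSet y' i p (c i p))
  · intro y hy
    simp only [auxY, mem_filter, mem_univ, true_and] at hy
    obtain ⟨hyv, hyd⟩ := hy
    let bad : Finset (Fin n) := univ.filter fun p => ∃ r, y r p ≠ c r p
    have hbad : bad.card ≤ ∑ r, a r := by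
      have : bad ⊆ univ.biUnion fun r : Fin k => univ.filter fun p => y r p ≠ c r p := by
        intro p hp
        simpa [bad] using hp
      refine (card_le_card this).trans (card_biUnion_le.trans (le_of_eq ?_))
      apply sum_congr rfl
      intro r _
      rw [← hyd r]; simp only [hammingDist]
    let src : Finset (Σ _ : Fin n, Fin q) := (univ \ bad).sigma fun p =>
      univ.filter fun v : Fin q => v ≠ c i p ∧ Monotone (Function.update (fun r => c r p) i v)
    have hsrc : D ≤ src.card := by
      have h1 : src.card = ∑ p ∈ univ \ bad, auxDg i (fun r => c r p) := by
        rw [card_sigma]; rfl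
      have h2 : ∑ p ∈ univ \ bad, auxDg i (fun r => c r p) + ∑ p ∈ bad, auxDg i (fun r => c r p)
          = ∑ p, auxDg i (fun r => c r p) := sum_sdiff (subset_univ _)
      have h3 : ∑ p ∈ bad, auxDg i (fun r => c r p) ≤ bad.card * q := by
        rw [← smul_eq_mul]
        apply sum_le_card_nsmul
        intro p _
        refine (card_le_univ _).trans ?_
        simp
      have h4 : bad.card * q ≤ q * ∑ r, a r := by
        rw [mul_comm]; exact Nat.mul_le_mul_left _ hbad
      omega
    refine hsrc.trans ?_
    apply card_le_card_of_injOn (fun x => auxSet y i x.1 x.2)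
    · rintro ⟨p, v⟩ hx
      simp only [src, bad, coe_sigma, Set.mem_sigma_iff, mem_coe, mem_sdiff, mem_univ, mem_filter, true_and, not_exists,
        not_not] at hx
      obtain ⟨hp, hv, hmono⟩ := hx
      simp only [mem_coe, mem_bipartiteAbove, auxY, mem_filter, mem_univ, true_and]
      refine ⟨⟨?_, ?_⟩, ?_⟩
      · intro s
        by_cases hs : s = p
        · subst hs
          convert hmono using 1
          funext r
          by_cases hr : r = i
          · subst hr; simp [auxSet]
          · simp [auxSet, hr, hp]
        · have := hyv s
          simpa [auxSet, hs] using this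
      · intro r
        by_cases hr : r = i
        · subst hr
          rw [Function.update_self, ← hyd r]
          simp only [hammingDist]
          have : (univ.filter fun s => auxSet y r p v r s ≠ c r s) =
              insert p (univ.filter fun s => y r s ≠ c r s) := by
            ext s
            by_cases hs : s = p
            · subst hs; simp [auxSet, hv]
            · simp [auxSet, hs]
          rw [this, card_insert_of_notMem]
          simp [hp]
        · rw [Function.update_of_ne hr, ← hyd r]
          congr 1
          funext s
          simp [auxSet, hr]
      · refine ⟨p, by simpa [auxSet] using hv, ?_⟩
        funext r s
        by_cases h : r = i ∧ s = p
        · obtain ⟨rfl, rfl⟩ := h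
          simp [auxSet, hp]
        · simp [auxSet, h]
    · rintro ⟨p, v⟩ hx ⟨p', v'⟩ hx' h
      simp only [src, bad, coe_sigma, Set.mem_sigma_iff, mem_coe, mem_sdiff, mem_univ, mem_filter, true_and, not_exists,
        not_not] at hx hx'
      obtain ⟨hp, hv, -⟩ := hx
      have h1 := congrFun (congrFun h i) p
      by_cases hpp : p = p'
      · subst hpp
        simp [auxSet] at h1
        rw [h1]
      · simp [auxSet, hpp, hp] at h1
        exact absurd h1 hv
  · intro y' hy'
    simp only [auxY, mem_filter, mem_univ, true_and] at hy'
    have h := hy'.2 i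
    rw [Function.update_self] at h
    rw [← h]
    have : bipartiteBelow (fun y y' => ∃ p, y' i p ≠ c i p ∧ y = auxSet y' i p (c i p)) (auxY c a) y'
        ⊆ (univ.filter fun p => y' i p ≠ c i p).image fun p => auxSet y' i p (c i p) := by
      intro y hy
      rw [mem_bipartiteBelow] at hy
      obtain ⟨_, p, hp, rfl⟩ := hy
      simp only [mem_image, mem_filter, mem_univ, true_and]
      exact ⟨p, hp, rfl⟩
    refine (card_le_card this).trans (card_image_le.trans (le_of_eq ?_))
    simp only [hammingDist]

open Finset in
theorem aux_iter {q k n : ℕ} (c : Fin k → Fin n → Fin q) (hc : ValidSeq q k n c)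
    (e : Fin k → ℕ) (D : Fin k → ℕ)
    (hD : ∀ i, e i ≠ 0 → D i + q * ∑ r, e r ≤ ∑ p, auxDg i (fun r => c r p)) :
    ∀ (t : ℕ) (a : Fin k → ℕ), a ≤ e → ∑ i, a i = t →
      ∏ i, D i ^ a i ≤ (auxY c a).card * ∏ i, (a i).factorial := by
  intro t
  induction t with
  | zero =>
    intro a _ ha
    have ha0 : ∀ i, a i = 0 := by simpa using ha
    have : c ∈ auxY c a := by simp [auxY, hc, ha0]
    simp only [ha0, pow_zero, prod_const_one, Nat.factorial_zero, mul_one]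
    exact card_pos.2 ⟨c, this⟩
  | succ t ih =>
    intro a hae ha
    have : ∃ i, a i ≠ 0 := by
      by_contra! h
      simp [h] at ha
    obtain ⟨i, hi⟩ := this
    obtain ⟨b, hb⟩ := Nat.exists_eq_succ_of_ne_zero hi
    let a' := Function.update a i b
    have ha'i : a' i = b := by simp [a']
    have hupd : Function.update a' i (a' i + 1) = a := by
      rw [ha'i]; simp only [a', Function.update_idem]; rw [← Nat.succ_eq_add_one, ← hb]; simp
    have hle : a' ≤ a := by
      intro r
      by_cases hr : r = i
      · subst hr; change a' r ≤ a r; omega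
      · simp [a', hr]
    have hsum : ∑ r, a' r = t := by
      have h1 := add_sum_erase univ a (mem_univ i)
      have h2 := add_sum_erase univ a' (mem_univ i)
      have h3 : ∑ r ∈ univ.erase i, a' r = ∑ r ∈ univ.erase i, a r :=
        sum_congr rfl fun r hr => by simp [a', (mem_erase.1 hr).1]
      omega
    have h0 := ih a' (hle.trans hae) hsum
    have hst := aux_step c a' i (D i) (by
      have h1 := hD i (by have : a i ≤ e i := hae i; omega)
      have h2 : ∑ r, a' r ≤ ∑ r, e r := sum_le_sum fun r _ => (hle.trans hae) r
      have := Nat.mul_le_mul_left q h2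
      omega)
    rw [hupd, ha'i] at hst
    have hp1 : ∏ r, D r ^ a r = (∏ r, D r ^ a' r) * D i := by
      rw [← mul_prod_erase univ _ (mem_univ i), ← mul_prod_erase univ (fun r => D r ^ a' r) (mem_univ i)]
      have h3 : ∏ r ∈ univ.erase i, D r ^ a' r = ∏ r ∈ univ.erase i, D r ^ a r :=
        prod_congr rfl fun r hr => by simp [a', (mem_erase.1 hr).1]
      rw [h3, ha'i, hb, Nat.succ_eq_add_one, pow_succ]; ring
    have hp2 : ∏ r, (a r).factorial = (∏ r, (a' r).factorial) * (b + 1) := by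
      rw [← mul_prod_erase univ _ (mem_univ i), ← mul_prod_erase univ (fun r => (a' r).factorial) (mem_univ i)]
      have h3 : ∏ r ∈ univ.erase i, (a' r).factorial = ∏ r ∈ univ.erase i, (a r).factorial :=
        prod_congr rfl fun r hr => by simp [a', (mem_erase.1 hr).1]
      rw [h3, ha'i, hb, Nat.succ_eq_add_one, Nat.factorial_succ]; ring
    rw [hp1, hp2]
    calc (∏ r, D r ^ a' r) * D i ≤ ((auxY c a').card * ∏ r, (a' r).factorial) * D i :=
          Nat.mul_le_mul_right _ h0
      _ = ((auxY c a').card * D i) * ∏ r, (a' r).factorial := by ring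
      _ ≤ ((auxY c a).card * (b + 1)) * ∏ r, (a' r).factorial := Nat.mul_le_mul_right _ hst
      _ = _ := by ring

noncomputable def auxN (q : ℕ) {k : ℕ} (i : Fin k) : ℕ :=
  ∑ φ : {φ : Fin k → Fin q // Monotone φ}, auxDg i φ.1

open Finset Classical in
theorem aux_le_N {q k : ℕ} (i : Fin k) {β : Type*} (S : Finset β)
    (F : β → Fin k → Fin q) (G : β → Fin q)
    (hF : ∀ b ∈ S, Monotone (F b)) (hne : ∀ b ∈ S, G b ≠ F b i)
    (hG : ∀ b ∈ S, Monotone (Function.update (F b) i (G b)))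
    (hinj : ∀ b ∈ S, ∀ b' ∈ S, F b = F b' → G b = G b' → b = b') : S.card ≤ auxN q i := by
  let T : Finset (Σ _ : {φ : Fin k → Fin q // Monotone φ}, Fin q) := univ.sigma fun φ =>
    univ.filter fun v : Fin q => v ≠ φ.1 i ∧ Monotone (Function.update φ.1 i v)
  have hT : T.card = auxN q i := by
    rw [card_sigma]; rfl
  rw [← hT]
  let H : {b // b ∈ S} → (Σ _ : {φ : Fin k → Fin q // Monotone φ}, Fin q) :=
    fun b => ⟨⟨F b.1, hF b.1 b.2⟩, G b.1⟩
  rw [← card_attach]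
  apply card_le_card_of_injOn H
  · intro b _
    simp only [T, H, mem_coe, mem_sigma, mem_univ, true_and, mem_filter]
    exact ⟨hne b.1 b.2, hG b.1 b.2⟩
  · intro b _ b' _ h
    simp only [H, Sigma.mk.injEq, Subtype.mk.injEq, heq_eq_eq] at h
    exact Subtype.ext (hinj _ b.2 _ b'.2 h.1 h.2)

open Finset in
theorem aux_N_last {q k : ℕ} (hq : 2 ≤ q) (i : Fin k) : 2 * (q - 1) ≤ auxN q i := by
  have h : (univ : Finset (Fin q)).offDiag.card ≤ auxN q i := by
    have key : ∀ a b : Fin q, ∀ c, (c = a ∨ c = b) → Monotone (fun r : Fin k => if r < i then min a b else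
      if r = i then c else max a b) := by
      intro a b c hc r s hrs
      dsimp only
      rcases hc with rfl | rfl
      all_goals
        split_ifs <;> first | omega | simp
    apply aux_le_N i _ (fun x r => if r < i then min x.1 x.2 else if r = i then x.1 else max x.1 x.2)
      (fun x => x.2)
    · intro x _
      exact key _ _ _ (Or.inl rfl)
    · intro x hx
      simp only [mem_offDiag] at hx
      simpa using hx.2.2.symm
    · intro x _
      convert key x.1 x.2 x.2 (Or.inr rfl) using 1
      funext r
      by_cases hr : r = i
      · subst hr; simp
      · simp [hr]
    · intro x _ y _ h1 h2
      have := congrFun h1 i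
      simp at this
      exact Prod.ext this h2
  rw [offDiag_card] at h
  simp at h
  obtain ⟨t, rfl⟩ : ∃ t, q = t + 2 := ⟨q - 2, by omega⟩
  have : 2 * (t + 2 - 1) ≤ (t+2)*(t+2) - (t+2) := by
    have : (t+2)*(t+2) = (t+1)*(t+2) + (t+2) := by ring
    rw [this, Nat.add_sub_cancel]
    have : t + 2 - 1 = t + 1 := rfl
    nlinarith
  omega

open Finset in
theorem aux_N_mid {q k m : ℕ} (l : Fin m → Fin k) (hl : StrictMono l) (j : Fin m)
    (hj : j.val + 1 < m) : 2 * Nat.choose q m ≤ auxN q (l j) := by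
  classical
  -- index function
  let idx : Fin k → Fin m := fun r => ⟨min (m - 1) (univ.filter fun t : Fin m => l t < r).card, by omega⟩
  have hidx_mono : Monotone idx := by
    intro r s hrs
    have : (univ.filter fun t : Fin m => l t < r).card ≤ (univ.filter fun t : Fin m => l t < s).card := by
      apply card_le_card
      intro t ht
      simp only [mem_filter, mem_univ, true_and] at ht ⊢
      exact ht.trans_le hrs
    rw [Fin.le_def]
    simp only [idx]
    omega
  have hidx_l : ∀ t, idx (l t) = t := by
    intro t
    apply Fin.ext
    have : (univ.filter fun u : Fin m => l u < l t) = Finset.Iio t := by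
      ext u; simp [hl.lt_iff_lt]
    simp only [idx, this, Fin.card_Iio]
    omega
  let j' : Fin m := ⟨j.val + 1, hj⟩
  have hidx_gt : ∀ r, l j < r → j' ≤ idx r := by
    intro r hr
    have : (Finset.Iic j) ⊆ (univ.filter fun t : Fin m => l t < r) := by
      intro t ht
      simp only [mem_filter, mem_univ, true_and, mem_Iic] at ht ⊢
      exact (hl.monotone ht).trans_lt hr
    have := card_le_card this
    rw [Fin.card_Iic] at this
    change j.val + 1 ≤ min _ _
    omega
  have hjj : j < j' := by change j.val < j.val + 1; omega
  let S : Finset (Finset (Fin q)) := powersetCard m univ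
  have hScard : ∀ s : {s // s ∈ S}, s.1.card = m := fun s => (mem_powersetCard.1 s.2).2
  let x : {s // s ∈ S} → Fin m ↪o Fin q := fun s => s.1.orderEmbOfFin (hScard s)
  have hx_inj : ∀ s s', (∀ t, x s t = x s' t) → s = s' := by
    intro s s' h
    apply Subtype.ext
    have h1 := range_orderEmbOfFin s.1 (hScard s)
    have h2 := range_orderEmbOfFin s'.1 (hScard s')
    apply Finset.coe_injective
    rw [← h1, ← h2]
    congr 1
    funext t; exact h t
  let up : {s // s ∈ S} → Fin k → Fin q := fun s => Function.update (fun r => x s (idx r)) (l j) (x s j')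
  have hbase : ∀ s, Monotone (fun r => x s (idx r)) := fun s => (x s).monotone.comp hidx_mono
  have hup : ∀ s, Monotone (up s) := by
    intro s r r' hrr
    by_cases h1 : r = l j
    · by_cases h2 : r' = l j
      · rw [h1, h2]
      · have : l j < r' := lt_of_le_of_ne (h1 ▸ hrr) (Ne.symm h2)
        simp only [up, h1, Function.update_self, Function.update_of_ne h2]
        exact (x s).monotone (hidx_gt _ this)
    · by_cases h2 : r' = l j
      · simp only [up, h2, Function.update_self, Function.update_of_ne h1]
        apply (x s).monotone
        have := hidx_mono hrr
        rw [h2, hidx_l] at this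
        exact this.trans hjj.le
      · simp only [up, Function.update_of_ne h1, Function.update_of_ne h2]
        exact hbase s hrr
  have hlt : ∀ s, x s j < x s j' := fun s => (x s).strictMono hjj
  have hcard : (univ : Finset (Bool × {s // s ∈ S})).card = 2 * Nat.choose q m := by
    rw [card_univ, Fintype.card_prod, Fintype.card_bool, Fintype.card_coe, card_powersetCard]
    simp
  rw [← hcard]
  apply aux_le_N (l j) _ (fun b => if b.1 then up b.2 else fun r => x b.2 (idx r))
    (fun b => if b.1 then x b.2 j else x b.2 j')
  · rintro ⟨b, s⟩ _
    cases b
    · simpa using hbase s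
    · simpa using hup s
  · rintro ⟨b, s⟩ _
    cases b
    · simpa [hidx_l] using hjj.ne'
    · simpa [up] using hjj.ne
  · rintro ⟨b, s⟩ _
    cases b
    · simpa using hup s
    · have : Function.update (fun r => x s (idx r)) (l j) (x s j) = fun r => x s (idx r) := by
        rw [Function.update_eq_self_iff, hidx_l]
      simpa [up, this] using hbase s
  · rintro ⟨b, s⟩ _ ⟨b', s'⟩ _ h1 h2
    cases b <;> cases b' <;> simp at h1 h2
    · congr 1
      apply hx_inj
      intro t
      have := congrFun h1 (l t)
      simpa [hidx_l] using this
    · have h3 := congrFun h1 (l j)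
      simp [hidx_l, up] at h3
      have a1 := hlt s
      have a2 := hlt s'
      rw [h3, h2] at a1
      exact absurd a1 (lt_asymm a2)
    · have h3 := congrFun h1 (l j)
      simp [hidx_l, up] at h3
      have a1 := hlt s
      have a2 := hlt s'
      rw [h3, h2] at a1
      exact absurd a1 (lt_asymm a2)
    · congr 1
      apply hx_inj
      intro t
      by_cases ht : t = j
      · rw [ht]; exact h2
      · have := congrFun h1 (l t)
        simpa [hidx_l, up, hl.injective.eq_iff, ht] using this

theorem aux_max (q k n : ℕ) (e : Fin k → ℕ) :
    ∃ C : Set (Fin k → Fin n → Fin q), IsCECC q k n e C ∧ C.ncard = maxCECC q k n e := by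
  have := Nat.sSup_mem (s := {m | ∃ C : Set (Fin k → Fin n → Fin q), IsCECC q k n e C ∧ C.ncard = m})
    ⟨0, ∅, ⟨by simp, by simp⟩, by simp⟩
    ⟨Nat.card (Fin k → Fin n → Fin q), by
      rintro _ ⟨C, -, rfl⟩
      exact Set.ncard_le_card C⟩
  exact this

open Finset Classical in
theorem aux_count (q k n : ℕ) (e D : Fin k → ℕ) :
    ∃ x y : ℕ, maxCECC q k n e ≤ x + y ∧
      x * ∏ i, D i ^ e i ≤ (Fintype.card {φ : Fin k → Fin q // Monotone φ}) ^ n * ∏ i, (e i).factorial ∧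
      y ≤ ∑ i ∈ univ.filter (fun i => e i ≠ 0),
        (univ.filter fun s : Fin n → {φ : Fin k → Fin q // Monotone φ} =>
          ∑ p, auxDg i (s p).1 < D i + q * ∑ r, e r).card := by
  obtain ⟨C, ⟨hval, hdis⟩, hcard⟩ := aux_max q k n e
  let C' : Finset (Fin k → Fin n → Fin q) := univ.filter fun c => c ∈ C
  have hC' : C'.card = maxCECC q k n e := by
    rw [← hcard, Set.ncard_eq_toFinset_card']
    congr 1
    ext c; simp [C']
  let good : (Fin k → Fin n → Fin q) → Prop := fun c =>
    ∀ i, e i ≠ 0 → D i + q * ∑ r, e r ≤ ∑ p, auxDg i (fun r => c r p)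
  have hmemC : ∀ c ∈ C', c ∈ C := fun c hc => by simpa [C'] using hc
  refine ⟨(C'.filter good).card, (C'.filter fun c => ¬ good c).card, ?_, ?_, ?_⟩
  · rw [card_filter_add_card_filter_not, hC']
  · have hV : (univ.filter fun y => ValidSeq q k n y).card ≤
        (Fintype.card {φ : Fin k → Fin q // Monotone φ}) ^ n := by
      rw [← Fintype.card_subtype]
      have h : Fintype.card (Fin n → {φ : Fin k → Fin q // Monotone φ}) =
        (Fintype.card {φ : Fin k → Fin q // Monotone φ}) ^ n := by simp
      rw [← h]
      apply Fintype.card_le_of_injective (fun (y : {y // ValidSeq q k n y}) p =>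
        (⟨fun r => y.1 r p, y.2 p⟩ : {φ : Fin k → Fin q // Monotone φ}))
      intro y y' hyy
      apply Subtype.ext
      funext r p
      exact congrFun (congrArg Subtype.val (congrFun hyy p)) r
    have hU : ((C'.filter good).biUnion fun c => auxY c e).card ≤
        (univ.filter fun y => ValidSeq q k n y).card := by
      apply card_le_card
      intro y hy
      simp only [mem_biUnion, auxY, mem_filter, mem_univ, true_and] at hy ⊢
      obtain ⟨c, _, h, _⟩ := hy
      exact h
    rw [card_biUnion] at hU
    · calc (C'.filter good).card * ∏ i, D i ^ e i = ∑ c ∈ C'.filter good, ∏ i, D i ^ e i := by simp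
        _ ≤ ∑ c ∈ C'.filter good, (auxY c e).card * ∏ i, (e i).factorial := by
          apply sum_le_sum
          intro c hc
          rw [mem_filter] at hc
          exact aux_iter c (hval c (hmemC c hc.1)) e D hc.2 _ e le_rfl rfl
        _ = (∑ c ∈ C'.filter good, (auxY c e).card) * ∏ i, (e i).factorial := by rw [sum_mul]
        _ ≤ _ := Nat.mul_le_mul_right _ (hU.trans hV)
    · intro c hc c' hc' hne
      change Disjoint (auxY c e) (auxY c' e)
      rw [disjoint_left]
      intro y hy hy'
      simp only [auxY, mem_filter, mem_univ, true_and] at hy hy'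
      exact hdis c (hmemC c (mem_filter.1 hc).1) c' (hmemC c' (mem_filter.1 hc').1) hne
        ⟨y, fun i => ⟨(hy.2 i).le, (hy'.2 i).le⟩⟩
  · refine le_trans ?_ card_biUnion_le
    let emb : {c // c ∈ C'.filter fun c => ¬ good c} → Fin n → {φ : Fin k → Fin q // Monotone φ} :=
      fun c p => ⟨fun r => c.1 r p, hval c.1 (hmemC _ (mem_filter.1 c.2).1) p⟩
    rw [← card_attach]
    apply card_le_card_of_injOn emb
    · intro c _
      have hc := (mem_filter.1 c.2).2
      simp only [good, not_forall, not_le] at hc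
      obtain ⟨i, hi, hlt⟩ := hc
      simp only [mem_coe, mem_biUnion, mem_filter, mem_univ, true_and]
      exact ⟨i, hi, hlt⟩
    · intro c _ c' _ h
      apply Subtype.ext
      funext r p
      exact congrFun (congrArg Subtype.val (congrFun h p)) r

open Finset in
theorem aux_K (q k m : ℕ) (hq : 2 ≤ q) (hm : 1 ≤ m)
    (e : Fin k → ℕ) (l : Fin m → Fin k) (hl : StrictMono l)
    (hsupp : ∀ i : Fin k, e i ≠ 0 ↔ ∃ j : Fin m, l j = i)
    (E : ℕ) (hE : E = ∑ j : Fin m, e (l j))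
    (R : Finset (Fin m)) (hR : ∀ j ∈ R, 0 < j.val) (last : Fin m) (hlast : last.val = m - 1) :
    2 * (2 ^ R.card * (q - 1) ^ e (l last) * (Nat.choose q m) ^ (E - e (l last)))
      ≤ ∏ j, auxN q (l j) ^ e (l j) := by
  have h1 : ∀ j, 1 ≤ e (l j) := fun j => Nat.one_le_iff_ne_zero.2 ((hsupp _).2 ⟨j, rfl⟩)
  have hEm : m ≤ E := by
    rw [hE]
    calc m = ∑ j : Fin m, 1 := by simp
      _ ≤ _ := sum_le_sum fun j _ => h1 j
  have hRc : R.card + 1 ≤ m := by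
    have : R ⊆ univ.erase (⟨0, hm⟩ : Fin m) := by
      intro j hj
      simp only [mem_erase, mem_univ, and_true]
      intro h
      have := hR j hj
      rw [h] at this
      simp at this
    have := card_le_card this
    rw [card_erase_of_mem (mem_univ _)] at this
    simp at this
    omega
  have hE2 : E - e (l last) = ∑ j ∈ univ.erase last, e (l j) := by
    rw [hE, ← add_sum_erase univ _ (mem_univ last)]
    simp
  calc 2 * (2 ^ R.card * (q - 1) ^ e (l last) * (Nat.choose q m) ^ (E - e (l last)))
      = 2 ^ (R.card + 1) * ((q - 1) ^ e (l last) * (Nat.choose q m) ^ (E - e (l last))) := by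
        rw [pow_succ]; ring
    _ ≤ 2 ^ E * ((q - 1) ^ e (l last) * (Nat.choose q m) ^ (E - e (l last))) :=
        Nat.mul_le_mul_right _ (Nat.pow_le_pow_right (by norm_num) (by omega))
    _ = (2 * (q - 1)) ^ e (l last) * (2 * Nat.choose q m) ^ (E - e (l last)) := by
        have : e (l last) ≤ E := by
          rw [hE]; exact single_le_sum (f := fun j => e (l j)) (fun _ _ => Nat.zero_le _) (mem_univ last)
        rw [mul_pow, mul_pow]
        nth_rewrite 1 [← Nat.add_sub_of_le this]
        rw [pow_add]; ring
    _ = (2 * (q - 1)) ^ e (l last) * ∏ j ∈ univ.erase last, (2 * Nat.choose q m) ^ e (l j) := by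
        rw [prod_pow_eq_pow_sum, hE2]
    _ ≤ auxN q (l last) ^ e (l last) * ∏ j ∈ univ.erase last, auxN q (l j) ^ e (l j) := by
        apply Nat.mul_le_mul
        · exact Nat.pow_le_pow_left (aux_N_last hq _) _
        · apply prod_le_prod'
          intro j hj
          apply Nat.pow_le_pow_left
          apply aux_N_mid l hl
          have : j ≠ last := (mem_erase.1 hj).1
          have : j.val ≠ last.val := fun h => this (Fin.ext h)
          omega
    _ = _ := mul_prod_erase univ (fun j => auxN q (l j) ^ e (l j)) (mem_univ last)

set_option maxHeartbeats 2000000 in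
/-- Asymptotic upper bound of Theorem `thm_boundCECC2`: with nonzero error entries
exactly `e (l 0), …, e (l (m-1))`, `R = {j : 1 < j < m, l_j - l_{j-1} = 1}` and
`E = ∑_j e (l j)`, the maximum CECC size satisfies
`A ≤ Q^{n+E} ∏ e_{l_j}^{e_{l_j}} / (2^{|R|} (q-1)^{e_{l_m}} C(q,m)^{E - e_{l_m}} n^E) (1+o(1))`. -/
theorem stmt8 (q k m : ℕ) (hq : 2 ≤ q) (hk : 2 ≤ k) (hm : 1 ≤ m) (hmq : m ≤ q)
    (e : Fin k → ℕ) (l : Fin m → Fin k) (hl : StrictMono l)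
    (hsupp : ∀ i : Fin k, e i ≠ 0 ↔ ∃ j : Fin m, l j = i)
    (E : ℕ) (hE : E = ∑ j : Fin m, e (l j))
    (R : Finset (Fin m))
    (hR : R = Finset.univ.filter fun j : Fin m =>
      0 < j.val ∧ j.val < m - 1 ∧
        (l j).val = (l ⟨j.val - 1, by have := j.isLt; omega⟩).val + 1) :
    Filter.limsup (fun n : ℕ =>
      ((maxCECC q k n e : ℝ) * 2 ^ R.card
          * ((q : ℝ) - 1) ^ (e (l ⟨m - 1, by omega⟩))
          * (Nat.choose q m : ℝ) ^ (E - e (l ⟨m - 1, by omega⟩))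
          * (n : ℝ) ^ E)
        / ((Nat.choose (k + q - 1) (q - 1) : ℝ) ^ (n + E)
          * ∏ j : Fin m, (e (l j) : ℝ) ^ (e (l j)))) Filter.atTop ≤ 1 := by
  classical
  set last : Fin m := ⟨m - 1, by omega⟩ with hlast
  set Φ := {φ : Fin k → Fin q // Monotone φ} with hΦ
  have : Nonempty Φ := ⟨⟨fun _ => ⟨0, by omega⟩, fun _ _ _ => le_rfl⟩⟩
  set Q' : ℝ := (Fintype.card Φ : ℝ) with hQ'
  set Q : ℝ := (Nat.choose (k + q - 1) (q - 1) : ℝ) with hQdef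
  have hQ'1 : 1 ≤ Q' := by rw [hQ']; exact_mod_cast Fintype.card_pos (α := Φ)
  have hQ'0 : 0 < Q' := by linarith
  have hQQ : Q' ≤ Q := by
    rw [hQ', hQdef]; exact_mod_cast aux_cardMono q k hq
  have hN : ∀ i : Fin k, (0:ℝ) < auxN q i := fun i => by
    have := aux_N_last hq i
    have : 0 < auxN q i := by omega
    exact_mod_cast this
  have hEk : ∑ i, e i = E := by
    rw [hE]
    symm
    apply Fintype.sum_of_injective l hl.injective
    · intro i hi
      by_contra h
      exact hi ((hsupp i).1 h)
    · intro j; rfl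
  have hprod : ∀ g : Fin k → ℝ, ∏ i, g i ^ e i = ∏ j, g (l j) ^ e (l j) := by
    intro g
    symm
    apply Fintype.prod_of_injective l hl.injective
    · intro i hi
      have : e i = 0 := by
        by_contra h
        exact hi ((hsupp i).1 h)
      simp [this]
    · intro j; rfl
  set P : ℝ := ∏ j : Fin m, (e (l j) : ℝ) ^ (e (l j)) with hP
  have hPpos : 0 < P := by
    apply Finset.prod_pos
    intro j _
    have : 0 < e (l j) := Nat.pos_of_ne_zero ((hsupp _).2 ⟨j, rfl⟩)
    positivity
  have hfact : ((∏ i, (e i).factorial : ℕ) : ℝ) ≤ P := by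
    rw [hP, ← hprod (fun i => (e i : ℝ))]
    have : ∏ i, (e i).factorial ≤ ∏ i, e i ^ e i :=
      Finset.prod_le_prod' fun i _ => Nat.factorial_le_pow _
    exact_mod_cast this
  set K : ℝ := 2 ^ R.card * ((q : ℝ) - 1) ^ (e (l last)) * (Nat.choose q m : ℝ) ^ (E - e (l last)) with hK
  have hq1 : (0:ℝ) ≤ (q:ℝ) - 1 := by
    have : (2:ℝ) ≤ q := by exact_mod_cast hq
    linarith
  have hK0 : 0 ≤ K := by positivity
  set NN : ℝ := ∏ i, (auxN q i : ℝ) ^ e i with hNN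
  have hNN0 : 0 < NN := Finset.prod_pos fun i _ => pow_pos (hN i) _
  have hKN : 2 * K ≤ NN := by
    have h := aux_K q k m hq hm e l hl hsupp E hE R
      (by intro j hj; rw [hR] at hj; exact (Finset.mem_filter.1 hj).2.1) last rfl
    rw [hNN, hprod (fun i => (auxN q i : ℝ)), hK]
    have h2 : ((2 * (2 ^ R.card * (q - 1) ^ e (l last) * (Nat.choose q m) ^ (E - e (l last))) : ℕ) : ℝ)
      ≤ ((∏ j, auxN q (l j) ^ e (l j) : ℕ) : ℝ) := by exact_mod_cast h
    push_cast [Nat.cast_sub (show 1 ≤ q by omega)] at h2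
    exact h2
  obtain ⟨θ, hθ0, hθ1, hθE⟩ : ∃ θ : ℝ, 0 < θ ∧ θ < 1 ∧ 3 / 4 ≤ θ ^ E := by
    have hE1 : (0:ℝ) < 4 * (E + 1) := by positivity
    refine ⟨1 + -(1 / (4 * (E + 1))), ?_, ?_, ?_⟩
    · have : 1 / (4 * ((E:ℝ) + 1)) < 1 := by
        rw [div_lt_one hE1]
        have : (0:ℝ) ≤ E := Nat.cast_nonneg _
        linarith
      linarith
    · have : 0 < 1 / (4 * ((E:ℝ) + 1)) := by positivity
      linarith
    · refine le_trans ?_ (one_add_mul_le_pow ?_ E)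
      · have : (E:ℝ) * (1 / (4 * (E + 1))) ≤ 1 / 4 := by
          rw [mul_one_div, div_le_div_iff₀ hE1 (by norm_num)]
          linarith
        linarith
      · have : 1 / (4 * ((E:ℝ) + 1)) ≤ 1 := by
          rw [div_le_one hE1]
          have : (0:ℝ) ≤ E := Nat.cast_nonneg _
          linarith
        linarith
  set a : Fin k → ℝ := fun i => (1 + θ) / 2 * auxN q i / Q' with ha
  have hcher : ∀ i, ∃ ρ : ℝ, 0 ≤ ρ ∧ ρ < 1 ∧ ∀ n : ℕ,
      ((Finset.univ.filter fun s : Fin n → Φ => ∑ p, (auxDg i (s p).1 : ℝ) ≤ a i * n).card : ℝ)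
        ≤ (ρ * Q') ^ n := by
    intro i
    apply aux_chernoff (fun φ : Φ => (auxDg i φ.1 : ℝ)) (a i)
    have : ∑ φ : Φ, (auxDg i φ.1 : ℝ) = auxN q i := by
      simp only [auxN]; push_cast; rfl
    rw [this]
    simp only [ha]
    rw [← hQ', div_mul_cancel₀ _ hQ'0.ne']
    nlinarith [hN i]
  choose ρ hρ0 hρ1 hρ using hcher
  -- the exceptional part tends to zero
  have htend : Filter.Tendsto (fun n : ℕ => ∑ i : Fin k, K / P * ((n:ℝ) ^ E * ρ i ^ n))
      Filter.atTop (nhds 0) := by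
    have : (0:ℝ) = ∑ i : Fin k, K / P * 0 := by simp
    rw [this]
    apply tendsto_finsetSum
    intro i _
    apply Filter.Tendsto.const_mul
    exact tendsto_pow_const_mul_const_pow_of_abs_lt_one E (by rw [abs_of_nonneg (hρ0 i)]; exact hρ1 i)
  have hev1 : ∀ᶠ n : ℕ in Filter.atTop, ∑ i : Fin k, K / P * ((n:ℝ) ^ E * ρ i ^ n) < 1 / 3 :=
    htend.eventually_lt_const (by norm_num)
  have hev2 : ∀ᶠ n : ℕ in Filter.atTop, ∀ i : Fin k,
      θ * auxN q i / Q' * n + 1 + q * E ≤ a i * n := by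
    rw [Filter.eventually_all]
    intro i
    have hpos : 0 < (1 - θ) / 2 * auxN q i / Q' := by
      have := hN i
      have : 0 < 1 - θ := by linarith
      positivity
    have h := (tendsto_natCast_atTop_atTop (R := ℝ)).const_mul_atTop hpos
    filter_upwards [h.eventually_ge_atTop (1 + q * E)] with n hn
    have : a i * n = θ * auxN q i / Q' * n + (1 - θ) / 2 * auxN q i / Q' * n := by
      simp only [ha]; ring
    linarith
  apply Filter.limsup_le_of_le
  · apply Filter.IsCoboundedUnder.of_frequently_ge (a := 0)
    apply Filter.Frequently.of_forall
    intro n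
    have : 0 ≤ Q := by linarith
    positivity
  filter_upwards [hev1, hev2, Filter.eventually_gt_atTop 0] with n h1 h2 hn0
  have hn : (0:ℝ) < n := by exact_mod_cast hn0
  let D : Fin k → ℕ := fun i => ⌈θ * auxN q i / Q' * n⌉₊
  have hDlow : ∀ i, θ * auxN q i / Q' * n ≤ D i := fun i => Nat.le_ceil _
  have hDhi : ∀ i, ((D i + q * ∑ r, e r : ℕ) : ℝ) ≤ a i * n := by
    intro i
    rw [hEk]; push_cast
    have h0 : 0 ≤ θ * auxN q i / Q' * n := by
      have := hN i
      positivity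
    have := (Nat.ceil_lt_add_one h0).le
    have := h2 i
    simp only [D]
    linarith
  obtain ⟨x, y, hxy, hx, hy⟩ := aux_count q k n e D
  have hy' : (y : ℝ) ≤ ∑ i, (ρ i * Q') ^ n := by
    have hyr : (y:ℝ) ≤ _ := Nat.cast_le.2 hy
    rw [Nat.cast_sum] at hyr
    refine hyr.trans ?_
    refine (Finset.sum_le_sum fun i _ => ?_).trans
      (Finset.sum_le_sum_of_subset_of_nonneg (Finset.filter_subset _ _)
        (fun i _ _ => pow_nonneg (mul_nonneg (hρ0 i) hQ'0.le) n))
    refine le_trans ?_ (hρ i n)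
    norm_cast
    apply le_trans (Finset.card_le_card _) le_rfl
    intro s hs
    simp only [Finset.mem_filter, Finset.mem_univ, true_and] at hs ⊢
    refine le_trans ?_ (hDhi i)
    exact_mod_cast hs.le
  have hx' : (x : ℝ) * (θ ^ E * NN * n ^ E) ≤ Q' ^ (n + E) * P := by
    have hxr : ((x * ∏ i, D i ^ e i : ℕ) : ℝ) ≤ Q' ^ n * P := by
      have hxr : ((x * ∏ i, D i ^ e i : ℕ) : ℝ) ≤ ((_ : ℕ) : ℝ) := Nat.cast_le.2 hx
      refine hxr.trans ?_
      rw [Nat.cast_mul, Nat.cast_pow]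
      exact mul_le_mul_of_nonneg_left hfact (by positivity)
    push_cast at hxr
    have hlow : θ ^ E * NN * n ^ E / Q' ^ E ≤ ∏ i, (D i : ℝ) ^ e i := by
      have : θ ^ E * NN * n ^ E / Q' ^ E = ∏ i, (θ * auxN q i / Q' * n) ^ e i := by
        simp only [mul_pow, div_pow, Finset.prod_mul_distrib, Finset.prod_div_distrib,
          Finset.prod_pow_eq_pow_sum, hEk]
        rw [hNN]; ring
      rw [this]
      apply Finset.prod_le_prod
      · intro i _
        have := hN i
        positivity
      · intro i _
        apply pow_le_pow_left₀ _ (hDlow i)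
        have := hN i
        positivity
    have h3 := (mul_le_mul_of_nonneg_left hlow (Nat.cast_nonneg x)).trans hxr
    rw [← mul_div_assoc, div_le_iff₀ (by positivity)] at h3
    rw [pow_add]
    linarith
  have hxy' : (maxCECC q k n e : ℝ) ≤ x + y := by exact_mod_cast hxy
  have hQ0 : 0 < Q := by linarith
  have hQpow : Q' ^ (n + E) ≤ Q ^ (n + E) := pow_le_pow_left₀ hQ'0.le hQQ _
  have hQpow' : Q' ^ n ≤ Q' ^ (n + E) := pow_le_pow_right₀ hQ'1 (by omega)
  rw [div_le_one (by positivity)]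
  have hexp : (maxCECC q k n e : ℝ) * 2 ^ R.card * ((q : ℝ) - 1) ^ (e (l last))
      * (Nat.choose q m : ℝ) ^ (E - e (l last)) * (n : ℝ) ^ E
      = (maxCECC q k n e : ℝ) * (K * n ^ E) := by rw [hK]; ring
  rw [hexp]
  have hKn : 0 ≤ K * (n:ℝ) ^ E := by positivity
  have hpart1 : (x:ℝ) * (K * n ^ E) ≤ 2 / 3 * (Q ^ (n + E) * P) := by
    have s1 : 3 / 2 * K ≤ θ ^ E * NN := by nlinarith
    have s2 : (x:ℝ) * (3 / 2 * K * n ^ E) ≤ Q' ^ (n + E) * P :=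
      le_trans (by gcongr) hx'
    have s3 : Q' ^ (n + E) * P ≤ Q ^ (n + E) * P := by gcongr
    linarith
  have hpart2 : (y:ℝ) * (K * n ^ E) ≤ 1 / 3 * (Q ^ (n + E) * P) := by
    calc (y:ℝ) * (K * n ^ E) ≤ (∑ i, (ρ i * Q') ^ n) * (K * n ^ E) := by gcongr
      _ = (∑ i : Fin k, K / P * ((n:ℝ) ^ E * ρ i ^ n)) * (Q' ^ n * P) := by
        rw [Finset.sum_mul, Finset.sum_mul]
        apply Finset.sum_congr rfl
        intro i _
        rw [mul_pow]
        field_simp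
      _ ≤ 1 / 3 * (Q' ^ n * P) := by gcongr
      _ ≤ 1 / 3 * (Q ^ (n + E) * P) := by
        have := hQpow'.trans hQpow
        gcongr
  calc (maxCECC q k n e : ℝ) * (K * n ^ E) ≤ (x + y) * (K * n ^ E) := by gcongr
    _ = x * (K * n ^ E) + y * (K * n ^ E) := by ring
    _ ≤ Q ^ (n + E) * P := by linarith
end

section
/- Let k ≥ 2 and n ≥ 1 be integers and let y ∈ {0,1}^{n−1} be a binary sequence of Hamming weight w. Then the number of tuples (s_2,…,s_k) ∈ ({0,1}^n)^{k−1} for which there exists s_1 ∈ {0,1}^n such that y is a subsequence of s_1 of length n−1 and s_1 ≤ s_2 ≤ … ≤ s_k componentwise equals k^{n−w} + w·(k−1)·k^{n−w−1}. -/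
/-- `z` dominates a supersequence of `y`. -/
def GG {m : ℕ} (y : Fin m → Fin 2) (z : Fin (m + 1) → Fin 2) : Prop :=
  ∃ s : Fin (m + 1) → Fin 2, (List.ofFn y).Sublist (List.ofFn s) ∧ s ≤ z

lemma GG_cons_of_le {m : ℕ} (y : Fin m → Fin 2) (z : Fin (m + 1) → Fin 2) (a b : Fin 2)
    (h : b ≤ a) : GG (Fin.cons b y : Fin (m + 1) → Fin 2) (Fin.cons a z : Fin (m + 2) → Fin 2) ↔ GG y z := by
  constructor
  · rintro ⟨s, hs, hle⟩
    refine ⟨Fin.tail s, ?_, fun i => by simpa [Fin.tail] using hle i.succ⟩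
    rw [List.ofFn_succ, List.ofFn_succ (f := s)] at hs
    simp only [Fin.cons_zero, Fin.cons_succ] at hs
    exact hs.tail
  · rintro ⟨s, hs, hle⟩
    refine ⟨Fin.cons b s, ?_, ?_⟩
    · rw [List.ofFn_succ, List.ofFn_succ (f := (Fin.cons b s : Fin (m + 2) → Fin 2))]
      simp only [Fin.cons_zero, Fin.cons_succ]
      exact hs.cons_cons b
    · intro i
      refine Fin.cases ?_ (fun i => ?_) i
      · simpa using h
      · simpa using hle i

lemma GG_cons_one_zero {m : ℕ} (y : Fin m → Fin 2) (z : Fin (m + 1) → Fin 2) :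
    GG (Fin.cons 1 y : Fin (m + 1) → Fin 2) (Fin.cons 0 z : Fin (m + 2) → Fin 2) ↔
      (Fin.cons 1 y : Fin (m + 1) → Fin 2) ≤ z := by
  constructor
  · rintro ⟨s, hs, hle⟩
    have h0 : s 0 = 0 := by
      have := hle 0
      simpa using this
    have ht : Fin.tail s ≤ z := fun i => by simpa [Fin.tail] using hle i.succ
    have hs2 : (List.ofFn (Fin.cons 1 y : Fin (m + 1) → Fin 2)).Sublist (List.ofFn (Fin.tail s)) := by
      rw [List.ofFn_succ (f := s), h0] at hs
      rw [List.ofFn_succ] at hs ⊢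
      simp only [Fin.cons_zero, Fin.cons_succ] at hs ⊢
      cases hs with
      | cons _ h => exact h
    have := List.ofFn_injective (hs2.eq_of_length (by simp))
    rw [this]; exact ht
  · intro h
    refine ⟨Fin.cons 0 (Fin.cons 1 y), ?_, ?_⟩
    · rw [List.ofFn_succ (f := (Fin.cons 0 (Fin.cons 1 y : Fin (m + 1) → Fin 2) : Fin (m + 2) → Fin 2))]
      simp only [Fin.cons_zero, Fin.cons_succ]
      exact List.sublist_cons_self _ _
    · intro i
      refine Fin.cases ?_ (fun i => ?_) i
      · simp
      · simpa using h i

def ff {q : ℕ} (j : Fin (q + 1)) : Fin 2 := if j = 0 then 1 else 0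

lemma comp_cons {q m : ℕ} (c : Fin (q + 1)) (t : Fin m → Fin (q + 1)) :
    (fun i => ff ((Fin.cons c t : Fin (m + 1) → Fin (q + 1)) i)) =
      (Fin.cons (ff c) (fun i => ff (t i)) : Fin (m + 1) → Fin 2) := by
  funext i
  refine Fin.cases ?_ (fun i => ?_) i <;> simp

lemma sum_cons {q m : ℕ} (F : (Fin (m + 1) → Fin (q + 1)) → ℕ) :
    ∑ t, F t = ∑ c : Fin (q + 1), ∑ t : Fin m → Fin (q + 1), F (Fin.cons c t) := by
  rw [← Fintype.sum_prod_type' (f := fun c t => F (Fin.cons c t))]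
  exact (Fintype.sum_equiv (Fin.consEquiv (fun _ => Fin (q + 1))) _ _ (fun _ => rfl)).symm

def zc {m : ℕ} (y : Fin m → Fin 2) : ℕ := ∑ i, (if y i = 0 then 1 else 0)
def oc {m : ℕ} (y : Fin m → Fin 2) : ℕ := ∑ i, (if y i = 1 then 1 else 0)

lemma zc_cons {m : ℕ} (b : Fin 2) (y : Fin m → Fin 2) :
    zc (Fin.cons b y : Fin (m + 1) → Fin 2) = (if b = 0 then 1 else 0) + zc y := by
  rw [zc, zc, Fin.sum_univ_succ]
  simp only [Fin.cons_zero, Fin.cons_succ]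

lemma oc_cons {m : ℕ} (b : Fin 2) (y : Fin m → Fin 2) :
    oc (Fin.cons b y : Fin (m + 1) → Fin 2) = (if b = 1 then 1 else 0) + oc y := by
  rw [oc, oc, Fin.sum_univ_succ]
  simp only [Fin.cons_zero, Fin.cons_succ]

open Classical in
lemma count_le (q : ℕ) {m : ℕ} (y : Fin m → Fin 2) :
    ∑ t : Fin m → Fin (q + 1), (if y ≤ (fun i => ff (t i)) then 1 else 0) = (q + 1) ^ zc y := by
  induction m with
  | zero => 
    have : ∀ t : Fin 0 → Fin (q + 1), y ≤ (fun i => ff (t i)) := fun t i => i.elim0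
    simp [this, zc]
  | succ m ih =>
    obtain ⟨b, y, rfl⟩ : ∃ b y', y = (Fin.cons b y' : Fin (m + 1) → Fin 2) :=
      ⟨y 0, Fin.tail y, (Fin.cons_self_tail y).symm⟩
    rw [sum_cons, zc_cons]
    simp only [comp_cons, Fin.cons_le_cons]
    fin_cases b
    · simp [ih, pow_add]
    · rw [Fin.sum_univ_succ]
      have h0 : ff (0 : Fin (q + 1)) = 1 := by simp [ff]
      have h1 : ∀ i : Fin q, ff (i.succ) = 0 := by simp [ff]
      have h2 : ¬ ((1 : Fin 2) ≤ 0) := by decide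
      have e : (⟨1, by decide⟩ : Fin 2) = 1 := rfl
      simp only [Fin.mk_one, h0, h1, h2, le_refl, true_and, false_and, if_false, ih]
      simp

open Classical in
lemma count_GG (q : ℕ) {m : ℕ} (y : Fin m → Fin 2) :
    ∑ t : Fin (m + 1) → Fin (q + 1), (if GG y (fun i => ff (t i)) then 1 else 0)
      = (q + 1) ^ (zc y + 1) + oc y * q * (q + 1) ^ zc y := by
  induction m with
  | zero => 
    have : ∀ t : Fin 1 → Fin (q + 1), GG y (fun i => ff (t i)) :=
      fun t => ⟨_, by simp, le_refl _⟩
    simp [this, zc, oc]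
  | succ m ih =>
    obtain ⟨b, y, rfl⟩ : ∃ b y', y = (Fin.cons b y' : Fin (m + 1) → Fin 2) :=
      ⟨y 0, Fin.tail y, (Fin.cons_self_tail y).symm⟩
    rw [sum_cons, zc_cons, oc_cons]
    simp only [comp_cons]
    obtain rfl | rfl : b = 0 ∨ b = 1 := by omega
    · simp only [GG_cons_of_le _ _ _ _ (Fin.zero_le _), ih]
      simp
      ring
    · rw [Fin.sum_univ_succ]
      have h0 : ff (0 : Fin (q + 1)) = 1 := by simp [ff]
      have h1 : ∀ i : Fin q, ff (i.succ) = 0 := by simp [ff]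
      simp only [h0, h1, GG_cons_of_le _ _ _ _ (le_refl _), ih, GG_cons_one_zero, count_le, zc_cons]
      simp
      ring

/-- Monotone column from its threshold. -/
def ee {q : ℕ} (j : Fin (q + 1)) (a : Fin q) : Fin 2 := if j.val ≤ a.val then 1 else 0

lemma ee_inj {q : ℕ} {j j' : Fin (q + 1)} (h : ∀ a : Fin q, ee j a = ee j' a) : j = j' := by
  by_contra hne
  rcases lt_or_gt_of_ne hne with hl | hl
  · have := h ⟨j.val, by omega⟩
    simp [ee] at this
    omega
  · have := h ⟨j'.val, by omega⟩
    simp [ee] at this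
    omega

lemma ee_mono {q : ℕ} (j : Fin (q + 1)) {a b : Fin q} (h : a ≤ b) : ee j a ≤ ee j b := by
  unfold ee
  split_ifs <;> omega

lemma ee_surj {q : ℕ} (c : Fin q → Fin 2) (hc : ∀ a b, a ≤ b → c a ≤ c b) :
    ∃ j : Fin (q + 1), ∀ a, ee j a = c a := by
  classical
  have hex : ∃ j : ℕ, ∀ h : j < q, c ⟨j, h⟩ = 1 := ⟨q, fun h => absurd h (lt_irrefl _)⟩
  have hle : Nat.find hex ≤ q := Nat.find_min' hex (fun h => absurd h (lt_irrefl _))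
  refine ⟨⟨Nat.find hex, by omega⟩, fun a => ?_⟩
  unfold ee
  split_ifs with h
  · simp only at h
    have h1 := Nat.find_spec hex (by omega)
    have h2 := hc ⟨Nat.find hex, by omega⟩ a h
    rw [h1] at h2
    omega
  · simp only [not_le] at h
    have h1 := Nat.find_min hex h
    push Not at h1
    obtain ⟨_, h1⟩ := h1
    have : c a ≠ 1 := h1
    omega


theorem core (q m : ℕ) (hq : 0 < q) (y : Fin m → Fin 2) (w : ℕ)
    (hw : (Finset.univ.filter fun i => y i = 1).card = w) :
    Nat.card {t : Fin q → Fin (m + 1) → Fin 2 //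
      (∀ a b : Fin q, a ≤ b → t a ≤ t b) ∧
      ∃ s₁ : Fin (m + 1) → Fin 2,
        (List.ofFn y).Sublist (List.ofFn s₁) ∧ s₁ ≤ t ⟨0, hq⟩}
      = (q + 1) ^ (m + 1 - w) + w * q * (q + 1) ^ (m + 1 - w - 1) := by
  classical
  have hoc : oc y = w := by rw [← hw, oc, Finset.card_filter]
  have hzo : zc y + oc y = m := by
    rw [zc, oc, ← Finset.sum_add_distrib]
    have : ∀ i, ((if y i = 0 then 1 else 0) + (if y i = 1 then 1 else 0) : ℕ) = 1 := by
      intro i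
      obtain h | h : y i = 0 ∨ y i = 1 := by omega
      all_goals simp [h]
    simp [this]
  have e1 : m + 1 - w = zc y + 1 := by omega
  rw [e1, Nat.add_sub_cancel, ← hoc, ← count_GG q y, ← Finset.card_filter, ← Fintype.card_subtype,
    ← Nat.card_eq_fintype_card]
  have he : ∀ j : Fin (q + 1), ee j ⟨0, hq⟩ = ff j := by
    intro j
    simp [ee, ff]
  symm
  refine Nat.card_eq_of_bijective (fun u => ⟨fun a i => ee (u.1 i) a, ?_, ?_⟩) ⟨?_, ?_⟩
  · intro a b hab i
    exact ee_mono _ hab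
  · obtain ⟨s, h1, h2⟩ := u.2
    refine ⟨s, h1, fun i => ?_⟩
    beta_reduce
    rw [he]
    exact h2 i
  · intro u v huv
    apply Subtype.ext
    funext i
    apply ee_inj
    intro a
    exact congrFun (congrFun (congrArg Subtype.val huv) a) i
  · rintro ⟨t, ht, s, h1, h2⟩
    choose u hu using fun i => ee_surj (fun a => t a i) (fun a b hab => ht a b hab i)
    refine ⟨⟨u, s, h1, fun i => ?_⟩, ?_⟩
    · beta_reduce
      rw [← he, hu]
      exact h2 i
    · apply Subtype.ext
      funext a i
      exact hu i a

/-- Proposition `prop_GSPB1`: for a binary sequence `y` of length `n-1` and Hamming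
weight `w`, the number of tuples `(s₂,…,s_k) ∈ ({0,1}^n)^{k-1}` for which there exists
`s₁ ∈ {0,1}^n` with `y` a subsequence of `s₁` of length `n-1` and
`s₁ ≤ s₂ ≤ … ≤ s_k` componentwise equals `k^{n-w} + w(k-1)k^{n-w-1}`. -/
theorem stmt9 (k n : ℕ) (hk : 2 ≤ k) (hn : 1 ≤ n)
    (y : Fin (n - 1) → Fin 2) (w : ℕ)
    (hw : (Finset.univ.filter fun i => y i = 1).card = w) :
    Nat.card {t : Fin (k - 1) → Fin n → Fin 2 //
      (∀ a b : Fin (k - 1), a ≤ b → t a ≤ t b) ∧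
      ∃ s₁ : Fin n → Fin 2,
        (List.ofFn y).Sublist (List.ofFn s₁) ∧ s₁ ≤ t ⟨0, by omega⟩}
      = k ^ (n - w) + w * (k - 1) * k ^ (n - w - 1) := by
  obtain ⟨m, rfl⟩ : ∃ m, n = m + 1 := ⟨n - 1, by omega⟩
  obtain ⟨q, rfl⟩ : ∃ q, k = q + 1 := ⟨k - 1, by omega⟩
  exact core q m (by omega) y w hw
end

section
/- Let k ≥ 2 and n ≥ 2 be integers. Define V_{2,k,n} as the set of all tuples (y, s_2, …, s_k) with y ∈ {0,1}^{n−1} and s_2,…,s_k ∈ {0,1}^n such that there exists s_1 ∈ {0,1}^n with y a subsequence of s_1 of length n−1 and s_1 ≤ s_2 ≤ … ≤ s_k componentwise. Then |V_{2,k,n}| = k·(k+1)^{n−1} + (k−1)·(k+1)^{n−2}·(n−1). -/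
namespace OC

def E {C : Type} (a : C → Fin 2) {n : ℕ} (y : Fin n → Fin 2) (t : Fin (n + 1) → C) : Prop :=
  ∃ s : Fin (n + 1) → Fin 2, (List.ofFn y).Sublist (List.ofFn s) ∧ ∀ i, s i ≤ a (t i)

theorem E_cons {C : Type} (a : C → Fin 2) {n : ℕ} (y : Fin 2) (ys : Fin n → Fin 2)
    (c : C) (ts : Fin (n + 1) → C) :
    E a (Fin.cons y ys : Fin (n + 1) → Fin 2) (Fin.cons c ts : Fin (n + 2) → C) ↔
      (∀ i, (Fin.cons y ys : Fin (n + 1) → Fin 2) i ≤ a (ts i)) ∨ (y ≤ a c ∧ E a ys ts) := by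
  constructor
  · rintro ⟨s, hs, hle⟩
    have hs' : (y :: List.ofFn ys).Sublist (s 0 :: List.ofFn (fun i => s (Fin.succ i))) := by
      simpa [List.ofFn_succ] using hs
    rw [List.cons_sublist_cons'] at hs'
    rcases hs' with h | ⟨h1, h2⟩
    · left
      have h3 : List.ofFn (Fin.cons y ys : Fin (n + 1) → Fin 2)
          = List.ofFn (fun i => s (Fin.succ i)) := by
        have h4 := h.eq_of_length (by simp)
        simpa [List.ofFn_succ] using h4
      have h5 := List.ofFn_injective h3
      intro i
      rw [h5]
      simpa using hle i.succ
    · right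
      refine ⟨?_, fun i => s i.succ, h2, fun i => by simpa using hle i.succ⟩
      rw [h1]; simpa using hle 0
  · rintro (h | ⟨h, s, hs, hle⟩)
    · refine ⟨Fin.cons 0 (Fin.cons y ys : Fin (n + 1) → Fin 2), ?_, ?_⟩
      · rw [List.ofFn_succ (n := n + 1)]
        simp
      · intro i
        refine Fin.cases ?_ (fun j => ?_) i
        · simp
        · simpa using h j
    · refine ⟨Fin.cons y s, ?_, ?_⟩
      · simpa [List.ofFn_succ] using hs
      · intro i
        refine Fin.cases ?_ (fun j => ?_) i
        · simpa using h
        · simpa using hle j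

theorem E_of_tail {C : Type} (a : C → Fin 2) {n : ℕ} (ys : Fin n → Fin 2)
    (ts : Fin (n + 1) → C) (h : ∀ i : Fin n, ys i ≤ a (ts i.succ)) : E a ys ts := by
  refine ⟨Fin.cons 0 ys, ?_, ?_⟩
  · simp [List.ofFn_succ]
  · intro i
    refine Fin.cases ?_ (fun j => ?_) i
    · simp
    · simpa using h j

theorem E_iff {C : Type} (a : C → Fin 2) {n : ℕ} (y : Fin 2) (ys : Fin n → Fin 2)
    (c : C) (ts : Fin (n + 1) → C) :
    E a (Fin.cons y ys : Fin (n + 1) → Fin 2) (Fin.cons c ts : Fin (n + 2) → C) ↔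
      (y ≤ a c ∧ E a ys ts) ∨
      (¬ y ≤ a c ∧ a (ts 0) = 1 ∧ ∀ i : Fin n, ys i ≤ a (ts i.succ)) := by
  rw [E_cons, Fin.forall_fin_succ]
  simp only [Fin.cons_zero, Fin.cons_succ]
  constructor
  · rintro (⟨h1, h2⟩ | h)
    · by_cases hy : y ≤ a c
      · exact Or.inl ⟨hy, E_of_tail a ys ts h2⟩
      · refine Or.inr ⟨hy, ?_, h2⟩
        generalize a c = u at *
        generalize a (ts 0) = v at *
        revert y u v; decide
    · exact Or.inl h
  · rintro (h | ⟨h1, h2, h3⟩)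
    · exact Or.inr h
    · refine Or.inl ⟨?_, h3⟩
      rw [h2]; clear h1; revert y; decide

theorem card_P {C : Type} [Fintype C] (a : C → Fin 2) (r : ℕ)
    (h0 : Nat.card {c // a c = 0} = r) (h1 : Nat.card {c // a c = 1} = 1) :
    Nat.card {p : Fin 2 × C // p.1 ≤ a p.2} = r + 2 := by
  classical
  rw [Nat.card_eq_fintype_card, Fintype.card_subtype] at *
  rw [Finset.card_filter] at *
  rw [Fintype.sum_prod_type, Fin.sum_univ_two]
  have e0 : ∀ c, (if (0 : Fin 2) ≤ a c then 1 else 0) =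
    (if a c = 0 then 1 else 0) + (if a c = 1 then 1 else 0) := by
    intro c; generalize a c = u; revert u; decide
  have e1 : ∀ c, (if (1 : Fin 2) ≤ a c then 1 else 0) = (if a c = 1 then 1 else 0) := by
    intro c; generalize a c = u; revert u; decide
  simp only [e0, e1, Finset.sum_add_distrib]
  omega

theorem card_N {C : Type} [Fintype C] (a : C → Fin 2) (r : ℕ)
    (h0 : Nat.card {c // a c = 0} = r) :
    Nat.card {p : Fin 2 × C // ¬ p.1 ≤ a p.2} = r := by
  classical
  rw [Nat.card_eq_fintype_card, Fintype.card_subtype] at *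
  rw [Finset.card_filter] at *
  rw [Fintype.sum_prod_type, Fin.sum_univ_two]
  have e0 : ∀ c, (if ¬ (0 : Fin 2) ≤ a c then 1 else 0) = 0 := by
    intro c; generalize a c = u; revert u; decide
  have e1 : ∀ c, (if ¬ (1 : Fin 2) ≤ a c then 1 else 0) = (if a c = 0 then 1 else 0) := by
    intro c; generalize a c = u; revert u; decide
  simp only [e0, e1]
  simpa using h0

theorem card_B {C : Type} [Fintype C] (a : C → Fin 2) (r : ℕ)
    (h0 : Nat.card {c // a c = 0} = r) (h1 : Nat.card {c // a c = 1} = 1) (n : ℕ) :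
    Nat.card {p : (Fin n → Fin 2) × (Fin n → C) // ∀ i, p.1 i ≤ a (p.2 i)} = (r + 2) ^ n := by
  have e : {p : (Fin n → Fin 2) × (Fin n → C) // ∀ i, p.1 i ≤ a (p.2 i)} ≃
      (Fin n → {p : Fin 2 × C // p.1 ≤ a p.2}) :=
    { toFun := fun p i => ⟨(p.1.1 i, p.1.2 i), p.2 i⟩
      invFun := fun f => ⟨(fun i => (f i).1.1, fun i => (f i).1.2), fun i => (f i).2⟩
      left_inv := fun p => rfl
      right_inv := fun f => rfl }
  rw [Nat.card_congr e, Nat.card_fun, card_P a r h0 h1]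
  simp

theorem card_T {C : Type} [Fintype C] (a : C → Fin 2) (r : ℕ)
    (h0 : Nat.card {c // a c = 0} = r) (h1 : Nat.card {c // a c = 1} = 1) (n : ℕ) :
    Nat.card {p : (Fin n → Fin 2) × (Fin (n + 1) → C) //
      a (p.2 0) = 1 ∧ ∀ i : Fin n, p.1 i ≤ a (p.2 i.succ)} = (r + 2) ^ n := by
  have e : {p : (Fin n → Fin 2) × (Fin (n + 1) → C) //
      a (p.2 0) = 1 ∧ ∀ i : Fin n, p.1 i ≤ a (p.2 i.succ)} ≃
      {c // a c = 1} × {p : (Fin n → Fin 2) × (Fin n → C) // ∀ i, p.1 i ≤ a (p.2 i)} :=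
    { toFun := fun p => (⟨p.1.2 0, p.2.1⟩, ⟨(p.1.1, fun i => p.1.2 i.succ), p.2.2⟩)
      invFun := fun q => ⟨(q.2.1.1, Fin.cons q.1.1 q.2.1.2),
        by simpa using q.1.2, by simpa using q.2.2⟩
      left_inv := fun p => by
        apply Subtype.ext
        apply Prod.ext
        · rfl
        · exact Fin.cons_self_tail p.1.2
      right_inv := fun q => rfl }
  rw [Nat.card_congr e, Nat.card_prod, h1, card_B a r h0 h1, one_mul]

theorem card_E {C : Type} [Fintype C] (a : C → Fin 2) (r : ℕ)
    (h0 : Nat.card {c // a c = 0} = r) (h1 : Nat.card {c // a c = 1} = 1) (n : ℕ) :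
    Nat.card {p : (Fin (n + 1) → Fin 2) × (Fin (n + 2) → C) // E a p.1 p.2} =
    (r + 2) * Nat.card {p : (Fin n → Fin 2) × (Fin (n + 1) → C) // E a p.1 p.2} +
      r * (r + 2) ^ n := by
  classical
  let X := Fin 2 × C
  let Y := (Fin n → Fin 2) × (Fin (n + 1) → C)
  let P : X × Y → Prop := fun q => q.1.1 ≤ a q.1.2 ∧ E a q.2.1 q.2.2
  let Q : X × Y → Prop := fun q => ¬ q.1.1 ≤ a q.1.2 ∧
    (a (q.2.2 0) = 1 ∧ ∀ i : Fin n, q.2.1 i ≤ a (q.2.2 i.succ))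
  have e : {p : (Fin (n + 1) → Fin 2) × (Fin (n + 2) → C) // E a p.1 p.2} ≃
      {q : X × Y // P q ∨ Q q} := by
    refine (Equiv.subtypeEquiv (Equiv.trans (Equiv.prodProdProdComm _ _ _ _) (Equiv.prodCongr
      (Fin.consEquiv (fun _ : Fin (n + 1) => Fin 2)) (Fin.consEquiv (fun _ : Fin (n + 2) => C)))) ?_).symm
    rintro ⟨⟨y, c⟩, ⟨ys, ts⟩⟩
    exact (E_iff a y ys c ts).symm
  have hd : Disjoint P Q := by
    rw [disjoint_iff]
    ext q
    simp only [P, Q, Pi.inf_apply, inf_Prop_eq, Pi.bot_apply, Prop.bot_eq_false]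
    tauto
  have hP : Nat.card {q // P q} = (r + 2) *
      Nat.card {p : (Fin n → Fin 2) × (Fin (n + 1) → C) // E a p.1 p.2} := by
    rw [← card_P a r h0 h1, ← Nat.card_prod]
    exact Nat.card_congr (Equiv.subtypeProdEquivProd
      (p := fun x : Fin 2 × C => x.1 ≤ a x.2) (q := fun y : Y => E a y.1 y.2))
  have hQ : Nat.card {q // Q q} = r * (r + 2) ^ n := by
    rw [← card_T a r h0 h1 n]
    conv_rhs => rw [← card_N a r h0, ← Nat.card_prod]
    exact Nat.card_congr (Equiv.subtypeProdEquivProd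
      (p := fun x : Fin 2 × C => ¬ x.1 ≤ a x.2)
      (q := fun y : Y => a (y.2 0) = 1 ∧ ∀ i : Fin n, y.1 i ≤ a (y.2 i.succ)))
  rw [Nat.card_congr e, Nat.card_congr (subtypeOrEquiv P Q hd), Nat.card_sum, hP, hQ]

theorem card_E0 {C : Type} [Fintype C] (a : C → Fin 2) (r : ℕ)
    (h0 : Nat.card {c // a c = 0} = r) (h1 : Nat.card {c // a c = 1} = 1) :
    Nat.card {p : (Fin 0 → Fin 2) × (Fin 1 → C) // E a p.1 p.2} = r + 1 := by
  classical
  have hE : ∀ p : (Fin 0 → Fin 2) × (Fin 1 → C), E a p.1 p.2 := fun p =>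
    E_of_tail a _ _ (fun i => i.elim0)
  rw [Nat.card_congr (Equiv.subtypeUnivEquiv hE)]
  have hC : Nat.card C = r + 1 := by
    have hs := congrArg₂ (· + ·) h0 h1
    simp only [← Nat.card_sum] at hs
    rw [← hs]
    refine Nat.card_congr ((Equiv.sumCompl (fun c => a c = 0)).symm.trans
      (Equiv.sumCongr (Equiv.refl _) (Equiv.subtypeEquivRight ?_)))
    intro c; generalize a c = u; revert u; decide
  rw [Nat.card_eq_fintype_card] at hC
  simp [hC]

theorem card_all {C : Type} [Fintype C] (a : C → Fin 2) (r : ℕ)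
    (h0 : Nat.card {c // a c = 0} = r) (h1 : Nat.card {c // a c = 1} = 1) (n : ℕ) :
    Nat.card {p : (Fin (n + 1) → Fin 2) × (Fin (n + 2) → C) // E a p.1 p.2} =
      (r + 1) * (r + 2) ^ (n + 1) + r * (r + 2) ^ n * (n + 1) := by
  induction n with
  | zero => rw [card_E a r h0 h1, card_E0 a r h0 h1]; ring
  | succ n ih => rw [card_E a r h0 h1, ih]; ring

/-- columns -/
def Col (m : ℕ) : Type := {c : Fin (m + 1) → Fin 2 // ∀ i j, i ≤ j → c i ≤ c j}

noncomputable instance (m : ℕ) : Fintype (Col m) := by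
  classical
  unfold Col; infer_instance

def top (m : ℕ) (c : Col m) : Fin 2 := c.1 0

theorem card_top1 (m : ℕ) : Nat.card {c : Col m // top m c = 1} = 1 := by
  rw [Nat.card_eq_one_iff_exists]
  refine ⟨⟨⟨fun _ => 1, fun _ _ _ => le_rfl⟩, rfl⟩, ?_⟩
  rintro ⟨⟨c, hc⟩, h⟩
  apply Subtype.ext
  apply Subtype.ext
  funext i
  have h2 := hc 0 i (Fin.zero_le _)
  have h' : c 0 = 1 := h
  rw [h'] at h2
  change c i = 1
  generalize c i = u at *
  revert u; decide

theorem card_top0 (m : ℕ) : Nat.card {c : Col m // top m c = 0} = m + 1 := by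
  let f : Fin (m + 1) → {c : Col m // top m c = 0} := fun j =>
    ⟨⟨fun i => if j < i then 1 else 0, by
      intro x y hxy
      by_cases h : j < x
      · simp [h, h.trans_le hxy]
      · simp [h]⟩, by simp [top]⟩
  have hf : Function.Bijective f := by
    constructor
    · intro x y hxy
      have h : ∀ i, (if x < i then (1 : Fin 2) else 0) = if y < i then 1 else 0 :=
        fun i => congrFun (congrArg (fun z => z.1.1) hxy) i
      rcases lt_trichotomy x y with h1 | h1 | h1
      · have := h y; simp [h1] at this
      · exact h1
      · have := h x; simp [h1] at this
    · rintro ⟨⟨c, hc⟩, h⟩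
      have h' : c 0 = 0 := h
      let S := Finset.univ.filter (fun i => c i = 0)
      have hS : S.Nonempty := ⟨0, by simp [S, h']⟩
      have hm : c (S.max' hS) = 0 := by
        have := S.max'_mem hS
        simpa [S] using this
      refine ⟨S.max' hS, ?_⟩
      apply Subtype.ext
      apply Subtype.ext
      funext i
      change (if S.max' hS < i then (1 : Fin 2) else 0) = c i
      split_ifs with hi
      · have : c i ≠ 0 := fun h0 => absurd (S.le_max' i (by simp [S, h0])) (not_le.mpr hi)
        generalize c i = u at *
        revert u; decide
      · have := hc i _ (not_lt.mp hi)
        rw [hm] at this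
        generalize c i = u at *
        revert u; decide
  rw [← Nat.card_congr (Equiv.ofBijective f hf)]
  simp

end OC

/-- Lemma `lem_errorspace`: `|V_{2,k,n}| = k(k+1)^{n-1} + (k-1)(k+1)^{n-2}(n-1)`,
where `V_{2,k,n}` is the set of tuples `(y, s₂, …, s_k)` with `y ∈ {0,1}^{n-1}`,
`s₂,…,s_k ∈ {0,1}^n`, such that there exists `s₁ ∈ {0,1}^n` with `y` a subsequence
of `s₁` of length `n-1` and `s₁ ≤ s₂ ≤ … ≤ s_k` componentwise. -/
theorem stmt10 (k n : ℕ) (hk : 2 ≤ k) (hn : 2 ≤ n) :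
    Nat.card {p : (Fin (n - 1) → Fin 2) × (Fin (k - 1) → Fin n → Fin 2) //
      (∀ a b : Fin (k - 1), a ≤ b → p.2 a ≤ p.2 b) ∧
      ∃ s₁ : Fin n → Fin 2,
        (List.ofFn p.1).Sublist (List.ofFn s₁) ∧ s₁ ≤ p.2 ⟨0, by omega⟩}
      = k * (k + 1) ^ (n - 1) + (k - 1) * (k + 1) ^ (n - 2) * (n - 1) := by
  obtain ⟨m, rfl⟩ : ∃ m, k = m + 2 := ⟨k - 2, by omega⟩
  obtain ⟨l, rfl⟩ : ∃ l, n = l + 2 := ⟨n - 2, by omega⟩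
  have key := OC.card_all (OC.top m) (m + 1) (OC.card_top0 m) (OC.card_top1 m) l
  have e : {p : (Fin (l + 1) → Fin 2) × (Fin (m + 1) → Fin (l + 2) → Fin 2) //
      (∀ a b : Fin (m + 1), a ≤ b → p.2 a ≤ p.2 b) ∧
      ∃ s₁ : Fin (l + 2) → Fin 2,
        (List.ofFn p.1).Sublist (List.ofFn s₁) ∧ s₁ ≤ p.2 0} ≃
      {p : (Fin (l + 1) → Fin 2) × (Fin (l + 2) → OC.Col m) // OC.E (OC.top m) p.1 p.2} :=
    { toFun := fun p => ⟨(p.1.1, fun i => ⟨fun j => p.1.2 j i, fun x y h => p.2.1 x y h i⟩), p.2.2⟩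
      invFun := fun q => ⟨(q.1.1, fun j i => (q.1.2 i).1 j),
        fun x y h i => (q.1.2 i).2 x y h, q.2⟩
      left_inv := fun p => rfl
      right_inv := fun q => rfl }
  rw [← Nat.card_congr e] at key
  exact key
end

section
/- Let q ≥ 2, k ≥ 2 and n ≥ 2 be integers, Q_{q,k} = binom(k+q−1, q−1), and define m_{q,k} = 1 − (1/Q_{q,k}^2)·Σ_{a=0}^{q−1} binom(k+q−a−2, k−1)^2. Then for every real number t > 0, the number of sequences c ∈ Φ_{q,k}^n whose first row c_1 has fewer than (n−1)·m_{q,k} + 1 − sqrt(t·(n−1)·ln n) runs is at most Q_{q,k}^n / n^t. -/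
open ProbabilityTheory MeasureTheory in
theorem hoeff (p θ : ℝ) (h0 : 0 ≤ p) (h1 : p ≤ 1) :
    (1 - p) * Real.exp (θ * p) + p * Real.exp (θ * (p - 1)) ≤ Real.exp (θ ^ 2 / 8) := by
  let μ : Measure ℝ := ENNReal.ofReal p • Measure.dirac 1 + ENNReal.ofReal (1 - p) • Measure.dirac 0
  have hμ : IsProbabilityMeasure μ := ⟨by
    simp [μ, ← ENNReal.ofReal_add h0 (sub_nonneg.2 h1)]⟩
  have hint : ∀ g : ℝ → ℝ, ∫ x, g x ∂μ = p * g 1 + (1 - p) * g 0 := by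
    intro g
    rw [integral_add_measure, integral_smul_measure, integral_smul_measure, integral_dirac,
      integral_dirac, ENNReal.toReal_ofReal h0, ENNReal.toReal_ofReal (sub_nonneg.2 h1)]
    · simp
    · exact (integrable_dirac (by simp)).smul_measure (by simp)
    · exact (integrable_dirac (by simp)).smul_measure (by simp)
  have hs := hasSubgaussianMGF_of_mem_Icc (μ := μ) (X := fun x => x) (a := 0) (b := 1)
    aemeasurable_id (by
      rw [ae_iff]
      simp [μ])
  have h := hs.mgf_le (-θ)
  rw [mgf, hint, hint] at h
  simp at h
  have e : -(θ * (1 - p)) = θ * (p - 1) := by ring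
  rw [e] at h
  have e2 : ((2:ℝ) ^ 2)⁻¹ * θ ^ 2 / 2 = θ ^ 2 / 8 := by ring
  rw [e2] at h
  linarith

noncomputable def ev {V : Type*} (d : V → V → ℝ) : List V → ℝ
  | [] => 0
  | [_] => 0
  | a :: b :: l => d a b + ev d l

noncomputable def od {V : Type*} (d : V → V → ℝ) : List V → ℝ
  | [] => 0
  | _ :: l => ev d l

theorem runs_aux {V α : Type*} [DecidableEq α] (f : V → α) (m : ℝ) (l : List V) : ∀ a : V,
    ev (fun a b => m - if f a = f b then 0 else 1) (a :: l) + 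
    od (fun a b => m - if f a = f b then 0 else 1) (a :: l) =
     l.length * m + 1 - ((((a :: l).map f).destutter (· ≠ ·)).length : ℝ) := by
  induction l with
  | nil => intro a; simp [ev, od]
  | cons b l ih =>
    intro a
    have h := ih b
    simp only [ev, od, List.map_cons, List.destutter_cons', List.destutter'_cons, List.length_cons] at h ⊢
    by_cases hab : f a = f b
    · simp only [hab, ne_eq, not_true_eq_false, if_true, if_false]
      push_cast
      simp only [ne_eq] at h
      linarith
    · simp only [hab, ne_eq, not_false_eq_true, if_true, if_false, List.length_cons]
      push_cast
      simp only [ne_eq] at h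
      linarith

theorem sum_succ {V : Type*} [Fintype V] (F : List V → ℝ) (n : ℕ) :
    ∑ c : Fin (n+1) → V, F (List.ofFn c) = ∑ a, ∑ c : Fin n → V, F (a :: List.ofFn c) := by
  rw [← (Fin.consEquiv (fun _ => V)).sum_comp, Fintype.sum_prod_type]
  simp [Fin.consEquiv, List.ofFn_succ]

theorem sum_ev {V : Type*} [Fintype V] (d : V → V → ℝ) (K : ℝ) (hK : 0 ≤ K)
    (h : ∑ a, ∑ b, Real.exp (d a b) ≤ (Fintype.card V : ℝ) ^ 2 * K) : ∀ n : ℕ,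
    ∑ c : Fin n → V, Real.exp (ev d (List.ofFn c)) ≤ (Fintype.card V : ℝ) ^ n * K ^ (n / 2)
  | 0 => by simp [ev]
  | 1 => by rw [sum_succ (fun l => Real.exp (ev d l))]; simp [ev]
  | n + 2 => by
    rw [sum_succ (fun l => Real.exp (ev d l))]
    have : ∀ a, ∑ c : Fin (n+1) → V, Real.exp (ev d (a :: List.ofFn c))
      = ∑ b, Real.exp (d a b) * ∑ c : Fin n → V, Real.exp (ev d (List.ofFn c)) := by
      intro a
      rw [sum_succ (fun l => Real.exp (ev d (a :: l)))]
      simp [ev, Real.exp_add, Finset.mul_sum]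
    simp_rw [this, ← Finset.sum_mul]
    have e : (n + 2) / 2 = n / 2 + 1 := by omega
    calc _ ≤ ((Fintype.card V : ℝ) ^ 2 * K) * ((Fintype.card V : ℝ) ^ n * K ^ (n / 2)) := by
          apply mul_le_mul h (sum_ev d K hK h n)
          · positivity
          · positivity
      _ = _ := by rw [e]; ring

theorem sum_od {V : Type*} [Fintype V] (d : V → V → ℝ) (K : ℝ) (hK : 0 ≤ K)
    (h : ∑ a, ∑ b, Real.exp (d a b) ≤ (Fintype.card V : ℝ) ^ 2 * K) (n : ℕ) :
    ∑ c : Fin (n+1) → V, Real.exp (od d (List.ofFn c)) ≤ (Fintype.card V : ℝ) ^ (n+1) * K ^ (n / 2) := by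
  rw [sum_succ (fun l => Real.exp (od d l))]
  simp only [od, Finset.sum_const, Finset.card_univ, nsmul_eq_mul]
  have := mul_le_mul_of_nonneg_left (sum_ev d K hK h n) (Nat.cast_nonneg (α := ℝ) (Fintype.card V))
  refine this.trans (le_of_eq (by ring))

theorem ev_smul {V : Type*} (d : V → V → ℝ) (s : ℝ) : ∀ l, ev (fun a b => s * d a b) l = s * ev d l
  | [] => by simp [ev]
  | [_] => by simp [ev]
  | a :: b :: l => by simp [ev, ev_smul d s l, mul_add]

theorem od_smul {V : Type*} (d : V → V → ℝ) (s : ℝ) : ∀ l, od (fun a b => s * d a b) l = s * od d l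
  | [] => by simp [od]
  | a :: l => by simp [od, ev_smul]

theorem sum_tot {V : Type*} [Fintype V] (d : V → V → ℝ) (s : ℝ)
    (h : ∑ a, ∑ b, Real.exp (2 * s * d a b) ≤ (Fintype.card V : ℝ) ^ 2 * Real.exp (s ^ 2 / 2)) (n : ℕ) :
    ∑ c : Fin (n+1) → V, Real.exp (s * (ev d (List.ofFn c) + od d (List.ofFn c)))
      ≤ (Fintype.card V : ℝ) ^ (n+1) * Real.exp (s ^ 2 * n / 4) := by
  have h1 := sum_ev _ _ (Real.exp_pos _).le h (n+1)
  have h2 := sum_od _ _ (Real.exp_pos _).le h n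
  simp only [ev_smul, od_smul] at h1 h2
  have cs := Finset.sum_mul_sq_le_sq_mul_sq Finset.univ
    (fun c : Fin (n+1) → V => Real.exp (s * ev d (List.ofFn c)))
    (fun c : Fin (n+1) → V => Real.exp (s * od d (List.ofFn c)))
  simp only [← Real.exp_add, ← mul_add, ← Real.exp_nat_mul] at cs
  simp only [Nat.cast_ofNat, ← mul_assoc] at cs
  refine (sq_le_sq₀ (by positivity) (by positivity)).1 ?_
  refine cs.trans ((mul_le_mul h1 h2 (by positivity) (by positivity)).trans (le_of_eq ?_))
  rw [← Real.exp_nat_mul, ← Real.exp_nat_mul, mul_pow, ← Real.exp_nat_mul, mul_mul_mul_comm, ← Real.exp_add, ← sq]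
  congr 2
  have : (n + 1) / 2 + n / 2 = n := by omega
  have : (((n + 1) / 2 : ℕ) : ℝ) + ((n / 2 : ℕ) : ℝ) = n := by exact_mod_cast this
  rw [← add_mul, this]; push_cast; ring

theorem pair_sum {V α : Type*} [Fintype V] [Nonempty V] [Fintype α] [DecidableEq α] (f : V → α) (m θ : ℝ)
   (hm : m = 1 - (1 / (Fintype.card V : ℝ) ^ 2) * ∑ a, ((Finset.univ.filter (fun v => f v = a)).card : ℝ) ^ 2) :
    ∑ a, ∑ b, Real.exp (θ * (m - if f a = f b then 0 else 1)) ≤ (Fintype.card V : ℝ) ^ 2 * Real.exp (θ ^ 2 / 8) := by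
  set Q : ℝ := (Fintype.card V : ℝ)
  have hQ : 0 < Q := by simp [Q, Fintype.card_pos]
  have hc : ∑ a : V, ∑ b : V, (if f a = f b then (1:ℝ) else 0) =
      ∑ a, ((Finset.univ.filter (fun v => f v = a)).card : ℝ) ^ 2 := by
    have : ∀ a : V, ∑ b : V, (if f a = f b then (1:ℝ) else 0) = ((Finset.univ.filter (fun v => f v = f a)).card : ℝ) := by
      intro a
      simp [Finset.sum_ite, eq_comm]
    simp_rw [this]
    rw [← Finset.sum_fiberwise Finset.univ f]
    refine Finset.sum_congr rfl fun a _ => ?_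
    rw [Finset.sum_congr rfl (g := fun _ => ((Finset.univ.filter (fun v => f v = a)).card : ℝ))]
    · simp [sq]
    · intro v hv; simp at hv; rw [hv]
  rw [← hc] at hm
  set S := ∑ a : V, ∑ b : V, (if f a = f b then (1:ℝ) else 0)
  have hS : S = Q ^ 2 * (1 - m) := by rw [hm]; field_simp; ring
  have hS0 : 0 ≤ S := Finset.sum_nonneg fun _ _ => Finset.sum_nonneg fun _ _ => by split_ifs <;> simp
  have hS1 : S ≤ Q ^ 2 := by
    calc S ≤ ∑ a : V, ∑ b : V, (1:ℝ) := Finset.sum_le_sum fun _ _ => Finset.sum_le_sum fun _ _ => by split_ifs <;> simp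
      _ = _ := by simp [Q, sq]
  have hm1 : m ≤ 1 := by by_contra hh; nlinarith [sq_pos_of_pos hQ]
  have hm0 : 0 ≤ m := by by_contra hh; nlinarith [sq_pos_of_pos hQ]
  have key := hoeff m θ hm0 hm1
  have : ∀ a b : V, Real.exp (θ * (m - if f a = f b then 0 else 1)) =
     (if f a = f b then (1:ℝ) else 0) * (Real.exp (θ * m) - Real.exp (θ * (m - 1))) + Real.exp (θ * (m-1)) := by
    intro a b; split_ifs <;> simp
  simp_rw [this, Finset.sum_add_distrib, ← Finset.sum_mul]
  change S * _ + _ ≤ _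
  rw [hS]
  simp only [Finset.sum_const, Finset.card_univ, nsmul_eq_mul]
  change _ + Q * (Q * _) ≤ _
  have := mul_le_mul_of_nonneg_left key (sq_nonneg Q)
  linarith

theorem main_count {V α : Type*} [Fintype V] [Nonempty V] [Fintype α] [DecidableEq α] (f : V → α) (m t : ℝ)
   (ht : 0 < t)
   (hm : m = 1 - (1 / (Fintype.card V : ℝ) ^ 2) * ∑ a, ((Finset.univ.filter (fun v => f v = a)).card : ℝ) ^ 2)
   (n : ℕ) (hn : 2 ≤ n) (R : (Fin n → V) → ℕ) 
   (hR : ∀ x, R x = (((List.ofFn x).map f).destutter (· ≠ ·)).length) :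
   (Set.ncard {x : Fin n → V | (R x : ℝ) < ((n : ℝ) - 1) * m + 1 - Real.sqrt (t * ((n : ℝ) - 1) * Real.log n)} : ℝ)
      ≤ (Fintype.card V : ℝ) ^ n / (n : ℝ) ^ t := by
  classical
  obtain ⟨N, rfl⟩ : ∃ N, n = N + 1 := ⟨n - 1, by omega⟩
  have hN : (0:ℝ) < N := by exact_mod_cast (by omega : 0 < N)
  have hlog : 0 < Real.log ((N + 1 : ℕ) : ℝ) := Real.log_pos (by push_cast; linarith)
  set lam := Real.sqrt (t * (((N + 1 : ℕ) : ℝ) - 1) * Real.log ((N + 1 : ℕ) : ℝ)) with hlam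
  have hl2 : lam ^ 2 = t * N * Real.log ((N + 1 : ℕ) : ℝ) := by
    rw [hlam, Real.sq_sqrt]
    · push_cast; ring
    · have : (0:ℝ) ≤ ((N + 1 : ℕ) : ℝ) - 1 := by push_cast; linarith
      positivity
  have hl0 : 0 ≤ lam := Real.sqrt_nonneg _
  set s := 2 * lam / N with hs
  have hs0 : 0 ≤ s := by positivity
  have tot := sum_tot (V := V) (fun a b => m - if f a = f b then 0 else 1) s (by
    have := pair_sum f m (2 * s) hm
    refine this.trans (le_of_eq ?_)
    congr 2; ring) N
  rw [Set.ncard_eq_toFinset_card', Set.toFinset_ofPred]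
  have hr : ∀ x : Fin (N+1) → V, ev (fun a b => m - if f a = f b then 0 else 1) (List.ofFn x) + 
    od (fun a b => m - if f a = f b then 0 else 1) (List.ofFn x) = N * m + 1 - R x := by
    intro x
    rw [hR, List.ofFn_succ, runs_aux]; simp
  simp_rw [hr] at tot
  have b1 : ((Finset.univ.filter fun x : Fin (N+1) → V => (R x : ℝ) < (((N + 1 : ℕ) : ℝ) - 1) * m + 1 - lam).card : ℝ) * Real.exp (s * lam)
      ≤ ∑ x : Fin (N+1) → V, Real.exp (s * (N * m + 1 - R x)) := by
    rw [← nsmul_eq_mul, ← Finset.sum_const]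
    refine (Finset.sum_le_sum fun x hx => ?_).trans (Finset.sum_le_sum_of_subset_of_nonneg (Finset.filter_subset _ _) fun _ _ _ => (Real.exp_pos _).le)
    simp only [Finset.mem_filter, Finset.mem_univ, true_and] at hx
    push_cast at hx
    apply Real.exp_le_exp.2
    apply mul_le_mul_of_nonneg_left _ hs0
    linarith
  have b2 := b1.trans tot
  rw [← le_div_iff₀ (Real.exp_pos _)] at b2
  refine b2.trans (le_of_eq ?_)
  rw [Real.rpow_def_of_pos (by positivity), mul_div_assoc, ← Real.exp_sub, div_eq_mul_inv (_ ^ _) (Real.exp _), ← Real.exp_neg]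
  congr 2
  have : s ^ 2 * N / 4 - s * lam = - (lam ^ 2 / N) := by rw [hs]; field_simp; ring
  rw [this, hl2]; field_simp

theorem hockey (q k : ℕ) (a : ℕ) (ha : a < q) :
    ∑ b : Fin q with a ≤ b.val, (k + (q - 1 - b.val)).choose k = (k + 1 + (q - 1 - a)).choose (k + 1) := by
  have := Nat.sum_range_add_choose (q - 1 - a) k
  rw [show k + 1 + (q - 1 - a) = q - 1 - a + k + 1 by omega, ← this]
  refine Finset.sum_bij (fun b _ => q - 1 - b.val) ?_ ?_ ?_ ?_
  · intro b hb; simp at hb ⊢; omega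
  · intro b hb c hc h; ext; have := b.2; have := c.2; omega
  · intro j hj
    simp at hj
    exact ⟨⟨q - 1 - j, by omega⟩, by simp; omega, by simp; omega⟩
  · intro b hb; rw [add_comm]

open Classical in
theorem card_mono_first (q : ℕ) : ∀ (k : ℕ) (a : Fin q),
    (Finset.univ.filter (fun g : Fin (k+1) → Fin q => Monotone g ∧ g 0 = a)).card
      = (k + (q - 1 - a.val)).choose k
  | 0, a => by
    simp only [zero_add, Nat.choose_zero_right]
    rw [Finset.card_eq_one]
    refine ⟨fun _ => a, ?_⟩
    ext g
    simp only [Finset.mem_filter, Finset.mem_univ, true_and, Finset.mem_singleton]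
    constructor
    · rintro ⟨_, h⟩; funext i; rw [show i = 0 from Fin.ext (by have := i.2; simp only [Fin.val_zero]; omega), h]
    · rintro rfl; exact ⟨monotone_const, rfl⟩
  | k + 1, a => by
    rw [← hockey q k a.val a.2]
    have : (Finset.univ.filter (fun g : Fin (k+2) → Fin q => Monotone g ∧ g 0 = a)).card
       = (Finset.univ.filter (fun g : Fin (k+1) → Fin q => Monotone g ∧ a ≤ g 0)).card := by
      symm
      refine Finset.card_bij (fun g _ => Matrix.vecCons a g) ?_ ?_ ?_
      · intro g hg
        simp only [Finset.mem_filter, Finset.mem_univ, true_and] at hg ⊢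
        exact ⟨monotone_vecCons.2 ⟨hg.2, hg.1⟩, rfl⟩
      · intro g _ h _ e
        have := congrArg Matrix.vecTail e
        simpa using this
      · intro g hg
        simp only [Finset.mem_filter, Finset.mem_univ, true_and] at hg
        have e : Matrix.vecCons a (Matrix.vecTail g) = g := by
          rw [← hg.2]; exact Matrix.cons_head_tail g
        have hm := hg.1
        rw [← e, monotone_vecCons] at hm
        exact ⟨Matrix.vecTail g, by simp [hm.1, hm.2], e⟩
    rw [this, Finset.card_eq_sum_card_fiberwise (f := fun g => g 0) (t := Finset.univ.filter (fun b : Fin q => a.val ≤ b.val))]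
    · refine Finset.sum_congr rfl fun b hb => ?_
      rw [← card_mono_first q k b, Finset.filter_filter]
      congr 1
      ext g
      simp only [Finset.mem_filter, Finset.mem_univ, true_and] at hb ⊢
      constructor
      · rintro ⟨⟨h1, _⟩, h2⟩; exact ⟨h1, h2⟩
      · rintro ⟨h1, h2⟩; exact ⟨⟨h1, by rw [h2]; exact hb⟩, h2⟩
    · intro g hg
      simp at hg ⊢
      exact hg.2

open Classical in
theorem card_mono (q k : ℕ) (hq : 0 < q) :
    (Finset.univ.filter (fun g : Fin (k+1) → Fin q => Monotone g)).card
      = (k + q).choose (q - 1) := by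
  rw [Finset.card_eq_sum_card_fiberwise (f := fun g => g 0) (t := Finset.univ) (by intro; simp)]
  simp_rw [Finset.filter_filter, card_mono_first]
  have := hockey q k 0 hq
  simp only [zero_le, Finset.filter_true] at this
  rw [this, show k + 1 + (q - 1 - 0) = k + q by omega]
  exact Nat.choose_symm_of_eq_add (by omega)



/-- The number of runs (maximal constant substrings) of a finite sequence. -/
def numRuns {n : ℕ} {α : Type*} [DecidableEq α] (x : Fin n → α) : ℕ :=
  ((List.ofFn x).destutter (· ≠ ·)).length

/-- Lemma `lem_runlemma`: with `m_{q,k} = 1 - Q^{-2} ∑_{a<q} C(k+q-a-2, k-1)²`, for any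
`t > 0` the number of `c ∈ Φ_{q,k}^n` whose first row has fewer than
`(n-1)m_{q,k} + 1 - √(t(n-1)ln n)` runs is at most `Q^n / n^t`. -/
theorem stmt11 (q k n : ℕ) (hq : 2 ≤ q) (hk : 2 ≤ k) (hn : 2 ≤ n)
    (m : ℝ)
    (hm : m = 1 - (1 / (Nat.choose (k + q - 1) (q - 1) : ℝ) ^ 2) *
      ∑ a ∈ Finset.range q, (Nat.choose (k + q - a - 2) (k - 1) : ℝ) ^ 2)
    (t : ℝ) (ht : 0 < t) :
    (Set.ncard {c : Fin k → Fin n → Fin q |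
        ValidSeq q k n c ∧
        (numRuns (c ⟨0, by omega⟩) : ℝ) <
          ((n : ℝ) - 1) * m + 1 - Real.sqrt (t * ((n : ℝ) - 1) * Real.log n)} : ℝ)
      ≤ (Nat.choose (k + q - 1) (q - 1) : ℝ) ^ n / (n : ℝ) ^ t := by
  classical
  obtain ⟨K, rfl⟩ : ∃ K, k = K + 1 := ⟨k - 1, by omega⟩
  let V := {g : Fin (K + 1) → Fin q // Monotone g}
  have : Nonempty V := ⟨⟨fun _ => ⟨0, by omega⟩, monotone_const⟩⟩
  have hcard : Fintype.card V = (K + 1 + q - 1).choose (q - 1) := by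
    rw [show K + 1 + q - 1 = K + q by omega, ← card_mono q K (by omega)]
    exact Fintype.card_subtype _
  have hfib : ∀ a : Fin q, (Finset.univ.filter (fun v : V => v.1 0 = a)).card
      = (K + 1 + q - a.val - 2).choose (K + 1 - 1) := by
    intro a
    have := a.2
    rw [show K + 1 + q - a.val - 2 = K + (q - 1 - a.val) by omega, Nat.add_sub_cancel,
      ← card_mono_first q K a]
    refine Finset.card_bij (fun v _ => v.1) ?_ ?_ ?_
    · intro v hv
      simp only [Finset.mem_filter, Finset.mem_univ, true_and] at hv ⊢
      exact ⟨v.2, hv⟩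
    · intro v _ w _ h
      exact Subtype.ext h
    · intro g hg
      simp only [Finset.mem_filter, Finset.mem_univ, true_and] at hg
      exact ⟨⟨g, hg.1⟩, by simpa using hg.2, rfl⟩
  have hm' : m = 1 - (1 / (Fintype.card V : ℝ) ^ 2) *
      ∑ a, ((Finset.univ.filter (fun v : V => v.1 0 = a)).card : ℝ) ^ 2 := by
    rw [hm, hcard]
    simp_rw [hfib]
    rw [Fin.sum_univ_eq_sum_range
      (fun a => ((K + 1 + q - a - 2).choose (K + 1 - 1) : ℝ) ^ 2) q]
  have key := main_count (fun v : V => v.1 0) m t ht hm' n hn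
    (fun x => numRuns (fun j => (x j).1 0)) (by
      intro x
      simp only [numRuns, List.map_ofFn]
      rfl)
  rw [hcard] at key
  refine le_trans ?_ key
  norm_cast
  refine le_trans (Set.ncard_le_ncard ?_ (Set.toFinite _))
    (Set.ncard_image_le (f := fun (x : Fin n → V) (i : Fin (K + 1)) (j : Fin n) => (x j).1 i)
      (Set.toFinite _))
  rintro c ⟨hc, hlt⟩
  exact ⟨fun j => ⟨fun i => c i j, hc j⟩, hlt, rfl⟩
end

section
/- Let k ≥ 2 be an integer. Then limsup_{n→∞} [ A^D_{2,k}(n;(1,0,…,0)) · 2k · n ] / [ (k+1)^2 · ( k·(k+1)^{n−1} + (k−1)·(k+1)^{n−2}·(n−1) ) ] ≤ 1; that is, A^D_{2,k}(n;(1,0,…,0)) ≤ ((k+1)^2/(2k)) · |V_{2,k,n}| / n · (1+o(1)), where |V_{2,k,n}| = k·(k+1)^{n−1} + (k−1)·(k+1)^{n−2}·(n−1). -/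
/-- A binary sequence in `Φ_{2,k}^n`, viewed as a `k × n` matrix over `{0,1}`,
is valid if every column is nondecreasing. -/
def ValidSeq2 (k n : ℕ) (s : Fin k → Fin n → Fin 2) : Prop :=
  ∀ j : Fin n, Monotone fun i : Fin k => s i j

/-- The `(1,0,…,0)`-deletion ball of `c ∈ Φ_{2,k}^n`: pairs `(y₁, (s₂,…,s_k))` where
`y₁` is a subsequence of the first row of `c` of length `n-1` and the remaining
components are the other rows of `c`. -/
def DelBall1 (k n : ℕ) (hk : 0 < k) (c : Fin k → Fin n → Fin 2) :
    Set (List (Fin 2) × (Fin (k - 1) → Fin n → Fin 2)) :=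
  {p | p.1.length = n - 1 ∧ p.1.Sublist (List.ofFn (c ⟨0, hk⟩)) ∧
       ∀ i : Fin (k - 1), p.2 i = c ⟨i.val + 1, by have := i.isLt; omega⟩}

/-- `C ⊆ Φ_{2,k}^n` is a `(1,0,…,0)`-CDCC. -/
def IsCDCC1 (k n : ℕ) (hk : 0 < k) (C : Set (Fin k → Fin n → Fin 2)) : Prop :=
  (∀ c ∈ C, ValidSeq2 k n c) ∧
  ∀ c ∈ C, ∀ c' ∈ C, c ≠ c' → Disjoint (DelBall1 k n hk c) (DelBall1 k n hk c')

/-- `A^D_{2,k}(n; (1,0,…,0))`: the maximum size of a `(1,0,…,0)`-CDCC in `Φ_{2,k}^n`. -/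
noncomputable def maxCDCC1 (k n : ℕ) (hk : 0 < k) : ℕ :=
  sSup {m | ∃ C : Set (Fin k → Fin n → Fin 2), IsCDCC1 k n hk C ∧ C.ncard = m}

section helper
variable {α : Type*} [Fintype α] [DecidableEq α]

def goodB (a b : α) : Finset (α × α × α) := {(a,a,a),(b,a,a),(a,b,a),(a,a,b)}

def canonL (a b : α) : List α → List α
  | x :: y :: z :: t => if (x,y,z) ∈ goodB a b then a :: a :: a :: t else x :: y :: z :: canonL a b t
  | l => l

def allL (α : Type*) [Fintype α] [DecidableEq α] : ℕ → Finset (List α)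
  | 0 => {[]}
  | n+1 => (Finset.univ ×ˢ allL α n).image (fun p : α × List α => p.1 :: p.2)

def canL (a b : α) : ℕ → Finset (List α)
  | 0 => allL α 0
  | 1 => allL α 1
  | 2 => allL α 2
  | n+3 => ((goodB a b)ᶜ ×ˢ canL a b n).image
      (fun p : (α × α × α) × List α => p.1.1 :: p.1.2.1 :: p.1.2.2 :: p.2) ∪
      (allL α n).image (fun t => a :: a :: a :: t)

theorem mem_allL (l : List α) : l ∈ allL α l.length := by
  induction l with
  | nil => simp [allL]
  | cons x t ih => simp [allL, ih]

theorem card_allL (n : ℕ) : (allL α n).card ≤ Fintype.card α ^ n := by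
  induction n with
  | zero => simp [allL]
  | succ n ih =>
    refine Finset.card_image_le.trans ?_
    rw [Finset.card_product, Finset.card_univ, pow_succ, mul_comm]
    gcongr

theorem mem_canL (a b : α) (l : List α) : canonL a b l ∈ canL a b l.length := by
  fun_induction canonL a b l with
  | case1 x y z t h =>
    simp only [List.length_cons, canL]
    exact Finset.mem_union_right _ (Finset.mem_image_of_mem _ (mem_allL t))
  | case2 x y z t h ih =>
    simp only [List.length_cons, canL]
    refine Finset.mem_union_left _ (Finset.mem_image.2 ⟨((x,y,z), canonL a b t), ?_, rfl⟩)
    simp [h, ih]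
  | case3 l h =>
    match l, h with
    | [], _ => exact mem_allL (α := α) []
    | [x], _ => exact mem_allL [x]
    | [x,y], _ => exact mem_allL [x,y]
    | x::y::z::t, h => exact (h x y z t rfl).elim

theorem card_goodB {a b : α} (h : a ≠ b) : (goodB a b).card = 4 := by
  simp [goodB, h, h.symm]

theorem card_canL {a b : α} (h : a ≠ b) (n : ℕ) :
    ((canL a b n).card : ℝ) ≤ (Fintype.card α : ℝ) ^ n *
      (1/4 + (1 - 4 / (Fintype.card α : ℝ) ^ 3) ^ (n / 3)) := by
  have hcast : ∀ n, ((allL α n).card : ℝ) ≤ (Fintype.card α : ℝ) ^ n := fun n => by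
    exact_mod_cast card_allL (α := α) n
  have hq4 : 4 ≤ Fintype.card α ^ 3 := by
    rw [← card_goodB h]
    refine (Finset.card_le_univ _).trans ?_
    simp [pow_succ, mul_assoc]
  have hq4' : (4:ℝ) ≤ (Fintype.card α : ℝ) ^ 3 := by exact_mod_cast hq4
  have hbase : ∀ n, ((allL α n).card : ℝ) ≤ (Fintype.card α : ℝ) ^ n *
      (1/4 + (1 - 4 / (Fintype.card α : ℝ) ^ 3) ^ 0) := fun n => by
    have := hcast n
    have h0 : (0:ℝ) ≤ (Fintype.card α : ℝ) ^ n := by positivity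
    simp only [pow_zero]; nlinarith
  induction n using Nat.strong_induction_on with
  | _ n ih =>
  match n, ih with
  | 0, _ => exact hbase 0
  | 1, _ => exact hbase 1
  | 2, _ => exact hbase 2
  | n+3, ih =>
    have ih := ih n (by omega)
    have h1 : (canL a b (n+3)).card ≤
        (Fintype.card α ^ 3 - 4) * (canL a b n).card + (allL α n).card := by
      rw [canL]
      refine (Finset.card_union_le _ _).trans ?_
      refine Nat.add_le_add (Finset.card_image_le.trans ?_) Finset.card_image_le
      rw [Finset.card_product, Finset.card_compl, card_goodB h]
      simp [pow_succ, mul_assoc]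
    have h2 : ((canL a b (n+3)).card : ℝ) ≤
        ((Fintype.card α:ℝ) ^ 3 - 4) * (canL a b n).card + (allL α n).card := by
      have : ((Fintype.card α ^ 3 - 4 : ℕ) : ℝ) = (Fintype.card α:ℝ) ^ 3 - 4 := by
        push_cast [Nat.cast_sub hq4]; rfl
      rw [← this]; exact_mod_cast h1
    have h3 := hcast n
    have e : (n+3)/3 = n/3+1 := by omega
    rw [e]
    set Q := (Fintype.card α : ℝ)
    set R := (1 - 4 / Q ^ 3) ^ (n/3) with hR
    have h4 : (Q^3 - 4) * ((canL a b n).card:ℝ) ≤ (Q^3-4) * (Q^n * (1/4 + R)) :=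
      mul_le_mul_of_nonneg_left ih (by linarith)
    have h5 : Q^(n+3) * (1/4 + (1 - 4 / Q ^ 3) ^ (n/3+1)) =
      (Q^3-4) * (Q^n * (1/4 + R)) + Q^n := by
      have hQ0 : Q ≠ 0 := by
        intro h0
        rw [h0] at hq4'
        norm_num at hq4'
      rw [pow_succ (1 - 4 / Q ^ 3), ← hR, pow_add]
      field_simp
      ring
    rw [h5]; linarith

theorem canonL_conf {β γ : Type*} (g : α → β) (h : α → γ) (a b : α) (hab : h a = h b)
    (l l' : List α) (he : canonL a b l = canonL a b l') :
    l = l' ∨ (l.map h = l'.map h ∧ ∃ y : List β, y.length + 1 = l.length ∧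
      y.Sublist (l.map g) ∧ y.Sublist (l'.map g)) := by
  have hg : ∀ x y z, (x,y,z) ∈ goodB a b → ∀ t : List α,
      (x::y::z::t).map h = h a :: h a :: h a :: t.map h ∧
      (g a :: g a :: t.map g).Sublist ((x::y::z::t).map g) := by
    intro x y z hx t
    simp only [goodB, Finset.mem_insert, Finset.mem_singleton, Prod.mk.injEq] at hx
    rcases hx with ⟨rfl,rfl,rfl⟩|⟨rfl,rfl,rfl⟩|⟨rfl,rfl,rfl⟩|⟨rfl,rfl,rfl⟩ <;>
      simp [hab]
  have haaa : (a,a,a) ∈ goodB a b := by simp [goodB]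
  have hlen : ∀ l, (canonL a b l).length = l.length := by
    intro l
    fun_induction canonL a b l <;> simp_all
  fun_induction canonL a b l generalizing l' with
  | case1 x y z t hx =>
    match l' with
    | [] | [_] | [_,_] => simp [canonL] at he
    | x'::y'::z'::t' =>
      rw [canonL] at he
      split_ifs at he with hx'
      · simp only [List.cons.injEq, true_and] at he
        subst he
        right
        refine ⟨by rw [(hg _ _ _ hx t).1, (hg _ _ _ hx' t).1], _, ?_, (hg _ _ _ hx t).2, (hg _ _ _ hx' t).2⟩
        simp
      · simp only [List.cons.injEq] at he
        obtain ⟨rfl, rfl, rfl, _⟩ := he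
        exact (hx' haaa).elim
  | case2 x y z t hx ih =>
    match l' with
    | [] | [_] | [_,_] => simp [canonL] at he
    | x'::y'::z'::t' =>
      rw [canonL] at he
      split_ifs at he with hx'
      · simp only [List.cons.injEq] at he
        obtain ⟨rfl, rfl, rfl, _⟩ := he
        exact (hx haaa).elim
      · simp only [List.cons.injEq] at he
        obtain ⟨rfl, rfl, rfl, he⟩ := he
        rcases ih t' he with rfl | ⟨h1, w, h2, h3, h4⟩
        · left; rfl
        · right
          refine ⟨by simp [h1], g x :: g y :: g z :: w, by simp [h2], by simp [h3], by simp [h4]⟩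
  | case3 l hl =>
    have e := congrArg List.length he
    rw [hlen] at e
    left
    rw [he]
    match l', l, hl with
    | [], _, _ => rfl
    | [_], _, _ => rfl
    | [_,_], _, _ => rfl
    | x'::y'::z'::t', x::y::z::t, hl => exact (hl x y z t rfl).elim
    | x'::y'::z'::t', [], hl => simp at e
    | x'::y'::z'::t', [_], hl => simp at e
    | x'::y'::z'::t', [_,_], hl => simp at e
end helper

def decC (k : ℕ) (w : Fin (k+1)) (i : Fin k) : Fin 2 := if k ≤ i.val + w.val then 1 else 0

theorem exists_decC (k : ℕ) (v : Fin k → Fin 2) (hv : Monotone v) : ∃ w, decC k w = v := by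
  by_cases h : ∃ m : ℕ, ∃ hm : m < k, v ⟨m, hm⟩ = 1
  · classical
    obtain ⟨hm, h1⟩ := Nat.find_spec h
    refine ⟨⟨k - Nat.find h, by omega⟩, ?_⟩
    funext i
    simp only [decC]
    split_ifs with hi
    · have : v ⟨_, hm⟩ ≤ v i := hv (by rw [Fin.le_def]; simp only; omega)
      rw [h1] at this
      omega
    · have := Nat.find_min h (m := i.val) (by omega)
      simp only [not_exists] at this
      have := this i.isLt
      simp only [Fin.eta] at this
      omega
  · push Not at h
    refine ⟨0, ?_⟩
    funext i
    have := h i.val i.isLt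
    simp only [Fin.eta] at this
    have hi := i.isLt
    rw [decC, if_neg (by simp)]
    omega

theorem maxC_le (k : ℕ) (hk : 2 ≤ k) (n : ℕ) (hk0 : 0 < k) :
    (maxCDCC1 k n hk0 : ℝ) ≤ ((k:ℝ)+1) ^ n * (1/4 + (1 - 4 / ((k:ℝ)+1) ^ 3) ^ (n / 3)) := by
  let a : Fin (k+1) := ⟨k-1, by omega⟩
  let b : Fin (k+1) := ⟨k, by omega⟩
  have hab : a ≠ b := by simp [a, b, Fin.ext_iff]; omega
  have hcard := card_canL hab n
  simp only [Fintype.card_fin, Nat.cast_add, Nat.cast_one] at hcard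
  refine le_trans ?_ hcard
  norm_cast
  refine csSup_le ⟨0, ∅, ⟨by simp, by simp⟩, by simp⟩ ?_
  rintro m ⟨C, ⟨hC1, hC2⟩, rfl⟩
  choose! enc henc using exists_decC k
  let L : (Fin k → Fin n → Fin 2) → List (Fin (k+1)) := fun c => List.ofFn (fun j => enc (fun i => c i j))
  rw [← Set.ncard_coe_finset]
  refine Set.ncard_le_ncard_of_injOn (fun c => canonL a b (L c)) ?_ ?_ (Finset.finite_toSet _)
  · intro c hc
    have := mem_canL a b (L c)
    simpa [L] using this
  · intro c hc c' hc' he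
    by_contra hne
    let g : Fin (k+1) → Fin 2 := fun w => decC k w ⟨0, hk0⟩
    let h : Fin (k+1) → Fin (k-1) → Fin 2 := fun w i => decC k w ⟨i.val+1, by have := i.isLt; omega⟩
    have hh : h a = h b := by
      funext i
      simp only [h, a, b, decC]
      rw [if_pos (by omega), if_pos (by omega)]
    have hgL : ∀ c ∈ C, (L c).map g = List.ofFn (c ⟨0, hk0⟩) := by
      intro c hc
      simp only [L, List.map_ofFn, g]
      congr 1
      funext j
      simp only [Function.comp]
      rw [henc _ (hC1 c hc j)]
    have hhL : ∀ c ∈ C, (L c).map h = List.ofFn (fun j (i : Fin (k-1)) => c ⟨i.val+1, by have := i.isLt; omega⟩ j) := by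
      intro c hc
      simp only [L, List.map_ofFn, h]
      congr 1
      funext j i
      simp only [Function.comp]
      rw [henc _ (hC1 c hc j)]
    rcases canonL_conf g h a b hh (L c) (L c') he with e | ⟨e, y, hy, hs, hs'⟩
    · apply hne
      have e := List.ofFn_injective e
      funext i j
      have := congrFun e j
      have h2 := henc _ (hC1 c hc j)
      rw [this, henc _ (hC1 c' hc' j)] at h2
      exact (congrFun h2 i).symm
    · rw [hhL c hc, hhL c' hc'] at e
      have e := List.ofFn_injective e
      rw [hgL c hc] at hs
      rw [hgL c' hc'] at hs'
      have hlen : y.length = n - 1 := by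
        simp only [L, List.length_ofFn] at hy; omega
      have hd := Set.disjoint_left.1 (hC2 c hc c' hc' hne)
      refine @hd (y, fun i : Fin (k-1) => c ⟨i.val + 1, by have := i.isLt; omega⟩)
        ⟨hlen, hs, fun i => rfl⟩ ⟨hlen, hs', fun i => ?_⟩
      funext j
      exact congrFun (congrFun e j) i

/-- Theorem `thm_asymptotic1del`:
`A^D_{2,k}(n;(1,0,…,0)) ≤ ((k+1)²/(2k)) · |V_{2,k,n}| / n · (1 + o(1))`, where
`|V_{2,k,n}| = k(k+1)^{n-1} + (k-1)(k+1)^{n-2}(n-1)`; expressed as a `limsup ≤ 1`. -/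
theorem stmt13 (k : ℕ) (hk : 2 ≤ k) :
    Filter.limsup (fun n : ℕ =>
      (maxCDCC1 k n (by omega) : ℝ) * (2 * (k : ℝ) * n) /
        (((k : ℝ) + 1) ^ 2 *
          ((k : ℝ) * ((k : ℝ) + 1) ^ (n - 1) +
            ((k : ℝ) - 1) * ((k : ℝ) + 1) ^ (n - 2) * ((n : ℝ) - 1))))
      Filter.atTop ≤ 1 := by
  have hk' : (2:ℝ) ≤ k := by exact_mod_cast hk
  set r : ℝ := 1 - 4 / ((k:ℝ)+1) ^ 3 with hr
  have h27 : (27:ℝ) ≤ ((k:ℝ)+1)^3 := by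
    calc (27:ℝ) = 3^3 := by norm_num
      _ ≤ _ := by gcongr; linarith
  have hr0 : 0 ≤ r := by
    rw [hr, sub_nonneg, div_le_one (by linarith)]; linarith
  have hr1 : r < 1 := by
    have : 0 < 4 / ((k:ℝ)+1) ^ 3 := by positivity
    linarith
  have hlim : Filter.Tendsto (fun n : ℕ => 1 + 4 * r ^ (n/3)) Filter.atTop (nhds 1) := by
    have := ((tendsto_pow_atTop_nhds_zero_of_lt_one hr0 hr1).comp
      (Nat.tendsto_div_const_atTop (n := 3) (by norm_num))).const_mul 4 |>.const_add 1
    simpa using this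
  have hV : ∀ n : ℕ, 2 ≤ n → ((k : ℝ) - 1) * ((k:ℝ)+1)^n * n ≤ (((k : ℝ) + 1) ^ 2 *
          ((k : ℝ) * ((k : ℝ) + 1) ^ (n - 1) +
            ((k : ℝ) - 1) * ((k : ℝ) + 1) ^ (n - 2) * ((n : ℝ) - 1))) := by
    intro n hn
    obtain ⟨m, rfl⟩ := Nat.exists_eq_add_of_le hn
    have e1 : 2 + m - 1 = m + 1 := by omega
    have e2 : 2 + m - 2 = m := by omega
    rw [e1, e2]
    have : 0 ≤ ((k:ℝ)+1)^(m+2) * (k * (k+1) - (k-1)) := by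
      apply mul_nonneg (by positivity); nlinarith
    have e3 : ((k:ℝ)+1)^(2+m) = ((k:ℝ)+1)^2 * (k+1)^m := by ring
    rw [e3]
    push_cast
    ring_nf at this ⊢
    linarith
  refine le_trans (Filter.limsup_le_limsup ?_ ?_ hlim.isBoundedUnder_le) hlim.limsup_eq.le
  · filter_upwards [Filter.eventually_ge_atTop 2] with n hn
    have hn' : (2:ℝ) ≤ n := by exact_mod_cast hn
    have hpos : 0 < ((k : ℝ) - 1) * ((k:ℝ)+1)^n * n := by
      have : 0 < (k:ℝ) - 1 := by linarith
      positivity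
    have hA := maxC_le k hk n (by omega)
    rw [div_le_iff₀ (hpos.trans_le (hV n hn))]
    have hR : 0 ≤ r ^ (n/3) := by positivity
    calc _ ≤ (((k:ℝ)+1) ^ n * (1/4 + r ^ (n / 3))) * (2 * k * n) := by gcongr
      _ ≤ (1 + 4 * r^(n/3)) * (((k : ℝ) - 1) * ((k:ℝ)+1)^n * n) := by
        have : 0 ≤ (1 + 4 * r^(n/3)) * (((k:ℝ)+1)^n * n) * (k - 1 - k/2) := by
          apply mul_nonneg (by positivity); linarith
        linarith
      _ ≤ _ := by
        have := hV n hn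
        gcongr
  · refine Filter.IsBoundedUnder.isCoboundedUnder_le ⟨0, ?_⟩
    rw [Filter.eventually_map]
    filter_upwards [Filter.eventually_ge_atTop 2] with n hn
    refine div_nonneg (by positivity) (le_trans ?_ (hV n hn))
    have : 0 ≤ (k:ℝ) - 1 := by linarith
    positivity
end

section
/- Let k ≥ 2 and n ≥ 3 be integers and 0 ≤ a ≤ n. Define C_1^D = { c ∈ Φ_{2,k}^n : Σ_{i=1}^k VT(c_i) ≡ a (mod n+1) }. Then C_1^D is a k-resolution 1-CDCC. Moreover, there exists a choice of a ∈ {0,1,…,n} such that |C_1^D| ≥ (k+1)^n/(n+1), i.e., the redundancy of C_1^D is at most log_{k+1}(n+1). -/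
/-- The Varshamov–Tenengolts weight `VT(x) = ∑ i·x[i]` (positions `1,…,n`). -/
def VT {n : ℕ} (x : Fin n → Fin 2) : ℕ := ∑ i : Fin n, (i.val + 1) * (x i).val

/-- The set of outputs obtained from `c ∈ Φ_{2,k}^n` when a single deletion occurs
in one (unknown) row: `y i` is a subsequence of row `i` of length `n-1` for one
index `i`, and all other rows are unchanged. -/
def OutOne (k n : ℕ) (c : Fin k → Fin n → Fin 2) : Set (Fin k → List (Fin 2)) :=
  {y | ∃ i : Fin k, (y i).length = n - 1 ∧ (y i).Sublist (List.ofFn (c i)) ∧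
        ∀ r : Fin k, r ≠ i → y r = List.ofFn (c r)}

/-- `C ⊆ Φ_{2,k}^n` is a `k`-resolution `1`-CDCC: it corrects a single deletion in
one unknown row. -/
def Is1CDCC (k n : ℕ) (C : Set (Fin k → Fin n → Fin 2)) : Prop :=
  (∀ c ∈ C, ValidSeq2 k n c) ∧
  ∀ c ∈ C, ∀ c' ∈ C, c ≠ c' → Disjoint (OutOne k n c) (OutOne k n c')

def LV : ℕ → List (Fin 2) → ℕ
  | _, [] => 0
  | s, a :: l => s * a.val + LV (s + 1) l

def LW (l : List (Fin 2)) : ℕ := (l.map Fin.val).sum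

lemma LV_succ (l : List (Fin 2)) : ∀ s, LV (s + 1) l = LV s l + LW l := by
  induction l with
  | nil => intro s; simp [LV, LW]
  | cons a l ih =>
    intro s
    have h := ih (s + 1)
    simp only [LV, LW, List.map_cons, List.sum_cons] at *
    rw [h]; ring

lemma LV_append (l l' : List (Fin 2)) : ∀ s, LV s (l ++ l') = LV s l + LV (s + l.length) l' := by
  induction l with
  | nil => intro s; simp [LV]
  | cons a l ih =>
    intro s
    simp only [LV, List.cons_append, List.length_cons]
    rw [ih, show s + 1 + l.length = s + (l.length + 1) by ring]; ring

lemma LV_ofFn {n : ℕ} : ∀ (s : ℕ) (x : Fin n → Fin 2),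
    LV s (List.ofFn x) = ∑ i : Fin n, (s + i.val) * (x i).val := by
  induction n with
  | zero => intro s x; simp [LV]
  | succ n ih =>
    intro s x
    rw [List.ofFn_succ, LV, ih, Fin.sum_univ_succ]
    simp only [Fin.val_zero, Fin.val_succ, add_zero]
    congr 1
    apply Finset.sum_congr rfl
    intro i _
    ring

lemma VT_eq {n : ℕ} (x : Fin n → Fin 2) : VT x = LV 1 (List.ofFn x) := by
  rw [LV_ofFn, VT]
  exact Finset.sum_congr rfl fun i _ => by ring

lemma LW_le (l : List (Fin 2)) : LW l ≤ l.length := by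
  induction l with
  | nil => simp [LW]
  | cons a l ih => simp only [LW, List.map_cons, List.sum_cons, List.length_cons] at *; omega

lemma LW_zero (l : List (Fin 2)) (h : LW l = 0) : l = List.replicate l.length 0 := by
  induction l with
  | nil => rfl
  | cons a l ih =>
    simp only [LW, List.map_cons, List.sum_cons, List.length_cons] at *
    rw [List.replicate_succ, ← ih (by omega)]
    congr 1
    ext; simp; omega

lemma LW_full (l : List (Fin 2)) (h : LW l = l.length) : l = List.replicate l.length 1 := by
  induction l with
  | nil => rfl
  | cons a l ih =>
    have := LW_le l
    simp only [LW, List.map_cons, List.sum_cons, List.length_cons] at *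
    rw [List.replicate_succ, ← ih (by omega)]
    congr 1
    ext; simp; omega

lemma sub_split {y x : List (Fin 2)} (h : y.Sublist x) (hl : x.length = y.length + 1) :
    ∃ u a v, x = u ++ a :: v ∧ y = u ++ v := by
  induction h with
  | slnil => simp at hl
  | @cons l₁ l₂ a h _ =>
    have : l₁ = l₂ := h.eq_of_length (by simp at hl; omega)
    exact ⟨[], a, l₂, rfl, this⟩
  | @cons_cons l₁ l₂ a h ih =>
    obtain ⟨u, b, v, h1, h2⟩ := ih (by simp at hl; omega)
    exact ⟨a :: u, b, v, by simp [h1], by simp [h2]⟩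

lemma mod_inj {n a b : ℕ} (ha : a < n + 1) (hb : b < n + 1) (h : a ≡ b [MOD (n + 1)]) : a = b :=
  Nat.ModEq.eq_of_lt_of_lt h ha hb

lemma core_s14 (n : ℕ) (u w v : List (Fin 2)) (a b : Fin 2)
    (hlen : (u ++ a :: (w ++ v)).length = n)
    (h : LV 1 (u ++ a :: (w ++ v)) ≡ LV 1 (u ++ w ++ b :: v) [MOD (n + 1)]) :
    u ++ a :: (w ++ v) = u ++ w ++ b :: v := by
  have hw := LW_le w
  simp only [List.length_append, List.length_cons] at hlen
  have e1 : LV 1 (u ++ a :: (w ++ v)) = (LV 1 u + LV (1 + u.length) w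
      + LV (1 + u.length + w.length + 1) v) + ((1 + u.length) * a.val + LW w) := by
    rw [LV_append, LV, LV_append, LV_succ w,
      show 1 + u.length + 1 + w.length = 1 + u.length + w.length + 1 by ring]
    ring
  have e2 : LV 1 (u ++ w ++ b :: v) = (LV 1 u + LV (1 + u.length) w
      + LV (1 + u.length + w.length + 1) v) + (1 + u.length + w.length) * b.val := by
    rw [LV_append, LV_append, LV, List.length_append,
      show 1 + (u.length + w.length) = 1 + u.length + w.length by ring]
    ring
  rw [e1, e2] at h
  have h := Nat.ModEq.add_left_cancel' _ h
  rw [List.append_assoc]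
  congr 1
  have key : ∀ c : Fin 2, w = List.replicate w.length c → c :: (w ++ v) = w ++ c :: v := by
    intro c hc
    rw [hc, ← List.cons_append, ← List.replicate_succ, List.replicate_succ']
    simp
  match a, b with
  | 0, 0 =>
    simp at h
    exact key 0 (LW_zero w (mod_inj (n := n) (by omega) (by omega) h))
  | 0, 1 =>
    simp at h
    have := mod_inj (n := n) (by omega) (by omega) h
    omega
  | 1, 0 =>
    simp at h
    have := mod_inj (n := n) (by omega) (by omega) h
    omega
  | 1, 1 =>
    simp at h
    have := mod_inj (n := n) (by omega) (by omega) h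
    exact key 1 (LW_full w (by omega))

lemma vt_correct (n : ℕ) (x x' y : List (Fin 2)) (hn : 1 ≤ n) (hx : x.length = n)
    (hx' : x'.length = n) (hy : y.length = n - 1) (h1 : y.Sublist x) (h2 : y.Sublist x')
    (h : LV 1 x ≡ LV 1 x' [MOD (n + 1)]) : x = x' := by
  obtain ⟨u, a, v, rfl, r1⟩ := sub_split h1 (by omega)
  obtain ⟨u', b, v', rfl, r2⟩ := sub_split h2 (by omega)
  rw [r1] at r2
  rcases List.append_eq_append_iff.1 r2 with ⟨w, rfl, rfl⟩ | ⟨w, rfl, rfl⟩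
  · exact core_s14 n u w v' a b hx h
  · exact (core_s14 n u' w v b a hx' h.symm).symm

lemma part1 (k n : ℕ) (hn : 3 ≤ n) (a : ℕ) :
      Is1CDCC k n {c : Fin k → Fin n → Fin 2 |
        ValidSeq2 k n c ∧ (∑ i : Fin k, VT (c i)) % (n + 1) = a} := by
  refine ⟨fun c hc => hc.1, ?_⟩
  rintro c ⟨-, hc⟩ c' ⟨-, hc'⟩ hne
  rw [Set.disjoint_left]
  rintro y ⟨i, l1, s1, o1⟩ ⟨j, l2, s2, o2⟩
  apply hne
  have hij : i = j := by
    by_contra hij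
    have := o2 i hij
    rw [this, List.length_ofFn] at l1
    omega
  subst hij
  have hoff : ∀ r, r ≠ i → c r = c' r := fun r hr =>
    List.ofFn_injective ((o1 r hr).symm.trans (o2 r hr))
  have hs : ∑ r ∈ Finset.univ.erase i, VT (c r) = ∑ r ∈ Finset.univ.erase i, VT (c' r) :=
    Finset.sum_congr rfl fun r hr => by rw [hoff r (Finset.ne_of_mem_erase hr)]
  have hm : (∑ i : Fin k, VT (c i)) ≡ (∑ i : Fin k, VT (c' i)) [MOD (n + 1)] := hc.trans hc'.symm
  rw [← Finset.add_sum_erase _ _ (Finset.mem_univ i),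
    ← Finset.add_sum_erase _ (fun r => VT (c' r)) (Finset.mem_univ i), hs] at hm
  have hm := Nat.ModEq.add_right_cancel' _ hm
  simp only [VT_eq] at hm
  have hi : c i = c' i := List.ofFn_injective
    (vt_correct n _ _ _ (by omega) (by simp) (by simp) l1 s1 s2 hm)
  funext r
  by_cases hr : r = i
  · rw [hr, hi]
  · exact hoff r hr

def emb (k n : ℕ) (f : Fin n → Fin (k + 1)) : Fin k → Fin n → Fin 2 :=
  fun i j => if i.val < (f j).val then 0 else 1

lemma emb_valid (k n : ℕ) (f) : ValidSeq2 k n (emb k n f) := by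
  intro j i i' h
  have h : i.val ≤ i'.val := h
  simp only [emb]
  split_ifs
  · exact le_rfl
  · exact Fin.zero_le _
  · omega
  · exact le_rfl

lemma emb_inj (k n : ℕ) : Function.Injective (emb k n) := by
  intro f g h
  funext j
  have key : ∀ i : Fin k, i.val < (f j).val ↔ i.val < (g j).val := by
    intro i
    have := congrFun (congrFun h i) j
    simp only [emb] at this
    split_ifs at this <;> simp_all <;> omega
  ext
  have hf := (f j).isLt
  have hg := (g j).isLt
  by_contra hne
  rcases Nat.lt_or_gt_of_ne hne with hlt | hlt
  · have := key ⟨(f j).val, by omega⟩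
    simp at this; omega
  · have := key ⟨(g j).val, by omega⟩
    simp at this; omega

lemma part2 (k n : ℕ) : ∃ a : ℕ, a ≤ n ∧
      ((k : ℝ) + 1) ^ n / ((n : ℝ) + 1) ≤
        (Set.ncard {c : Fin k → Fin n → Fin 2 |
          ValidSeq2 k n c ∧ (∑ i : Fin k, VT (c i)) % (n + 1) = a} : ℝ) := by
  classical
  obtain ⟨a, ha, hb⟩ := Finset.exists_le_card_fiber_of_nsmul_le_card_of_maps_to
    (s := (Finset.univ : Finset (Fin n → Fin (k + 1)))) (t := Finset.range (n + 1))
    (f := fun f => (∑ i : Fin k, VT (emb k n f i)) % (n + 1))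
    (b := ((k : ℝ) + 1) ^ n / ((n : ℝ) + 1))
    (fun f _ => Finset.mem_range.2 (Nat.mod_lt _ (Nat.succ_pos n)))
    ⟨0, by simp⟩
    (by
      have : (n : ℝ) + 1 ≠ 0 := by positivity
      simp
      field_simp
      exact le_rfl)
  refine ⟨a, by simpa [Nat.lt_succ_iff] using ha, hb.trans ?_⟩
  rw [← Finset.card_image_of_injective _ (emb_inj k n), ← Set.ncard_coe_finset]
  apply Nat.cast_le.2
  apply Set.ncard_le_ncard _ (Set.toFinite _)
  intro c hc
  simp only [Finset.coe_image, Set.mem_image, Finset.mem_coe, Finset.mem_filter] at hc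
  obtain ⟨f, ⟨-, hf⟩, rfl⟩ := hc
  exact ⟨emb_valid k n f, hf⟩


/-- Theorem `thm_1cdcc`: for every `0 ≤ a ≤ n` the VT-type code
`C₁^D = {c ∈ Φ_{2,k}^n : ∑_i VT(c_i) ≡ a (mod n+1)}` is a `1`-CDCC, and for some
choice of `a` its size is at least `(k+1)^n/(n+1)`. -/
theorem stmt14 (k n : ℕ) (hk : 2 ≤ k) (hn : 3 ≤ n) :
    (∀ a : ℕ, a ≤ n →
      Is1CDCC k n {c : Fin k → Fin n → Fin 2 |
        ValidSeq2 k n c ∧ (∑ i : Fin k, VT (c i)) % (n + 1) = a}) ∧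
    ∃ a : ℕ, a ≤ n ∧
      ((k : ℝ) + 1) ^ n / ((n : ℝ) + 1) ≤
        (Set.ncard {c : Fin k → Fin n → Fin 2 |
          ValidSeq2 k n c ∧ (∑ i : Fin k, VT (c i)) % (n + 1) = a} : ℝ) := by
  exact ⟨fun a _ => part1 k n hn a, part2 k n⟩
end

section
/- Let n ≥ 3 and 2 ≤ t ≤ k be integers, and let p be a prime with p > max{k−1, n}. For any residues 0 ≤ a_0, a_1, …, a_{t−1} < p, the code { c ∈ Φ_{2,k}^n : Σ_{i=1}^k i^j·VT(c_i) ≡ a_j (mod p) for all j = 0,1,…,t−1 } is a k-resolution t-(1,…,1)-CDCC. Moreover, there exists a choice of a_0,…,a_{t−1} such that this code has size at least (k+1)^n/p^t, i.e., redundancy at most t·log_{k+1}(p). -/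
/-- Outputs of `c ∈ Φ_{2,k}^n` when one deletion occurs in each of up to `t`
unknown rows. -/
def OutT (k n t : ℕ) (c : Fin k → Fin n → Fin 2) : Set (Fin k → List (Fin 2)) :=
  {y | ∃ S : Finset (Fin k), S.card ≤ t ∧
        (∀ i ∈ S, (y i).length = n - 1 ∧ (y i).Sublist (List.ofFn (c i))) ∧
        ∀ i ∉ S, y i = List.ofFn (c i)}

/-- `C ⊆ Φ_{2,k}^n` is a `t`-`(1,…,1)`-CDCC: it corrects one deletion in each of
up to `t` unknown rows. -/
def IsTCDCC (k n t : ℕ) (C : Set (Fin k → Fin n → Fin 2)) : Prop :=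
  (∀ c ∈ C, ValidSeq2 k n c) ∧
  ∀ c ∈ C, ∀ c' ∈ C, c ≠ c' → Disjoint (OutT k n t c) (OutT k n t c')

def vtl : ℕ → List (Fin 2) → ℕ
  | _, [] => 0
  | s, a :: l => s * a.val + vtl (s + 1) l

def ones : List (Fin 2) → ℕ
  | [] => 0
  | a :: l => a.val + ones l

lemma vtl_append (l1 l2 : List (Fin 2)) (s : ℕ) :
    vtl s (l1 ++ l2) = vtl s l1 + vtl (s + l1.length) l2 := by
  induction l1 generalizing s with
  | nil => simp [vtl]
  | cons a l ih =>
    simp only [List.cons_append, vtl, List.length_cons, ih]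
    rw [show s + 1 + l.length = s + (l.length + 1) by ring]; ring

lemma vtl_succ (l : List (Fin 2)) (s : ℕ) : vtl (s + 1) l = vtl s l + ones l := by
  induction l generalizing s with
  | nil => simp [vtl, ones]
  | cons a l ih => simp only [vtl, ones, ih]; ring

lemma ones_le (l : List (Fin 2)) : ones l ≤ l.length := by
  induction l with
  | nil => simp [ones]
  | cons a l ih => have := a.isLt; simp only [ones, List.length_cons]; omega

lemma ones_zero (l : List (Fin 2)) (h : ones l = 0) : l ++ [0] = 0 :: l := by
  induction l with
  | nil => rfl
  | cons a l ih =>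
    simp only [ones] at h
    have ha : a = 0 := by ext; simp; omega
    rw [List.cons_append, ih (by omega), ha]

lemma ones_full (l : List (Fin 2)) (h : ones l = l.length) : l ++ [1] = 1 :: l := by
  induction l with
  | nil => rfl
  | cons a l ih =>
    simp only [ones, List.length_cons] at h
    have h1 := ones_le l
    have h2 := a.isLt
    have ha : a = 1 := by ext; simp; omega
    rw [List.cons_append, ih (by omega), ha]

lemma vtl_ofFn {n : ℕ} (x : Fin n → Fin 2) (s : ℕ) :
    vtl s (List.ofFn x) = ∑ i : Fin n, (i.val + s) * (x i).val := by
  induction n generalizing s with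
  | zero => simp [vtl]
  | succ n ih =>
    rw [List.ofFn_succ, vtl, ih, Fin.sum_univ_succ]
    congr 1
    · simp
    · apply Finset.sum_congr rfl; intro i _; simp only [Fin.val_succ]; ring

lemma sub_decomp {y x : List (Fin 2)} (h : y.Sublist x) (hl : x.length = y.length + 1) :
    ∃ l1 u l2, x = l1 ++ u :: l2 ∧ y = l1 ++ l2 := by
  induction h with
  | slnil => simp at hl
  | @cons l1 l2 a h ih =>
    have : l1 = l2 := h.eq_of_length (by simp at hl; omega)
    exact ⟨[], a, l2, rfl, by simp [this]⟩
  | @cons_cons l1 l2 a h ih =>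
    obtain ⟨m1, u, m2, h1, h2⟩ := ih (by simpa using hl)
    exact ⟨a :: m1, u, m2, by simp [h1], by simp [h2]⟩

lemma vt_core (p : ℕ) (l1 m l2 : List (Fin 2)) (u v : Fin 2)
    (hp : (l1 ++ u :: (m ++ l2)).length < p)
    (h : vtl 1 (l1 ++ u :: (m ++ l2)) ≡ vtl 1 (l1 ++ m ++ v :: l2) [MOD p]) :
    l1 ++ u :: (m ++ l2) = l1 ++ m ++ v :: l2 := by
  have hlen : l1.length + m.length + 1 < p := by simp at hp; omega
  have h1 := ones_le m
  have e1 : vtl 1 (l1 ++ u :: (m ++ l2)) = (vtl 1 l1 + vtl (1 + l1.length) m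
      + vtl (1 + l1.length + m.length + 1) l2) + ((1 + l1.length) * u.val + ones m) := by
    rw [vtl_append, vtl, vtl_append, vtl_succ m,
      show 1 + l1.length + 1 + m.length = 1 + l1.length + m.length + 1 by ring]
    ring
  have e2 : vtl 1 (l1 ++ m ++ v :: l2) = (vtl 1 l1 + vtl (1 + l1.length) m
      + vtl (1 + l1.length + m.length + 1) l2) + ((1 + l1.length + m.length) * v.val) := by
    rw [vtl_append, vtl, vtl_append, List.length_append, ← add_assoc]
    ring
  rw [e1, e2] at h
  have h2 := Nat.ModEq.add_left_cancel' _ h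
  have h3 : (1 + l1.length) * u.val + ones m = (1 + l1.length + m.length) * v.val := by
    apply Nat.ModEq.eq_of_lt_of_lt h2
    · have := u.isLt
      have : u.val ≤ 1 := by omega
      nlinarith
    · have := v.isLt
      have : v.val ≤ 1 := by omega
      nlinarith
  fin_cases u <;> fin_cases v <;> simp at h3
  · have := ones_zero m h3
    have : m ++ 0 :: l2 = 0 :: (m ++ l2) := by
      rw [← List.cons_append, ← this]; simp
    simp [this]
  · omega
  · have := ones_full m (by omega)
    have : m ++ 1 :: l2 = 1 :: (m ++ l2) := by
      rw [← List.cons_append, ← this]; simp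
    simp [this]

lemma vt_list (p : ℕ) (x x' y : List (Fin 2)) (hx : x.length = y.length + 1)
    (hx' : x'.length = y.length + 1) (hp : x.length < p) (h1 : y.Sublist x) (h2 : y.Sublist x')
    (h : vtl 1 x ≡ vtl 1 x' [MOD p]) : x = x' := by
  obtain ⟨l1, u, l2, rfl, hy⟩ := sub_decomp h1 hx
  obtain ⟨k1, v, k2, rfl, hy'⟩ := sub_decomp h2 hx'
  rw [hy] at hy'
  rcases List.append_eq_append_iff.1 hy' with ⟨m, ha, hb⟩ | ⟨m, ha, hb⟩
  · subst ha hb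
    exact vt_core p _ _ _ _ _ hp h
  · subst ha hb
    exact (vt_core p _ _ _ _ _ (by rw [hx', ← hx]; exact hp) h.symm).symm

lemma vander (k t p : ℕ) (hp : p.Prime) (hpk : k ≤ p) (S : Finset (Fin k)) (hS : S.card ≤ t)
    (d : Fin k → ZMod p) (hd : ∀ i ∉ S, d i = 0)
    (h : ∀ j : ℕ, j < t → ∑ i : Fin k, ((i.val + 1 : ℕ) : ZMod p) ^ j * d i = 0) : ∀ i, d i = 0 := by
  have := Fact.mk hp
  intro i0
  by_cases hi0 : i0 ∈ S
  swap
  · exact hd i0 hi0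
  let P : Polynomial (ZMod p) :=
    ∏ i ∈ S.erase i0, (Polynomial.X - Polynomial.C ((i.val + 1 : ℕ) : ZMod p))
  have hdeg : P.natDegree < t := by
    have : P.natDegree = (S.erase i0).card := Polynomial.natDegree_finsetProd_X_sub_C_eq_card _ _
    rw [this, Finset.card_erase_of_mem hi0]
    have := Finset.card_pos.2 ⟨i0, hi0⟩
    omega
  have hsum : ∑ i : Fin k, P.eval ((i.val + 1 : ℕ) : ZMod p) * d i = 0 := by
    simp_rw [Polynomial.eval_eq_sum_range' hdeg, Finset.sum_mul]
    rw [Finset.sum_comm]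
    apply Finset.sum_eq_zero
    intro j hj
    simp_rw [mul_assoc]
    rw [← Finset.mul_sum, h j (Finset.mem_range.1 hj), mul_zero]
  rw [Finset.sum_eq_single i0] at hsum
  · rcases mul_eq_zero.1 hsum with h0 | h0
    · exfalso
      rw [Polynomial.eval_prod, Finset.prod_eq_zero_iff] at h0
      obtain ⟨i, hi, h0⟩ := h0
      simp only [Polynomial.eval_sub, Polynomial.eval_X, Polynomial.eval_C, sub_eq_zero] at h0
      rw [ZMod.natCast_eq_natCast_iff] at h0
      have h1 : i0.val ≡ i.val [MOD p] := Nat.ModEq.add_right_cancel' 1 h0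
      have h2 := Nat.ModEq.eq_of_lt_of_lt h1 (by omega) (by omega)
      exact (Finset.mem_erase.1 hi).1 (Fin.ext h2.symm)
    · exact h0
  · intro i _ hne
    by_cases hi : i ∈ S
    · have : P.eval ((i.val + 1 : ℕ) : ZMod p) = 0 := by
        rw [Polynomial.eval_prod]
        exact Finset.prod_eq_zero (Finset.mem_erase.2 ⟨hne, hi⟩) (by simp)
      rw [this, zero_mul]
    · rw [hd i hi, mul_zero]
  · simp

def stair (k n : ℕ) (f : Fin n → Fin (k + 1)) : Fin k → Fin n → Fin 2 :=
  fun i j => if (f j).val ≤ i.val then 1 else 0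

lemma stair_valid (k n : ℕ) (f : Fin n → Fin (k + 1)) : ValidSeq2 k n (stair k n f) := by
  intro j a b hab
  have : a.val ≤ b.val := hab
  simp only [stair]
  split_ifs <;> first | omega | simp

lemma stair_inj (k n : ℕ) : Function.Injective (stair k n) := by
  intro f g h
  funext j
  have key : ∀ i : Fin k, (f j).val ≤ i.val ↔ (g j).val ≤ i.val := by
    intro i
    have := congrFun (congrFun h i) j
    simp only [stair] at this
    by_cases h1 : (f j).val ≤ i.val <;> by_cases h2 : (g j).val ≤ i.val <;> simp [h1, h2] at this ⊢
  ext
  have hf := (f j).isLt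
  have hg := (g j).isLt
  by_contra hne
  rcases lt_or_gt_of_ne hne with hlt | hlt
  · have := key ⟨(f j).val, by omega⟩
    simp at this; omega
  · have := key ⟨(g j).val, by omega⟩
    simp at this; omega

/-- Theorem `thm_t1cdcc`: for a prime `p > max{k-1, n}` and residues
`a_0,…,a_{t-1} < p`, the code
`{c ∈ Φ_{2,k}^n : ∑_{i=1}^k iʲ·VT(c_i) ≡ a_j (mod p), j = 0,…,t-1}` is a
`t`-`(1,…,1)`-CDCC, and for some choice of residues its size is at least
`(k+1)^n/p^t`. -/
theorem stmt15 (k n t p : ℕ) (hk : 2 ≤ k) (hn : 3 ≤ n) (ht2 : 2 ≤ t) (htk : t ≤ k)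
    (hp : p.Prime) (hpk : k - 1 < p) (hpn : n < p) :
    (∀ a : Fin t → ℕ, (∀ j, a j < p) →
      IsTCDCC k n t {c : Fin k → Fin n → Fin 2 |
        ValidSeq2 k n c ∧
        ∀ j : Fin t, (∑ i : Fin k, (i.val + 1) ^ j.val * VT (c i)) % p = a j}) ∧
    ∃ a : Fin t → ℕ, (∀ j, a j < p) ∧
      ((k : ℝ) + 1) ^ n / (p : ℝ) ^ t ≤
        (Set.ncard {c : Fin k → Fin n → Fin 2 |
          ValidSeq2 k n c ∧
          ∀ j : Fin t, (∑ i : Fin k, (i.val + 1) ^ j.val * VT (c i)) % p = a j} : ℝ) := by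
  have hp0 : 0 < p := hp.pos
  constructor
  · intro a _
    refine ⟨fun c hc => hc.1, ?_⟩
    rintro c ⟨_, hc⟩ c' ⟨_, hc'⟩ hne
    rw [Set.disjoint_left]
    rintro y ⟨S, hS, hS1, hS2⟩ ⟨S', _, hS1', hS2'⟩
    apply hne
    have hSS : ∀ i, i ∈ S ↔ i ∈ S' := by
      intro i
      constructor
      · intro hi
        by_contra hi'
        have h1 := (hS1 i hi).1
        rw [hS2' i hi', List.length_ofFn] at h1
        omega
      · intro hi
        by_contra hi'
        have h1 := (hS1' i hi).1
        rw [hS2 i hi', List.length_ofFn] at h1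
        omega
    have hout : ∀ i ∉ S, c i = c' i := by
      intro i hi
      have h1 := hS2 i hi
      rw [hS2' i (fun h => hi ((hSS i).2 h))] at h1
      exact (List.ofFn_injective h1).symm
    have hd := vander k t p hp (by omega) S hS
      (fun i => (VT (c i) : ZMod p) - (VT (c' i) : ZMod p))
      (fun i hi => by simp [hout i hi])
      (fun j hj => by
        have h1 : (∑ i : Fin k, (i.val + 1) ^ j * VT (c i)) ≡
            (∑ i : Fin k, (i.val + 1) ^ j * VT (c' i)) [MOD p] :=
          (hc ⟨j, hj⟩).trans (hc' ⟨j, hj⟩).symm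
        rw [← ZMod.natCast_eq_natCast_iff] at h1
        simp_rw [mul_sub, Finset.sum_sub_distrib, sub_eq_zero]
        push_cast at h1 ⊢
        exact h1)
    funext i
    by_cases hi : i ∈ S
    swap
    · exact hout i hi
    have h1 := sub_eq_zero.1 (hd i)
    rw [ZMod.natCast_eq_natCast_iff] at h1
    have e : ∀ x : Fin n → Fin 2, vtl 1 (List.ofFn x) = VT x := fun x => vtl_ofFn x 1
    rw [← e, ← e] at h1
    have hy := (hS1 i hi).1
    apply List.ofFn_injective
    exact vt_list p _ _ (y i) (by rw [List.length_ofFn]; omega) (by rw [List.length_ofFn]; omega)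
      (by rw [List.length_ofFn]; omega) (hS1 i hi).2 (hS1' i ((hSS i).1 hi)).2 h1
  · classical
    let F : (Fin n → Fin (k + 1)) → (Fin t → Fin p) := fun f j =>
      ⟨(∑ i : Fin k, (i.val + 1) ^ j.val * VT (stair k n f i)) % p, Nat.mod_lt _ hp0⟩
    have : Nonempty (Fin t → Fin p) := ⟨fun _ => ⟨0, hp0⟩⟩
    obtain ⟨b, _, hb⟩ := Finset.exists_le_card_fiber_of_nsmul_le_card_of_maps_to
      (s := (Finset.univ : Finset (Fin n → Fin (k + 1)))) (t := (Finset.univ : Finset (Fin t → Fin p)))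
      (f := F) (b := ((k : ℝ) + 1) ^ n / (p : ℝ) ^ t)
      (fun _ _ => Finset.mem_univ _) Finset.univ_nonempty (by
        have : (p : ℝ) ≠ 0 := by positivity
        simp only [Finset.card_univ, Fintype.card_fun, Fintype.card_fin, nsmul_eq_mul]
        push_cast
        rw [mul_div_cancel₀]
        positivity)
    refine ⟨fun j => (b j).val, fun j => (b j).isLt, hb.trans ?_⟩
    rw [← Finset.card_image_of_injective _ (stair_inj k n), ← Set.ncard_coe_finset]
    apply Nat.cast_le.2
    apply Set.ncard_le_ncard _ (Set.toFinite _)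
    intro c hc
    simp only [Finset.coe_image, Set.mem_image, Finset.mem_coe, Finset.mem_filter] at hc
    obtain ⟨f, ⟨_, hf⟩, rfl⟩ := hc
    refine ⟨stair_valid k n f, fun j => ?_⟩
    rw [← hf]
end

section
/- Let k ≥ t ≥ 2 be integers. Let s_0 = min{ ⌊(t−1)·ln(k)/(2·ln(k) − ln(t))⌋ + 1, t−1 } and define f(k,t) = k if t = 2, f(k,t) = 2k if t = 3, and f(k,t) = t^{binom(s_0,2)}·k^{s_0(t−s_0)} if t ≥ 4. Let p be a prime with p > f(k,t). Then for every s with 1 ≤ s ≤ t and every choice of s row indices j_1 < … < j_s from {0,1,…,t−1} and s column indices i_1 < … < i_s from {1,2,…,k}, the s×s matrix over the finite field F_p whose (r,l)-entry is i_l^{j_r} (mod p) is invertible; i.e., every square submatrix of the t×k matrix ( i^j )_{0 ≤ j ≤ t−1, 1 ≤ i ≤ k} is invertible over F_p. -/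
open Finset in
lemma gv_key (D k : ℕ) : ∀ (s : ℕ) (j : Fin s → ℕ) (x : Fin s → ℕ), StrictMono j →
    (∀ r, r.val ≤ j r ∧ j r ≤ r.val + D) → (∀ c, 1 ≤ x c ∧ x c ≤ k) →
    ∃ S : ℕ, 1 ≤ S ∧ S ≤ (D+1)^(s.choose 2) * k^(s*D) ∧
      Matrix.det (Matrix.of fun r c : Fin s => (x c : ℤ)^(j r)) =
        (∏ i, ∏ c ∈ Ioi i, ((x c : ℤ) - x i)) * S := by
  intro s
  induction s with
  | zero => intro j x _ _ _; exact ⟨1, le_rfl, by simp, by simp⟩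
  | succ n ih =>
    intro j x hj hb hx
    have hjs : ∀ r : Fin n, j r.castSucc < j r.succ := fun r => hj Fin.castSucc_lt_succ
    let A : Fin n → Finset ℕ := fun r => Ico (j r.castSucc) (j r.succ)
    have hm : ∀ m ∈ Fintype.piFinset A, ∃ S : ℕ, 1 ≤ S ∧
        S ≤ (D+1)^(n.choose 2) * k^(n*D) ∧
        Matrix.det (Matrix.of fun r c : Fin n => (x c.succ : ℤ)^(m r)) =
        (∏ i, ∏ c ∈ Ioi i, ((x (Fin.succ c) : ℤ) - x (Fin.succ i))) * S := by
      intro m hm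
      have hm' : ∀ r, j r.castSucc ≤ m r ∧ m r < j r.succ := by
        intro r
        simpa [A] using (Fintype.mem_piFinset.1 hm r)
      refine ih m (fun c => x c.succ) ?_ ?_ (fun c => hx _)
      · cases n with
        | zero => intro a; exact a.elim0
        | succ n =>
          rw [Fin.strictMono_iff_lt_succ]
          intro i
          have h1 := (hm' i.castSucc).2
          have h2 := (hm' i.succ).1
          rw [← Fin.succ_castSucc] at h2
          omega
      · intro r
        have h1 := hm' r
        have h2 := hb r.castSucc
        have h3 := hb r.succ
        simp at h2 h3
        omega
    choose! S hS1 hS2 hS3 using hm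
    let e : (Fin n → ℕ) → ℕ := fun m => ∑ r, (j r.succ - 1 - m r)
    have hdet : Matrix.det (Matrix.of fun r c : Fin (n+1) => (x c : ℤ)^(j r)) =
        (x 0 : ℤ)^(j 0) * ((∏ c : Fin n, ((x c.succ : ℤ) - x 0)) *
          ∑ m ∈ Fintype.piFinset A, (x 0 : ℤ)^(e m) *
            Matrix.det (Matrix.of fun r c : Fin n => (x c.succ : ℤ)^(m r))) := by
      let B : Matrix (Fin (n+1)) (Fin (n+1)) ℤ := Matrix.of fun r c =>
        Fin.cases ((x c : ℤ)^(j 0))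
          (fun r' => (x c : ℤ)^(j r'.succ) - (x 0 : ℤ)^(j r'.succ - j r'.castSucc) * (x c : ℤ)^(j r'.castSucc)) r
      have h1 : Matrix.det (Matrix.of fun r c : Fin (n+1) => (x c : ℤ)^(j r)) = B.det := by
        apply Matrix.det_eq_of_forall_row_eq_smul_add_pred (fun r => (x 0 : ℤ)^(j r.succ - j r.castSucc))
        · intro c; simp [B]
        · intro r c; simp [B]
      rw [h1, Matrix.det_succ_column_zero, Fin.sum_univ_succ]
      have hz : ∀ i : Fin n, B i.succ 0 = 0 := by
        intro i
        simp only [B, Matrix.of_apply, Fin.cases_succ]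
        rw [← pow_add, Nat.sub_add_cancel (hjs i).le, sub_self]
      simp only [hz, mul_zero, zero_mul, Finset.sum_const_zero, add_zero]
      have h2 : B 0 0 = (x 0 : ℤ)^(j 0) := by simp [B]
      rw [h2]
      simp only [Fin.val_zero, pow_zero, one_mul]
      congr 1
      let C : Matrix (Fin n) (Fin n) ℤ := fun r => ∑ m ∈ A r,
        (x 0 : ℤ)^(j r.succ - 1 - m) • (fun c : Fin n => (x c.succ : ℤ)^m)
      have h3 : B.submatrix (Fin.succAbove 0) Fin.succ =
          Matrix.of fun r c => ((x c.succ : ℤ) - x 0) * C r c := by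
        ext r c
        simp only [B, C, Matrix.submatrix_apply, Matrix.of_apply, Fin.zero_succAbove, Fin.cases_succ,
          Finset.sum_apply, Pi.smul_apply, smul_eq_mul]
        have := (Commute.all (x c.succ : ℤ) (x 0)).mul_geom_sum₂_Ico (hjs r).le
        rw [mul_comm ((x 0 : ℤ)^(j r.succ - j r.castSucc)), ← this]
        congr 1
        apply Finset.sum_congr rfl
        intro m _
        rw [mul_comm]
      rw [h3, Matrix.det_mul_row]
      congr 1
      have h4 := (Matrix.detRowAlternating (n := Fin n) (R := ℤ)).toMultilinearMap.map_sum_finset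
        (fun r m => (x 0 : ℤ)^(j r.succ - 1 - m) • (fun c : Fin n => (x c.succ : ℤ)^m)) A
      refine Eq.trans h4 ?_
      apply Finset.sum_congr rfl
      intro m _
      rw [MultilinearMap.map_smul_univ, Finset.prod_pow_eq_pow_sum, smul_eq_mul]
      rfl
    have hx0 : 0 < x 0 := (hx 0).1
    refine ⟨∑ m ∈ Fintype.piFinset A, x 0 ^ (j 0 + e m) * S m, ?_, ?_, ?_⟩
    · have hne : (fun r : Fin n => j r.castSucc) ∈ Fintype.piFinset A := by
        rw [Fintype.mem_piFinset]; intro r; simp [A, hjs r]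
      have := Finset.single_le_sum (f := fun m => x 0 ^ (j 0 + e m) * S m)
        (fun _ _ => Nat.zero_le _) hne
      refine le_trans ?_ this
      exact Nat.mul_pos (pow_pos hx0 _) (hS1 _ hne)
    · have hterm : ∀ m ∈ Fintype.piFinset A, x 0 ^ (j 0 + e m) * S m ≤
          k^D * ((D+1)^(n.choose 2) * k^(n*D)) := by
        intro m hm
        refine Nat.mul_le_mul ?_ (hS2 m hm)
        have hm' : ∀ r, j r.castSucc ≤ m r ∧ m r < j r.succ := by
          intro r
          simpa [A] using (Fintype.mem_piFinset.1 hm r)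
        have he : j 0 + e m ≤ D := by
          have h1 : ∑ r : Fin n, ((j r.succ - 1 - m r) + j r.castSucc + 1) ≤ ∑ r : Fin n, j r.succ := by
            apply Finset.sum_le_sum
            intro r _
            have := hm' r
            omega
          simp only [Finset.sum_add_distrib, Finset.sum_const, Finset.card_univ, Fintype.card_fin, smul_eq_mul, mul_one] at h1
          have h2 := Fin.sum_univ_succ j
          have h3 := Fin.sum_univ_castSucc j
          have h4 := (hb (Fin.last n)).2
          simp only [Fin.val_last] at h4
          simp only [e]
          omega
        exact (Nat.pow_le_pow_right hx0 he).trans (Nat.pow_le_pow_left (hx 0).2 _)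
      refine (Finset.sum_le_card_nsmul _ _ _ hterm).trans ?_
      have hcard : (Fintype.piFinset A).card ≤ (D+1)^n := by
        rw [Fintype.card_piFinset]
        refine (Finset.prod_le_pow_card _ _ (D+1) ?_).trans (by simp)
        intro r _
        have h2 := hb r.castSucc
        have h3 := hb r.succ
        simp at h2 h3
        simp [A]
        omega
      rw [smul_eq_mul]
      refine (Nat.mul_le_mul_right _ hcard).trans (le_of_eq ?_)
      have hc : (n+1).choose 2 = n + n.choose 2 := by
        rw [Nat.choose_succ_succ' n 1, Nat.choose_one_right]
      rw [hc]; ring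
    · rw [hdet, Fin.prod_univ_succ, Fin.prod_Ioi_zero]
      simp only [Fin.prod_Ioi_succ]
      push_cast
      rw [Finset.sum_congr rfl (fun m hm => by rw [hS3 m hm])]
      rw [mul_left_comm, mul_assoc]
      congr 1
      rw [Finset.mul_sum, Finset.mul_sum]
      apply Finset.sum_congr rfl
      intro m _
      ring

lemma gv_gap {s : ℕ} (j : Fin s → ℕ) (hj : StrictMono j) :
    ∀ (n : ℕ) (a b : Fin s), b.val = a.val + n → j a + n ≤ j b := by
  intro n
  induction n with
  | zero => intro a b h; have : b = a := Fin.ext (by simpa using h); simp [this]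
  | succ n ih =>
    intro a b h
    have h1 := ih a ⟨a.val + n, by omega⟩ rfl
    have h2 : j ⟨a.val + n, by omega⟩ < j b := hj (by rw [Fin.lt_def]; simp; omega)
    omega

lemma gv_max (k t : ℕ) (ht : 2 ≤ t) (htk : t ≤ k) (s₀ : ℕ)
    (hs₀ : s₀ = min
      (Nat.floor (((t : ℝ) - 1) * Real.log k / (2 * Real.log k - Real.log t)) + 1)
      (t - 1)) (s : ℕ) (hs1 : 1 ≤ s) (hst : s ≤ t - 1) :
    t ^ (s.choose 2) * k ^ (s * (t - s)) ≤ t ^ (s₀.choose 2) * k ^ (s₀ * (t - s₀)) := by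
  have ht0 : (0:ℝ) < t := by exact_mod_cast (by omega : 0 < t)
  have hk0 : (0:ℝ) < k := by exact_mod_cast (by omega : 0 < k)
  have hK : 0 < Real.log k := Real.log_pos (by exact_mod_cast (by omega : 1 < k))
  have hTK : Real.log t ≤ Real.log k := Real.log_le_log ht0 (by exact_mod_cast htk)
  set K := Real.log k with hKd
  set T := Real.log t with hTd
  have hA : 0 < 2 * K - T := by linarith
  set q := ((t : ℝ) - 1) * K / (2 * K - T) with hq
  have hqA : q * (2*K - T) = ((t:ℝ) - 1) * K := by
    rw [hq]; exact div_mul_cancel₀ _ hA.ne'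
  have hq0 : 0 ≤ q := by
    rw [hq]
    have : (1:ℝ) ≤ t := by exact_mod_cast (by omega : 1 ≤ t)
    exact div_nonneg (mul_nonneg (by linarith) hK.le) hA.le
  have hfl := Nat.floor_le hq0
  have hfl2 := Nat.lt_floor_add_one q
  set F := Nat.floor q
  have hs0t : s₀ ≤ t - 1 := by omega
  have hs01 : 1 ≤ s₀ := by omega
  have key : ∀ a : ℕ, a ≤ t → Real.log ((t ^ (a.choose 2) * k ^ (a * (t - a)) : ℕ) : ℝ)
      = (a:ℝ) * (a - 1) / 2 * T + a * (t - a) * K := by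
    intro a ha
    push_cast
    rw [Real.log_mul (by positivity) (by positivity), Real.log_pow, Real.log_pow]
    push_cast [Nat.cast_choose_two, Nat.cast_sub ha]
    ring
  have hpos : ∀ a : ℕ, (0:ℝ) < ((t ^ (a.choose 2) * k ^ (a * (t - a)) : ℕ) : ℝ) := by
    intro a; push_cast; positivity
  rw [← Nat.cast_le (α := ℝ), ← Real.log_le_log_iff (hpos _) (hpos _), key s (by omega), key s₀ (by omega)]
  have hid : ((s₀:ℝ) * (s₀ - 1) / 2 * T + s₀ * (t - s₀) * K) - ((s:ℝ) * (s - 1) / 2 * T + s * (t - s) * K)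
      = ((s₀:ℝ) - s) * (2*K-T) * (q - ((s₀:ℝ) + s - 1)/2) := by
    linear_combination (-((s₀:ℝ) - s)) * hqA
  rcases lt_trichotomy s s₀ with h | h | h
  · have h1 : (s:ℝ) + 1 ≤ s₀ := by exact_mod_cast h
    have h2 : (s₀:ℝ) ≤ F + 1 := by exact_mod_cast (by omega : s₀ ≤ F + 1)
    have : 0 ≤ ((s₀:ℝ) - s) * (2*K-T) * (q - ((s₀:ℝ) + s - 1)/2) :=
      mul_nonneg (mul_nonneg (by linarith) hA.le) (by linarith)
    linarith
  · subst h; exact le_rfl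
  · have h1 : (s₀:ℝ) + 1 ≤ s := by exact_mod_cast h
    have h2 : (s₀:ℝ) = F + 1 := by exact_mod_cast (by omega : s₀ = F + 1)
    have : 0 ≤ ((s₀:ℝ) - s) * (2*K-T) * (q - ((s₀:ℝ) + s - 1)/2) :=
      mul_nonneg_of_nonpos_of_nonpos (mul_nonpos_of_nonpos_of_nonneg (by linarith) hA.le) (by linarith)
    linarith

/-- Lemma `lem_subvanmatrix`: for `k ≥ t ≥ 2`, with
`s₀ = min{⌊(t-1)ln k / (2 ln k - ln t)⌋ + 1, t-1}` and
`f(k,t) = k` if `t = 2`, `2k` if `t = 3`, and `t^{C(s₀,2)} k^{s₀(t-s₀)}` if `t ≥ 4`,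
for every prime `p > f(k,t)`, every square submatrix of the `t × k` matrix
`(i^j)_{0 ≤ j ≤ t-1, 1 ≤ i ≤ k}` is invertible over `F_p`. -/
theorem stmt16 (k t : ℕ) (ht : 2 ≤ t) (htk : t ≤ k)
    (s₀ : ℕ)
    (hs₀ : s₀ = min
      (Nat.floor (((t : ℝ) - 1) * Real.log k / (2 * Real.log k - Real.log t)) + 1)
      (t - 1))
    (f : ℕ)
    (hf : f = if t = 2 then k else if t = 3 then 2 * k
      else t ^ (Nat.choose s₀ 2) * k ^ (s₀ * (t - s₀)))
    (p : ℕ) (hp : p.Prime) (hpf : f < p)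
    (s : ℕ) (hs1 : 1 ≤ s) (hst : s ≤ t)
    (jj : Fin s → Fin t) (hjj : StrictMono jj)
    (ii : Fin s → Fin k) (hii : StrictMono ii) :
    IsUnit (Matrix.det (Matrix.of fun r c : Fin s =>
      ((((ii c).val + 1 : ℕ) : ZMod p) ^ (jj r).val))) := by
  have : Fact p.Prime := ⟨hp⟩
  rw [isUnit_iff_ne_zero]
  have hs0t : s₀ ≤ t - 1 := by omega
  have hs01 : 1 ≤ s₀ := by omega
  have hkp : k < p := by
    refine lt_of_le_of_lt ?_ hpf
    rw [hf]
    split_ifs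
    · exact le_rfl
    · omega
    · have h1 : 1 ≤ t ^ (Nat.choose s₀ 2) := Nat.one_le_pow _ _ (by omega)
      have h2 : k ^ 1 ≤ k ^ (s₀ * (t - s₀)) :=
        Nat.pow_le_pow_right (by omega) (Nat.mul_pos (by omega) (by omega))
      nlinarith
  have hnz : ∀ n : ℕ, 0 < n → n < p → (n : ZMod p) ≠ 0 := by
    intro n h0 h1 h
    rw [ZMod.natCast_eq_zero_iff] at h
    exact absurd (Nat.le_of_dvd h0 h) (by omega)
  have hxnz : ∀ c, (((ii c).val + 1 : ℕ) : ZMod p) ≠ 0 := fun c =>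
    hnz _ (by omega) (by have := (ii c).isLt; omega)
  have hdiff : ∀ a b : Fin s, a < b →
      (((ii b).val + 1 : ℕ) : ZMod p) - (((ii a).val + 1 : ℕ) : ZMod p) ≠ 0 := by
    intro a b hab
    have h1 : (ii a).val < (ii b).val := hii hab
    rw [← Nat.cast_sub (by omega)]
    exact hnz _ (by omega) (by have := (ii b).isLt; omega)
  by_cases hs : s = 1
  · subst hs
    rw [Matrix.det_fin_one]
    exact pow_ne_zero _ (hxnz _)
  by_cases h32 : t = 3 ∧ s = 2
  · obtain ⟨h3, h2⟩ := h32
    subst h3 h2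
    have hd := hdiff 0 1 (by decide)
    have h0 := hxnz 0
    have h1 := hxnz 1
    have hsum : (((ii 0).val + 1 : ℕ) : ZMod p) + (((ii 1).val + 1 : ℕ) : ZMod p) ≠ 0 := by
      rw [← Nat.cast_add]
      have h1 : (ii 0).val < (ii 1).val := hii (by decide)
      have := (ii 1).isLt
      simp at hf
      exact hnz _ (by omega) (by omega)
    have hj01 : (jj 0).val < (jj 1).val := hjj (by decide)
    have hj1 := (jj 1).isLt
    rw [Matrix.det_fin_two]
    simp only [Matrix.of_apply]
    generalize (((ii 0).val + 1 : ℕ) : ZMod p) = x at *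
    generalize (((ii 1).val + 1 : ℕ) : ZMod p) = y at *
    have hc : ((jj 0).val = 0 ∧ (jj 1).val = 1) ∨ ((jj 0).val = 0 ∧ (jj 1).val = 2) ∨
      ((jj 0).val = 1 ∧ (jj 1).val = 2) := by omega
    rcases hc with ⟨ha, hb⟩ | ⟨ha, hb⟩ | ⟨ha, hb⟩ <;> rw [ha, hb]
    · convert hd using 1; ring
    · convert mul_ne_zero hd hsum using 1; ring
    · convert mul_ne_zero (mul_ne_zero h0 h1) hd using 1; ring
  have hj' : StrictMono (fun r => (jj r).val) := fun a b h => hjj h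
  obtain ⟨S, hS1, hS2, hS3⟩ := gv_key (t - s) k s (fun r => (jj r).val) (fun c => (ii c).val + 1) hj'
    (by
      intro r
      have h1 := gv_gap _ hj' r.val ⟨0, by omega⟩ r (by simp)
      have h2 := gv_gap _ hj' (s - 1 - r.val) r ⟨s - 1, by omega⟩ (by simp; omega)
      have h3 := (jj ⟨s - 1, by omega⟩).isLt
      have h4 := r.isLt
      omega)
    (by intro c; have := (ii c).isLt; constructor <;> omega)
  have hSp : S < p := by
    by_cases hst' : s = t
    · subst hst'
      simp at hS2
      omega
    · refine lt_of_le_of_lt (hS2.trans ?_) hpf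
      rw [hf, if_neg (by omega), if_neg (by omega)]
      refine le_trans ?_ (gv_max k t ht htk s₀ hs₀ s hs1 (by omega))
      exact Nat.mul_le_mul_right _ (Nat.pow_le_pow_left (by omega) _)
  have hcast := congrArg (Int.castRingHom (ZMod p)) hS3
  rw [RingHom.map_det, map_mul, map_prod] at hcast
  have hmat : (Int.castRingHom (ZMod p)).mapMatrix
      (Matrix.of fun r c : Fin s => (((ii c).val + 1 : ℕ) : ℤ) ^ (jj r).val) =
      Matrix.of fun r c : Fin s => ((((ii c).val + 1 : ℕ) : ZMod p) ^ (jj r).val) := by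
    ext r c
    simp
  rw [hmat] at hcast
  rw [hcast]
  refine mul_ne_zero ?_ ?_
  · rw [Finset.prod_ne_zero_iff]
    intro a _
    rw [map_prod, Finset.prod_ne_zero_iff]
    intro b hb
    have := hdiff a b (Finset.mem_Ioi.1 hb)
    simpa using this
  · have := hnz S hS1 hSp
    simpa using this
end

section
/- Let q ≥ 2 and n ≥ 1 be integers. Suppose x, x′ ∈ Σ_q^n satisfy VT(x) ≡ VT(x′) (mod 2n(q−1)) and Σ_{i=1}^n x[i] ≡ Σ_{i=1}^n x′[i] (mod q). If there exists z ∈ Σ_q^n with d_H(x, z) ≤ 1 and d_H(x′, z) ≤ 1, then x = x′. Consequently, any x ∈ Σ_q^n can be decoded from any sequence obtained from it by at most one substitution, given the values VT(x) mod 2n(q−1) and (Σ_i x[i]) mod q. -/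
theorem aux_hd {q n : ℕ} (hn : 1 ≤ n) (x z : Fin n → Fin q) (h : hammingDist x z ≤ 1) :
    ∃ i, ∀ k, k ≠ i → x k = z k := by
  unfold hammingDist at h
  rw [Finset.card_le_one] at h
  by_cases hx : ∃ i, x i ≠ z i
  · obtain ⟨i, hi⟩ := hx
    refine ⟨i, fun k hk => ?_⟩
    by_contra hne
    exact hk (h k (by simpa using hne) i (by simpa using hi))
  · push Not at hx
    exact ⟨⟨0, hn⟩, fun k _ => hx k⟩

theorem aux_arith (i j n q a b : ℤ) (hi : 1 ≤ i) (hj : 1 ≤ j) (hin : i ≤ n) (hjn : j ≤ n)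
    (hij : i ≠ j) (hq : 2 ≤ q) (ha : |a| ≤ q - 1) (hb : |b| ≤ q - 1)
    (h1 : 2 * n * (q - 1) ∣ i * a + j * b) (h2 : q ∣ a + b) : a = 0 ∧ b = 0 := by
  have e1 : i * a + j * b = 0 := by
    apply Int.eq_zero_of_abs_lt_dvd h1
    have t1 : |i * a + j * b| ≤ i * |a| + j * |b| := by
      refine (abs_add_le _ _).trans ?_
      rw [abs_mul, abs_mul, abs_of_pos (by omega : 0 < i), abs_of_pos (by omega : 0 < j)]
    have t2 : i * |a| ≤ i * (q - 1) := by gcongr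
    have t3 : j * |b| ≤ j * (q - 1) := by gcongr
    have t4 : (i + j) * (q - 1) < 2 * n * (q - 1) := by
      apply mul_lt_mul_of_pos_right <;> omega
    linarith
  rw [abs_le] at ha hb
  have e2 : a + b = 0 := by
    apply Int.eq_zero_of_abs_lt_dvd h2
    rw [abs_lt]
    rcases lt_trichotomy a 0 with h | h | h
    · have : 0 < b := by
        by_contra hc
        nlinarith
      omega
    · omega
    · have : b < 0 := by
        by_contra hc
        nlinarith
      omega
  have e3 : b = -a := by omega
  subst e3
  have : (i - j) * a = 0 := by linarith
  rcases mul_eq_zero.1 this with h | h <;> omega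

/-- Lemma `lem_qary1sub`: if `x, x' ∈ Σ_q^n` have the same `VT` weight modulo
`2n(q-1)` and the same symbol sum modulo `q`, and some `z ∈ Σ_q^n` is within
Hamming distance `1` of both, then `x = x'`. Hence `x` can be decoded from any
word obtained from it by at most one substitution, given `VT(x) mod 2n(q-1)` and
`(∑ x[i]) mod q`. -/
theorem stmt19 (q n : ℕ) (hq : 2 ≤ q) (hn : 1 ≤ n) (x x' : Fin n → Fin q)
    (h1 : (∑ i : Fin n, (i.val + 1) * (x i).val) ≡
      (∑ i : Fin n, (i.val + 1) * (x' i).val) [MOD 2 * n * (q - 1)])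
    (h2 : (∑ i : Fin n, (x i).val) ≡ (∑ i : Fin n, (x' i).val) [MOD q])
    (h3 : ∃ z : Fin n → Fin q, hammingDist x z ≤ 1 ∧ hammingDist x' z ≤ 1) :
    x = x' := by
  obtain ⟨z, hz, hz'⟩ := h3
  obtain ⟨i, hi⟩ := aux_hd hn x z hz
  obtain ⟨j, hj⟩ := aux_hd hn x' z hz'
  have key : ∀ k, k ≠ i → k ≠ j → x k = x' k := fun k h h' => (hi k h).trans (hj k h').symm
  have d1 := (Nat.modEq_iff_dvd.1 h1.symm)
  have d2 := (Nat.modEq_iff_dvd.1 h2.symm)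
  push_cast [Nat.cast_sub (show 1 ≤ q by omega)] at d1 d2
  rw [← Finset.sum_sub_distrib] at d1 d2
  have hz0 : ∀ k, k ≠ i → k ≠ j → ((x k : ℕ) : ℤ) - ((x' k : ℕ) : ℤ) = 0 := by
    intro k h h'
    rw [key k h h', sub_self]
  have hz1 : ∀ k, k ≠ i → k ≠ j →
      (((k : ℕ) : ℤ) + 1) * ((x k : ℕ) : ℤ) - (((k : ℕ) : ℤ) + 1) * ((x' k : ℕ) : ℤ) = 0 := by
    intro k h h'
    rw [key k h h', sub_self]
  have hbd : ∀ k, |((x k : ℕ) : ℤ) - ((x' k : ℕ) : ℤ)| ≤ (q : ℤ) - 1 := by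
    intro k
    have := (x k).isLt
    have := (x' k).isLt
    rw [abs_le]
    omega
  have fin : ∀ i j : Fin n, i ≠ j → (∀ k, k ≠ i → k ≠ j → x k = x' k) → x = x' := by
    intro i j hij key
    rw [Finset.sum_eq_add i j hij (fun k _ hk => by rw [key k hk.1 hk.2, sub_self])
      (by simp) (by simp)] at d1 d2
    rw [← mul_sub, ← mul_sub] at d1
    have hi := i.isLt
    have hj := j.isLt
    have hij' : (i : ℕ) ≠ j := fun h => hij (Fin.ext h)
    obtain ⟨ha, hb⟩ := aux_arith _ _ n q _ _ (by omega) (by omega) (by omega) (by omega)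
      (by omega) (by omega) (hbd i) (hbd j) d1 d2
    funext k
    by_cases h : k = i
    · subst h; exact Fin.ext (by omega)
    by_cases h' : k = j
    · subst h'; exact Fin.ext (by omega)
    exact key k h h'
  by_cases hij : i = j
  · subst hij
    by_cases h : ∃ j, i ≠ j
    · obtain ⟨j, hj⟩ := h
      exact fin i j hj (fun k h _ => key k h h)
    · push Not at h
      rw [Finset.sum_eq_single i (fun k _ hk => absurd (h k).symm hk) (by simp)] at d2
      have := Int.eq_zero_of_abs_lt_dvd d2 (by have := hbd i; omega)
      funext k
      rw [← h k]
      exact Fin.ext (by omega)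
  · exact fin i j hij key
end
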